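/- Let f be a complex polynomial of degree d ≥ 2 such that every critical point c of f that lies in a wandering connected component of the filled-in Julia set K_f is non-recurrent, i.e. c does not belong to its own ω-limit set ω(c) under iteration of f. Then every wandering connected component of K_f is a single point. -/

import Mathlib

namespace Wandering

open Set Filter Topology Polynomial MeasureTheory Metric
open scoped ENNReal

/-- Twice the real-linear `∂̄`-derivative of a function on the plane. -/
noncomputable def dbar (u : ℂ → ℂ) (z : ℂ) : ℂ :=
  fderiv ℝ u z 1 + Complex.I * fderiv ℝ u z Complex.I

lemma integral_fderiv_eq_zero_of_compact {u : ℂ → ℂ} (hu : ContDiff ℝ 1 u)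
    (hc : HasCompactSupport u) (v : ℂ) : ∫ z, fderiv ℝ u z v = 0 := by
  have hcf : HasCompactSupport (fun z => fderiv ℝ u z v) := hc.fderiv_apply (𝕜 := ℝ) v
  have hcont : Continuous (fun z => fderiv ℝ u z v) :=
    (hu.continuous_fderiv one_ne_zero).clm_apply continuous_const
  have := integral_bilinear_hasLineDerivAt_right_eq_neg_left_of_integrable
    (μ := (volume : Measure ℂ)) (f := fun _ : ℂ => (1 : ℂ)) (f' := fun _ => 0) (g := u)
    (g' := fun z => fderiv ℝ u z v) (v := v) (B := ContinuousLinearMap.mul ℝ ℂ)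
    (by simp) (by simpa using hcont.integrable_of_hasCompactSupport hcf)
    (by simpa using hu.continuous.integrable_of_hasCompactSupport hc)
    (fun x _ => (hasFDerivAt_const (1:ℂ) x).hasLineDerivAt v)
    (fun x _ => ((hu.differentiable one_ne_zero x).hasFDerivAt).hasLineDerivAt v)
  simpa using this

lemma integral_dbar_mul_eq_zero {φ g : ℂ → ℂ} {Ω : Set ℂ} (hΩ : IsOpen Ω)
    (hφ : ContDiff ℝ 1 φ) (hc : HasCompactSupport φ) (hs : tsupport φ ⊆ Ω)
    (hg : DifferentiableOn ℂ g Ω) : ∫ z, dbar φ z * g z = 0 := by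
  have hu : ContDiff ℝ 1 (fun z => φ z * g z) := by
    rw [contDiff_iff_contDiffAt]
    intro z
    by_cases hz : z ∈ Ω
    · have h1 : ContDiffAt ℂ 1 g z := (hg.contDiffOn hΩ).contDiffAt (hΩ.mem_nhds hz)
      exact hφ.contDiffAt.mul (h1.restrict_scalars ℝ)
    · have : (fun z => φ z * g z) =ᶠ[𝓝 z] fun _ => 0 := by
        have h2 : z ∉ tsupport φ := fun h => hz (hs h)
        filter_upwards [(isClosed_tsupport φ).isOpen_compl.mem_nhds h2] with y hy
        rw [image_eq_zero_of_notMem_tsupport hy, zero_mul]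
      exact contDiffAt_const.congr_of_eventuallyEq this
  have hcu : HasCompactSupport (fun z => φ z * g z) := hc.mul_right
  have key : ∀ z, dbar φ z * g z = dbar (fun z => φ z * g z) z := by
    intro z
    by_cases hz : z ∈ Ω
    · have h1 : DifferentiableAt ℂ g z := hg.differentiableAt (hΩ.mem_nhds hz)
      have h2 : HasFDerivAt g ((fderiv ℂ g z).restrictScalars ℝ) z :=
        h1.hasFDerivAt.restrictScalars ℝ
      have h3 : HasFDerivAt φ (fderiv ℝ φ z) z :=
        (hφ.differentiable one_ne_zero z).hasFDerivAt
      have h4 : fderiv ℝ (fun z => φ z * g z) z = _ := (h3.mul h2).fderiv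
      have h5 : fderiv ℂ g z Complex.I = Complex.I * fderiv ℂ g z 1 := by
        simp
      unfold dbar
      rw [h4]
      simp only [add_apply, smul_apply,
        ContinuousLinearMap.coe_restrictScalars', h5, smul_eq_mul]
      ring_nf
      simp [Complex.I_sq]
    · have h2 : z ∉ tsupport φ := fun h => hz (hs h)
      have e1 : φ =ᶠ[𝓝 z] fun _ => 0 := by
        filter_upwards [(isClosed_tsupport φ).isOpen_compl.mem_nhds h2] with y hy
        exact image_eq_zero_of_notMem_tsupport hy
      have e2 : (fun z => φ z * g z) =ᶠ[𝓝 z] fun _ => 0 := by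
        filter_upwards [e1] with y hy
        rw [hy, zero_mul]
      simp [dbar, e1.fderiv_eq, e2.fderiv_eq]
  simp_rw [key, dbar]
  have hcont : ∀ v, Integrable (fun z => fderiv ℝ (fun z => φ z * g z) z v) := fun v =>
    ((hu.continuous_fderiv one_ne_zero).clm_apply continuous_const).integrable_of_hasCompactSupport
      (hcu.fderiv_apply (𝕜 := ℝ) v)
  rw [integral_add (hcont 1) ((hcont _).const_mul _), integral_const_mul,
    integral_fderiv_eq_zero_of_compact hu hcu, integral_fderiv_eq_zero_of_compact hu hcu]
  simp

/-- A smooth radial bump: `1` on `|z|² ≤ 1` and `0` for `|z|² ≥ 2`. -/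
noncomputable def bump (z : ℂ) : ℂ := ((Real.smoothTransition (2 - Complex.normSq z) : ℝ) : ℂ)

lemma contDiff_normSq : ContDiff ℝ 1 (fun z : ℂ => Complex.normSq z) := by
  have : (fun z : ℂ => Complex.normSq z) = fun z => Complex.reCLM z * Complex.reCLM z +
      Complex.imCLM z * Complex.imCLM z := by
    ext z; simp [Complex.normSq_apply]
  rw [this]
  exact (Complex.reCLM.contDiff.mul Complex.reCLM.contDiff).add
    (Complex.imCLM.contDiff.mul Complex.imCLM.contDiff)

lemma contDiff_smoothTransition_normSq (a b : ℝ) (G : ℂ → ℂ) (hG : ContDiff ℝ 1 G) :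
    ContDiff ℝ 1 (fun z => ((Real.smoothTransition (a - b * Complex.normSq (G z)) : ℝ) : ℂ)) := by
  have h1 : ContDiff ℝ 1 (fun z => a - b * Complex.normSq (G z)) :=
    contDiff_const.sub (contDiff_const.mul (contDiff_normSq.comp hG))
  exact Complex.ofRealCLM.contDiff.comp (Real.smoothTransition.contDiff.comp h1)

lemma contDiff_bump : ContDiff ℝ 1 bump := by
  have := contDiff_smoothTransition_normSq 2 1 (fun z => z) contDiff_id
  simp only [one_mul] at this
  exact this

lemma bump_eq_one {z : ℂ} (hz : ‖z‖ ≤ 1) : bump z = 1 := by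
  rw [bump, Real.smoothTransition.one_of_one_le]
  · simp
  · rw [Complex.normSq_eq_norm_sq]; nlinarith [norm_nonneg z]

lemma bump_eq_zero {z : ℂ} (hz : 2 ≤ ‖z‖) : bump z = 0 := by
  rw [bump, Real.smoothTransition.zero_of_nonpos]
  · simp
  · rw [Complex.normSq_eq_norm_sq]; nlinarith [norm_nonneg z]

lemma hasCompactSupport_bump : HasCompactSupport bump := by
  refine HasCompactSupport.of_support_subset_isCompact (isCompact_closedBall (0:ℂ) 2) ?_
  intro z hz
  by_contra h
  simp only [mem_closedBall, dist_zero_right, not_le] at h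
  exact hz (bump_eq_zero h.le)

lemma hasDerivAt_normSq_dir (z : ℂ) :
    HasFDerivAt (fun z : ℂ => Complex.normSq z)
      ((2 * z.re) • Complex.reCLM + (2 * z.im) • Complex.imCLM) z := by
  have : (fun z : ℂ => Complex.normSq z) = fun z => Complex.reCLM z * Complex.reCLM z +
      Complex.imCLM z * Complex.imCLM z := by
    ext z; simp [Complex.normSq_apply]
  rw [this]
  have h := (Complex.reCLM.hasFDerivAt (x := z)).mul (Complex.reCLM.hasFDerivAt (x := z))
  have h' := (Complex.imCLM.hasFDerivAt (x := z)).mul (Complex.imCLM.hasFDerivAt (x := z))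
  refine (h.add h').congr_fderiv ?_
  ext; simp; ring

lemma dbar_bump (z : ℂ) :
    dbar bump z = ((-2 * deriv Real.smoothTransition (2 - Complex.normSq z) : ℝ) : ℂ) * z := by
  have h0 : HasDerivAt Real.smoothTransition (deriv Real.smoothTransition (2 - Complex.normSq z))
      (2 - Complex.normSq z) :=
    ((Real.smoothTransition.contDiff (n := 1)).differentiable one_ne_zero _).hasDerivAt
  have h1 := h0.comp_hasFDerivAt z ((hasDerivAt_normSq_dir z).const_sub 2)
  have h2 : HasFDerivAt bump _ z := Complex.ofRealCLM.hasFDerivAt.comp z h1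
  rw [dbar, h2.fderiv]
  apply Complex.ext <;> (simp; ring)

/-- The normalising constant of the Cauchy–Pompeiu formula. -/
noncomputable def pompeiuConst : ℂ := ∫ z : ℂ, dbar bump z / z

lemma pompeiuConst_ne_zero : pompeiuConst ≠ 0 := by
  have hcont : Continuous (deriv Real.smoothTransition) :=
    (Real.smoothTransition.contDiff (n := 1)).continuous_deriv le_rfl
  let g : ℂ → ℝ := fun z => deriv Real.smoothTransition (2 - Complex.normSq z)
  have hg : Continuous g := hcont.comp (continuous_const.sub Complex.continuous_normSq)
  have hg0 : ∀ z, 0 ≤ g z := fun z => Real.smoothTransition.monotone.deriv_nonneg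
  have e : pompeiuConst = ((-2 * ∫ z : ℂ, g z : ℝ) : ℂ) := by
    rw [pompeiuConst, Complex.ofReal_mul, ← integral_complex_ofReal, ← integral_const_mul]
    refine integral_congr_ae ?_
    have : ∀ᵐ z : ℂ, z ≠ 0 := by
      simp [ae_iff]
    filter_upwards [this] with z hz
    rw [dbar_bump, mul_div_cancel_right₀ _ hz]
    simp [g]
  have hcs : HasCompactSupport g := by
    refine HasCompactSupport.of_support_subset_isCompact (isCompact_closedBall (0:ℂ) 2) ?_
    intro z hz
    by_contra h
    simp only [mem_closedBall, dist_zero_right, not_le] at h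
    refine hz ?_
    have : Real.smoothTransition =ᶠ[𝓝 (2 - Complex.normSq z)] fun _ => 0 := by
      have : 2 - Complex.normSq z < 0 := by
        rw [Complex.normSq_eq_norm_sq]; nlinarith
      filter_upwards [Iio_mem_nhds this] with t ht
      exact Real.smoothTransition.zero_of_nonpos (le_of_lt ht)
    simp [g, this.deriv_eq]
  rw [e]
  intro h0
  have h1 : ∫ z : ℂ, g z = 0 := by
    have : (-2 * ∫ z : ℂ, g z : ℝ) = 0 := by exact_mod_cast h0
    linarith
  have h2 := (integral_eq_zero_iff_of_nonneg hg0 (hg.integrable_of_hasCompactSupport hcs)).1 h1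
  have h3 : g = fun _ => 0 := by
    exact (hg.ae_eq_iff_eq volume continuous_const).1 h2
  have h4 : ∀ t ∈ Icc (0:ℝ) 1, derivWithin Real.smoothTransition (Icc 0 1) t = 0 := by
    intro t ht
    have : deriv Real.smoothTransition t = 0 := by
      have := congrFun h3 ((Real.sqrt (2 - t) : ℝ) : ℂ)
      simp only [g, Complex.normSq_ofReal] at this
      rwa [Real.mul_self_sqrt (by linarith [ht.2]), sub_sub_cancel] at this
    have hd : HasDerivAt Real.smoothTransition 0 t := by
      rw [← this]
      exact ((Real.smoothTransition.contDiff (n := 1)).differentiable one_ne_zero _).hasDerivAt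
    exact hd.hasDerivWithinAt.derivWithin (uniqueDiffOn_Icc one_pos t ht)
  have h5 := constant_of_derivWithin_zero
    (((Real.smoothTransition.contDiff (n := 1)).differentiable one_ne_zero).differentiableOn)
    (fun t ht => h4 t ⟨ht.1, ht.2.le⟩) 1 (by simp)
  simp at h5

theorem pompeiu {χ h : ℂ → ℂ} {Ω : Set ℂ} (hΩ : IsOpen Ω) (hχ : ContDiff ℝ 1 χ)
    (hc : HasCompactSupport χ) (hs : tsupport χ ⊆ Ω) (hh : DifferentiableOn ℂ h Ω) {z : ℂ}
    (hz : χ =ᶠ[𝓝 z] fun _ => 1) :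
    ∫ ζ, dbar χ ζ * h ζ * (ζ - z)⁻¹ = pompeiuConst * h z := by
  have hzt : z ∈ tsupport χ := subset_tsupport _ (by
    rw [Function.mem_support, hz.self_of_nhds]; exact one_ne_zero)
  have hzΩ : z ∈ Ω := hs hzt
  have hχ0 : ∀ᶠ ζ in 𝓝 z, dbar χ ζ = 0 := by
    filter_upwards [hz.eventually_nhds] with ζ hζ
    simp [dbar, Filter.EventuallyEq.fderiv_eq hζ]
  have hdc : Continuous (dbar χ) := by
    unfold dbar
    have := hχ.continuous_fderiv one_ne_zero
    exact (this.clm_apply continuous_const).add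
      (continuous_const.mul (this.clm_apply continuous_const))
  have hdcs : HasCompactSupport (dbar χ) :=
    (hc.fderiv_apply (𝕜 := ℝ) 1).add
      (HasCompactSupport.mul_left (hc.fderiv_apply (𝕜 := ℝ) Complex.I))
  have hds : tsupport (dbar χ) ⊆ Ω := by
    refine Subset.trans (closure_minimal ?_ (isClosed_tsupport χ)) hs
    intro ζ hζ
    by_contra hn
    refine hζ ?_
    have e1 : χ =ᶠ[𝓝 ζ] fun _ => 0 := by
      filter_upwards [(isClosed_tsupport χ).isOpen_compl.mem_nhds hn] with y hy
      exact image_eq_zero_of_notMem_tsupport hy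
    simp [dbar, e1.fderiv_eq]
  have hdz : z ∉ tsupport (dbar χ) := by
    rw [notMem_tsupport_iff_eventuallyEq]; exact hχ0
  have hint : ∀ g : ℂ → ℂ, DifferentiableOn ℂ g Ω →
      Integrable (fun ζ => dbar χ ζ * g ζ * (ζ - z)⁻¹) := by
    intro g hg
    have hcs : HasCompactSupport (fun ζ => dbar χ ζ * g ζ * (ζ - z)⁻¹) :=
      (hdcs.mul_right (f' := g)).mul_right
    refine Continuous.integrable_of_hasCompactSupport ?_ hcs
    rw [continuous_iff_continuousAt]
    intro ζ
    by_cases hζ : ζ ∈ tsupport (dbar χ)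
    · have hne : ζ - z ≠ 0 := sub_ne_zero.2 (fun h => hdz (h ▸ hζ))
      have hga := (hg.differentiableAt (hΩ.mem_nhds (hds hζ))).continuousAt
      exact (hdc.continuousAt.mul hga).mul ((continuousAt_id.sub continuousAt_const).inv₀ hne)
    · have : (fun ζ => dbar χ ζ * g ζ * (ζ - z)⁻¹) =ᶠ[𝓝 ζ] fun _ => 0 := by
        rw [notMem_tsupport_iff_eventuallyEq] at hζ
        filter_upwards [hζ] with y hy
        rw [hy]; simp
      exact continuousAt_const.congr this.symm
  have A : ∫ ζ, dbar χ ζ * dslope h z ζ = 0 :=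
    integral_dbar_mul_eq_zero hΩ hχ hc hs
      ((Complex.differentiableOn_dslope (hΩ.mem_nhds hzΩ)).2 hh)
  have B : ∫ ζ, dbar χ ζ * (ζ - z)⁻¹ = pompeiuConst := by
    let b : ℂ → ℂ := fun ζ => bump (ζ - z)
    have hb : ContDiff ℝ 1 b := contDiff_bump.comp (contDiff_id.sub contDiff_const)
    have hbc : HasCompactSupport b := hasCompactSupport_bump.comp_homeomorph (Homeomorph.subRight z)
    have hdb : ∀ ζ, dbar b ζ = dbar bump (ζ - z) := by
      intro ζ
      simp only [dbar, b]
      rw [fderiv_comp_sub]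
    have hpc : ∫ ζ, dbar b ζ * (ζ - z)⁻¹ = pompeiuConst := by
      rw [pompeiuConst, ← integral_sub_right_eq_self (fun w => dbar bump w / w) z]
      simp_rw [hdb, div_eq_mul_inv]
    have hb1 : b =ᶠ[𝓝 z] fun _ => 1 := by
      filter_upwards [ball_mem_nhds z one_pos] with y hy
      exact bump_eq_one (by rw [← dist_eq_norm]; exact (mem_ball.1 hy).le)
    have h0 : ∫ ζ, dbar (fun ζ => χ ζ - b ζ) ζ * (ζ - z)⁻¹ = 0 := by
      refine integral_dbar_mul_eq_zero (Ω := {z}ᶜ) isOpen_compl_singleton (hχ.sub hb)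
        (hc.sub hbc) ?_ ?_
      · intro y hy hyz
        rw [mem_singleton_iff] at hyz
        subst hyz
        refine (notMem_tsupport_iff_eventuallyEq.2 ?_) hy
        filter_upwards [hz, hb1] with w h1 h2
        simp [h1, h2]
      · exact (differentiableOn_id.sub (differentiableOn_const z)).inv
          (fun x hx => sub_ne_zero.2 hx)
    have hd : ∀ ζ, dbar (fun ζ => χ ζ - b ζ) ζ = dbar χ ζ - dbar b ζ := by
      intro ζ
      unfold dbar
      rw [fderiv_fun_sub (hχ.differentiable one_ne_zero ζ) (hb.differentiable one_ne_zero ζ)]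
      simp; ring
    have i1 : Integrable (fun ζ => dbar χ ζ * (ζ - z)⁻¹) := by
      simpa using hint (fun _ => 1) (differentiableOn_const 1)
    have hadd : (fun ζ => dbar b ζ * (ζ - z)⁻¹) = fun ζ => dbar χ ζ * (ζ - z)⁻¹ -
        dbar (fun ζ => χ ζ - b ζ) ζ * (ζ - z)⁻¹ := by
      ext ζ; rw [hd]; ring
    have i2 : Integrable (fun ζ => dbar (fun ζ => χ ζ - b ζ) ζ * (ζ - z)⁻¹) := by
      have hcs : HasCompactSupport (fun ζ => dbar (fun ζ => χ ζ - b ζ) ζ) :=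
        ((hc.sub hbc).fderiv_apply (𝕜 := ℝ) 1).add
          (HasCompactSupport.mul_left ((hc.sub hbc).fderiv_apply (𝕜 := ℝ) Complex.I))
      refine Continuous.integrable_of_hasCompactSupport ?_ hcs.mul_right
      rw [continuous_iff_continuousAt]
      intro ζ
      by_cases hζ : ζ = z
      · subst hζ
        have : (fun w => dbar (fun ζ => χ ζ - b ζ) w * (w - ζ)⁻¹) =ᶠ[𝓝 ζ] fun _ => 0 := by
          have e : (fun ζ => χ ζ - b ζ) =ᶠ[𝓝 ζ] fun _ => 0 := by
            filter_upwards [hz, hb1] with w h1 h2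
            simp [h1, h2]
          filter_upwards [e.eventually_nhds] with w hw
          simp [dbar, Filter.EventuallyEq.fderiv_eq hw]
        exact continuousAt_const.congr this.symm
      · have hcf := (hχ.sub hb).continuous_fderiv one_ne_zero
        have : Continuous (dbar (fun ζ => χ ζ - b ζ)) := by
          unfold dbar
          exact (hcf.clm_apply continuous_const).add
            (continuous_const.mul (hcf.clm_apply continuous_const))
        exact this.continuousAt.mul
            ((continuousAt_id.sub continuousAt_const).inv₀ (sub_ne_zero.2 hζ))
    rw [← hpc, hadd, integral_sub i1 i2, h0, sub_zero]
  have e : ∀ ζ, dbar χ ζ * h ζ * (ζ - z)⁻¹ =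
      dbar χ ζ * dslope h z ζ + h z * (dbar χ ζ * (ζ - z)⁻¹) := by
    intro ζ
    by_cases hζ : ζ = z
    · subst hζ; rw [hχ0.self_of_nhds]; ring
    · rw [dslope_of_ne _ hζ, slope_def_field]
      field_simp [sub_ne_zero.2 hζ]
      ring
  have i1 : Integrable (fun ζ => h z * (dbar χ ζ * (ζ - z)⁻¹)) := by
    have := hint (fun _ => 1) (differentiableOn_const 1)
    simp only [mul_one] at this
    exact this.const_mul _
  have i2 : Integrable (fun ζ => dbar χ ζ * dslope h z ζ) := by
    have := (hint h hh).sub i1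
    refine this.congr (Eventually.of_forall fun ζ => ?_)
    simp only [Pi.sub_apply, e]; ring
  simp_rw [e]
  rw [integral_add i2 i1, A, integral_const_mul, B, zero_add, mul_comm]

/-- The open lemniscate domain `{|F| < R}`. -/
def lem (F : ℂ[X]) (R : ℝ) : Set ℂ := {z | ‖F.eval z‖ < R}

/-- The component of `z` in the lemniscate domain `{|F| < R}`. -/
def lemComp (F : ℂ[X]) (R : ℝ) (z : ℂ) : Set ℂ := connectedComponentIn (lem F R) z

lemma isOpen_lem (F : ℂ[X]) (R : ℝ) : IsOpen (lem F R) :=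
  isOpen_lt F.continuous.norm continuous_const

lemma isOpen_lemComp (F : ℂ[X]) (R : ℝ) (z : ℂ) : IsOpen (lemComp F R z) :=
  (isOpen_lem F R).connectedComponentIn

lemma lem_mono (F : ℂ[X]) {r R : ℝ} (h : r ≤ R) : lem F r ⊆ lem F R :=
  fun _ hz => lt_of_lt_of_le hz h

lemma lemComp_mono (F : ℂ[X]) {r R : ℝ} (h : r ≤ R) (z : ℂ) : lemComp F r z ⊆ lemComp F R z :=
  connectedComponentIn_mono z (lem_mono F h)

lemma isCompact_closedLem {F : ℂ[X]} (hF : 0 < F.degree) (R : ℝ) :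
    IsCompact {z : ℂ | ‖F.eval z‖ ≤ R} := by
  have : {z : ℂ | ‖F.eval z‖ ≤ R} = F.eval ⁻¹' closedBall 0 R := by
    ext z; simp
  rw [this]
  exact (F.isProperMap_eval hF).isCompact_preimage (isCompact_closedBall 0 R)

lemma exists_lt_mem_lemComp (F : ℂ[X]) {R : ℝ} {z₀ z : ℂ} (h0 : z₀ ∈ lem F R)
    (hz : z ∈ lemComp F R z₀) : ∃ s < R, z₀ ∈ lem F s ∧ z ∈ lemComp F s z₀ := by
  set U : Set ℂ := ⋃ s ∈ {s : ℝ | s < R ∧ z₀ ∈ lem F s}, lemComp F s z₀ with hU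
  have hUo : IsOpen U := isOpen_biUnion fun s _ => isOpen_lemComp F s z₀
  obtain ⟨s₀, hs₀, hs₀R⟩ := exists_between (show ‖F.eval z₀‖ < R from h0)
  have hz0 : z₀ ∈ U := by
    rw [hU]
    exact mem_biUnion (x := s₀) ⟨hs₀R, hs₀⟩ (mem_connectedComponentIn hs₀)
  have hsub : lemComp F R z₀ ⊆ U := by
    refine isPreconnected_connectedComponentIn.subset_of_closure_inter_subset hUo
      ⟨z₀, mem_connectedComponentIn h0, hz0⟩ ?_
    rintro y ⟨hy, hyR⟩
    have hyR' : y ∈ lem F R := connectedComponentIn_subset _ _ hyR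
    obtain ⟨s₁, hs₁, hs₁R⟩ := exists_between (show ‖F.eval y‖ < R from hyR')
    obtain ⟨ε, hε, hball⟩ := Metric.isOpen_iff.1 (isOpen_lem F s₁) y hs₁
    obtain ⟨x, hxU, hxy⟩ := Metric.mem_closure_iff.1 hy ε hε
    simp only [hU, mem_iUnion, exists_prop] at hxU ⊢
    obtain ⟨s, ⟨hsR, hs0⟩, hx⟩ := hxU
    refine ⟨max s s₁, ⟨max_lt hsR hs₁R, lem_mono F (le_max_left _ _) hs0⟩, ?_⟩
    have hx' : x ∈ lemComp F (max s s₁) z₀ := lemComp_mono F (le_max_left _ _) _ hx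
    have e := connectedComponentIn_eq hx'
    rw [lemComp, e]
    exact (convex_ball y ε).isPreconnected.subset_connectedComponentIn
      (by rw [mem_ball, dist_comm]; exact hxy)
      (hball.trans (lem_mono F (le_max_right _ _))) (mem_ball_self hε)
  have := hsub hz
  simp only [hU, mem_iUnion, exists_prop] at this
  obtain ⟨s, ⟨h1, h2⟩, h3⟩ := this
  exact ⟨s, h1, h2, h3⟩

lemma continuous_dbar {χ : ℂ → ℂ} (hχ : ContDiff ℝ 1 χ) : Continuous (dbar χ) := by
  unfold dbar
  have := hχ.continuous_fderiv one_ne_zero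
  exact (this.clm_apply continuous_const).add
    (continuous_const.mul (this.clm_apply continuous_const))

lemma dbar_eq_zero_of_eventually {χ : ℂ → ℂ} {a : ℂ} {z : ℂ} (h : χ =ᶠ[𝓝 z] fun _ => a) :
    dbar χ z = 0 := by
  simp [dbar, h.fderiv_eq]

/-- The difference quotient of a polynomial. -/
noncomputable def quot (F : ℂ[X]) (z ζ : ℂ) : ℂ :=
  ∑ i ∈ Finset.range (F.natDegree + 1), ∑ j ∈ Finset.range i,
    F.coeff i * (z ^ j * ζ ^ (i - 1 - j))

lemma quot_mul (F : ℂ[X]) (z ζ : ℂ) : quot F z ζ * (z - ζ) = F.eval z - F.eval ζ := by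
  rw [quot, Finset.sum_mul, eval_eq_sum_range, eval_eq_sum_range, ← Finset.sum_sub_distrib]
  refine Finset.sum_congr rfl fun i _ => ?_
  rw [← Finset.mul_sum, mul_assoc, (Commute.all z ζ).geom_sum₂_mul]
  ring

lemma exists_entire_approx {F : ℂ[X]} (hF : 0 < F.degree) {R s₁ : ℝ} (h1 : 0 < s₁) (h2 : s₁ < R)
    {h : ℂ → ℂ} (hh : DifferentiableOn ℂ h (lem F R)) :
    ∃ p : ℕ → ℂ → ℂ, (∀ n, Differentiable ℂ (p n)) ∧ TendstoUniformlyOn p h atTop (lem F s₁) := by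
  obtain ⟨s, hs1, hsR⟩ := exists_between h2
  obtain ⟨s₂, hs2, hs2R⟩ := exists_between hsR
  have hs0 : 0 < s := h1.trans hs1
  have hs20 : 0 < s₂ := hs0.trans hs2
  set b : ℝ := 1 / (s₂ ^ 2 - s ^ 2) with hb
  have hbpos : 0 < s₂ ^ 2 - s ^ 2 := by nlinarith
  have hb0 : 0 < b := by positivity
  have hbm : b * (s₂ ^ 2 - s ^ 2) = 1 := by rw [hb]; field_simp
  set χ : ℂ → ℂ := fun z =>
    ((Real.smoothTransition (b * s₂ ^ 2 - b * Complex.normSq (F.eval z)) : ℝ) : ℂ) with hχdef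
  have hFs : ContDiff ℝ 1 (fun z : ℂ => F.eval z) :=
    (F.contDiff_aeval (𝕜 := ℂ) 1 |>.restrict_scalars ℝ : ContDiff ℝ 1 (fun z : ℂ => aeval z F))
  have hχ : ContDiff ℝ 1 χ := contDiff_smoothTransition_normSq _ _ _ hFs
  have hχ1 : ∀ z, ‖F.eval z‖ ≤ s → χ z = 1 := by
    intro z hz
    simp only [hχdef]
    rw [Real.smoothTransition.one_of_one_le]
    · simp
    · rw [Complex.normSq_eq_norm_sq]
      have : ‖F.eval z‖ ^ 2 ≤ s ^ 2 := by gcongr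
      nlinarith
  have hχ0 : ∀ z, s₂ ≤ ‖F.eval z‖ → χ z = 0 := by
    intro z hz
    simp only [hχdef]
    rw [Real.smoothTransition.zero_of_nonpos]
    · simp
    · rw [Complex.normSq_eq_norm_sq]
      have : s₂ ^ 2 ≤ ‖F.eval z‖ ^ 2 := by gcongr
      nlinarith
  have hts : tsupport χ ⊆ {z | ‖F.eval z‖ ≤ s₂} := by
    refine closure_minimal ?_ (isClosed_le F.continuous.norm continuous_const)
    intro z hz
    by_contra hn
    exact hz (hχ0 z (not_le.1 hn).le)
  have hcs : HasCompactSupport χ :=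
    (isCompact_closedLem hF s₂).of_isClosed_subset (isClosed_tsupport χ) hts
  have htR : tsupport χ ⊆ lem F R := hts.trans fun z hz => lt_of_le_of_lt hz hs2R
  have hd1 : ∀ ζ, ‖F.eval ζ‖ < s → dbar χ ζ = 0 := by
    intro ζ hζ
    refine dbar_eq_zero_of_eventually (a := 1) ?_
    filter_upwards [(isOpen_lem F s).mem_nhds hζ] with y hy
    exact hχ1 y (le_of_lt hy)
  have hd0 : ∀ ζ, ζ ∉ tsupport χ → dbar χ ζ = 0 := by
    intro ζ hζ
    exact dbar_eq_zero_of_eventually (a := 0) (notMem_tsupport_iff_eventuallyEq.1 hζ)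
  have hint : ∀ g : ℂ → ℂ, ContinuousOn g {z | 0 < ‖F.eval z‖} →
      Integrable (fun ζ => dbar χ ζ * h ζ * g ζ) := by
    intro g hg
    have hsupp : HasCompactSupport (fun ζ => dbar χ ζ * h ζ * g ζ) := by
      refine HasCompactSupport.of_support_subset_isCompact hcs ?_
      intro ζ hζ
      by_contra hn
      exact hζ (by simp [hd0 ζ hn])
    refine Continuous.integrable_of_hasCompactSupport ?_ hsupp
    rw [continuous_iff_continuousAt]
    intro ζ
    by_cases hζ : ζ ∈ tsupport χ
    · by_cases hζs : ‖F.eval ζ‖ < s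
      · have : (fun ζ => dbar χ ζ * h ζ * g ζ) =ᶠ[𝓝 ζ] fun _ => 0 := by
          filter_upwards [(isOpen_lem F s).mem_nhds hζs] with y hy
          simp [hd1 y hy]
        exact continuousAt_const.congr this.symm
      · have hpos : 0 < ‖F.eval ζ‖ := hs0.trans_le (not_lt.1 hζs)
        have hga : ContinuousAt g ζ := by
          refine hg.continuousAt ?_
          filter_upwards [(isOpen_lt continuous_const F.continuous.norm).mem_nhds hpos] with y hy
          exact hy
        exact ((continuous_dbar hχ).continuousAt.mul
          (hh.differentiableAt ((isOpen_lem F R).mem_nhds (htR hζ))).continuousAt).mul hga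
    · have : (fun ζ => dbar χ ζ * h ζ * g ζ) =ᶠ[𝓝 ζ] fun _ => 0 := by
        filter_upwards [(isClosed_tsupport χ).isOpen_compl.mem_nhds hζ] with y hy
        simp [hd0 y hy]
      exact continuousAt_const.congr this.symm
  have hinv : ∀ m i : ℕ, Integrable (fun ζ => dbar χ ζ * h ζ * (ζ ^ i * ((F.eval ζ)⁻¹) ^ m)) := by
    intro m i
    refine hint _ ?_
    exact ContinuousOn.mul (by fun_prop) (ContinuousOn.pow (ContinuousOn.inv₀
      F.continuous.continuousOn fun x hx => norm_pos_iff.1 hx) _)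
  set p : ℕ → ℂ → ℂ := fun N z => pompeiuConst⁻¹ * ∑ m ∈ Finset.range N,
    ∑ i ∈ Finset.range (F.natDegree + 1), ∑ j ∈ Finset.range i,
      F.coeff i * (z ^ j * (F.eval z) ^ m) *
        ∫ ζ, dbar χ ζ * h ζ * (ζ ^ (i - 1 - j) * ((F.eval ζ)⁻¹) ^ (m + 1)) with hp
  have hpint : ∀ N z, p N z = pompeiuConst⁻¹ * ∫ ζ, dbar χ ζ * h ζ *
      ∑ m ∈ Finset.range N, (F.eval z) ^ m * ((F.eval ζ)⁻¹) ^ (m + 1) * quot F z ζ := by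
    intro N z
    simp only [hp]
    congr 1
    have e : ∀ ζ, dbar χ ζ * h ζ * ∑ m ∈ Finset.range N,
        (F.eval z) ^ m * ((F.eval ζ)⁻¹) ^ (m + 1) * quot F z ζ =
        ∑ m ∈ Finset.range N, ∑ i ∈ Finset.range (F.natDegree + 1), ∑ j ∈ Finset.range i,
          F.coeff i * (z ^ j * (F.eval z) ^ m) *
          (dbar χ ζ * h ζ * (ζ ^ (i - 1 - j) * ((F.eval ζ)⁻¹) ^ (m + 1))) := by
      intro ζ
      simp only [quot, Finset.mul_sum]
      refine Finset.sum_congr rfl fun m _ => Finset.sum_congr rfl fun i _ =>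
        Finset.sum_congr rfl fun j _ => ?_
      ring
    simp_rw [e]
    rw [integral_finsetSum _ fun m _ => integrable_finsetSum _ fun i _ =>
      integrable_finsetSum _ fun j _ => (hinv _ _).const_mul _]
    refine Finset.sum_congr rfl fun m _ => ?_
    rw [integral_finsetSum _ fun i _ =>
      integrable_finsetSum _ fun j _ => (hinv _ _).const_mul _]
    refine Finset.sum_congr rfl fun i _ => ?_
    rw [integral_finsetSum _ fun j _ => (hinv _ _).const_mul _]
    exact Finset.sum_congr rfl fun j _ => (integral_const_mul _ _).symm
  refine ⟨p, fun N => ?_, ?_⟩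
  · simp only [hp]
    refine Differentiable.const_mul ?_ _
    refine Differentiable.fun_sum fun m _ => Differentiable.fun_sum fun i _ =>
      Differentiable.fun_sum fun j _ => ?_
    have := F.differentiable
    exact (((differentiable_id.pow j).mul (this.pow m)).const_mul _).mul_const _
  obtain ⟨δ, hδ, hδs⟩ := (isCompact_closedLem hF s₁).exists_thickening_subset_open
    (isOpen_lem F s) (fun z hz => lt_of_le_of_lt hz hs1)
  set A : ℝ := ∫ ζ, ‖dbar χ ζ * h ζ‖ with hA
  have hAi : Integrable (fun ζ => dbar χ ζ * h ζ) := by simpa using hinv 0 0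
  have hbound : ∀ N, ∀ z ∈ lem F s₁, ‖h z - p N z‖ ≤
      ‖pompeiuConst⁻¹‖ * (δ⁻¹ * A) * (s₁ / s) ^ N := by
    intro N z hz
    have hzs : ‖F.eval z‖ < s := lt_trans hz hs1
    have hpom := pompeiu (isOpen_lem F R) hχ hcs htR hh (z := z) (by
      filter_upwards [(isOpen_lem F s).mem_nhds hzs] with y hy
      exact hχ1 y (le_of_lt hy))
    have hz' : h z = pompeiuConst⁻¹ * ∫ ζ, dbar χ ζ * h ζ * (ζ - z)⁻¹ := by
      rw [hpom, inv_mul_cancel_left₀ pompeiuConst_ne_zero]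
    have hfar : ∀ ζ, s ≤ ‖F.eval ζ‖ → δ ≤ ‖ζ - z‖ := by
      intro ζ hζ
      by_contra hlt
      have : ζ ∈ thickening δ {z : ℂ | ‖F.eval z‖ ≤ s₁} :=
        mem_thickening_iff.2
            ⟨z, (show ‖F.eval z‖ ≤ s₁ from le_of_lt hz), by rw [dist_eq_norm]; exact not_le.1 hlt⟩
      exact absurd (hδs this) (not_lt.2 hζ)
    have e : ∀ ζ, dbar χ ζ * h ζ * (ζ - z)⁻¹ - dbar χ ζ * h ζ *
        ∑ m ∈ Finset.range N, (F.eval z) ^ m * ((F.eval ζ)⁻¹) ^ (m + 1) * quot F z ζ =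
        dbar χ ζ * h ζ * ((ζ - z)⁻¹ * (F.eval z / F.eval ζ) ^ N) := by
      intro ζ
      by_cases hζ : ‖F.eval ζ‖ < s
      · simp [hd1 ζ hζ]
      · have hζ' := not_lt.1 hζ
        have hne : ζ - z ≠ 0 := norm_pos_iff.1 (hδ.trans_le (hfar ζ hζ'))
        have hFne : F.eval ζ ≠ 0 := norm_pos_iff.1 (hs0.trans_le hζ')
        have hq : quot F z ζ = (F.eval ζ - F.eval z) * (ζ - z)⁻¹ := by
          rw [eq_mul_inv_iff_mul_eq₀ hne]
          have := quot_mul F z ζ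
          linear_combination -this
        have hg : (∑ m ∈ Finset.range N, (F.eval z) ^ m * ((F.eval ζ)⁻¹) ^ (m + 1)) *
            (F.eval ζ - F.eval z) = 1 - (F.eval z / F.eval ζ) ^ N := by
          have := geom_sum_mul_neg (F.eval z / F.eval ζ) N
          rw [← this, Finset.sum_mul, Finset.sum_mul]
          refine Finset.sum_congr rfl fun m _ => ?_
          rw [div_pow, inv_pow, pow_succ]
          field_simp
        rw [← Finset.sum_mul, hq, ← mul_assoc (∑ m ∈ Finset.range N, _), hg]
        ring
    have hi1 : Integrable (fun ζ => dbar χ ζ * h ζ * (ζ - z)⁻¹) := by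
      have hcs' : HasCompactSupport (fun ζ => dbar χ ζ * h ζ * (ζ - z)⁻¹) := by
        refine HasCompactSupport.of_support_subset_isCompact hcs ?_
        intro ζ hζ
        by_contra hn
        exact hζ (by simp [hd0 ζ hn])
      refine Continuous.integrable_of_hasCompactSupport ?_ hcs'
      rw [continuous_iff_continuousAt]
      intro ζ
      by_cases hζ : ζ ∈ tsupport χ
      · by_cases hζs : ‖F.eval ζ‖ < s
        · have : (fun ζ => dbar χ ζ * h ζ * (ζ - z)⁻¹) =ᶠ[𝓝 ζ] fun _ => 0 := by
            filter_upwards [(isOpen_lem F s).mem_nhds hζs] with y hy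
            simp [hd1 y hy]
          exact continuousAt_const.congr this.symm
        · have hne : ζ - z ≠ 0 := norm_pos_iff.1 (hδ.trans_le (hfar ζ (not_lt.1 hζs)))
          exact ((continuous_dbar hχ).continuousAt.mul
            (hh.differentiableAt ((isOpen_lem F R).mem_nhds (htR hζ))).continuousAt).mul
            ((continuousAt_id.sub continuousAt_const).inv₀ hne)
      · have : (fun ζ => dbar χ ζ * h ζ * (ζ - z)⁻¹) =ᶠ[𝓝 ζ] fun _ => 0 := by
          filter_upwards [(isClosed_tsupport χ).isOpen_compl.mem_nhds hζ] with y hy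
          simp [hd0 y hy]
        exact continuousAt_const.congr this.symm
    have hi2 : Integrable (fun ζ => dbar χ ζ * h ζ *
        ∑ m ∈ Finset.range N, (F.eval z) ^ m * ((F.eval ζ)⁻¹) ^ (m + 1) * quot F z ζ) := by
      refine hint _ ?_
      refine continuousOn_finsetSum _ fun m _ => ?_
      refine ContinuousOn.mul (ContinuousOn.mul continuousOn_const (ContinuousOn.pow
        (ContinuousOn.inv₀ F.continuous.continuousOn fun x hx => norm_pos_iff.1 hx) _)) ?_
      unfold quot
      fun_prop
    rw [hz', hpint, ← mul_sub, ← integral_sub hi1 hi2, norm_mul, mul_assoc, mul_assoc]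
    refine mul_le_mul_of_nonneg_left ?_ (norm_nonneg _)
    have : ∫ ζ, δ⁻¹ * (s₁ / s) ^ N * ‖dbar χ ζ * h ζ‖ = δ⁻¹ * (A * (s₁ / s) ^ N) := by
      rw [integral_const_mul, hA]; ring
    rw [← this]
    refine norm_integral_le_of_norm_le (hAi.norm.const_mul _) (Eventually.of_forall fun ζ => ?_)
    rw [e, norm_mul]
    by_cases hζ : ‖F.eval ζ‖ < s
    · simp [hd1 ζ hζ]
    · have hζ' := not_lt.1 hζ
      rw [mul_comm, norm_mul, norm_inv, norm_pow, norm_div]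
      have h3 := hfar ζ hζ'
      have : ‖F.eval z‖ ≤ s₁ := le_of_lt hz
      gcongr
  rw [Metric.tendstoUniformlyOn_iff]
  intro ε hε
  have hlim : Tendsto (fun N : ℕ => ‖pompeiuConst⁻¹‖ * (δ⁻¹ * A) * (s₁ / s) ^ N) atTop (𝓝 0) := by
    have := (tendsto_pow_atTop_nhds_zero_of_lt_one (r := s₁ / s) (by positivity)
      ((div_lt_one hs0).2 hs1)).const_mul (‖pompeiuConst⁻¹‖ * (δ⁻¹ * A))
    simpa using this
  filter_upwards [hlim.eventually (gt_mem_nhds hε)] with N hN z hz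
  rw [dist_eq_norm]
  exact (hbound N z hz).trans_lt hN

lemma isPreconnected_lemComp (F : ℂ[X]) (R : ℝ) (z : ℂ) : IsPreconnected (lemComp F R z) :=
  isPreconnected_connectedComponentIn

lemma mem_lemComp {F : ℂ[X]} {R : ℝ} {z : ℂ} (h : z ∈ lem F R) : z ∈ lemComp F R z :=
  mem_connectedComponentIn h

lemma differentiableOn_indicator_lemComp {F : ℂ[X]} {R : ℝ} {z₀ : ℂ} {h : ℂ → ℂ}
    (hh : DifferentiableOn ℂ h (lemComp F R z₀)) :
    DifferentiableOn ℂ ((lemComp F R z₀).indicator h) (lem F R) := by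
  intro z hz
  refine DifferentiableAt.differentiableWithinAt ?_
  by_cases hzW : z ∈ lemComp F R z₀
  · have hW := (isOpen_lemComp F R z₀).mem_nhds hzW
    refine (hh.differentiableAt hW).congr_of_eventuallyEq ?_
    filter_upwards [hW] with y hy
    exact indicator_of_mem hy _
  · have : (lemComp F R z₀).indicator h =ᶠ[𝓝 z] fun _ => 0 := by
      filter_upwards [(isOpen_lemComp F R z).mem_nhds (mem_lemComp hz)] with y hy
      refine indicator_of_notMem (fun hy' => hzW ?_) _
      have e1 : lemComp F R z = lemComp F R y := connectedComponentIn_eq hy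
      have e2 : lemComp F R z₀ = lemComp F R y := connectedComponentIn_eq hy'
      rw [e2, ← e1]
      exact mem_lemComp hz
    exact (differentiableAt_const _).congr_of_eventuallyEq this

lemma exists_primitive_of_lt {F : ℂ[X]} (hF : 0 < F.degree) {R s : ℝ} (hs : s < R) {z₀ : ℂ}
    (hz₀ : z₀ ∈ lem F s) {h : ℂ → ℂ} (hh : DifferentiableOn ℂ h (lemComp F R z₀)) :
    ∃ H : ℂ → ℂ, H z₀ = 0 ∧ ∀ z ∈ lemComp F s z₀, HasDerivAt H (h z) z := by
  have hs0 : 0 < s := lt_of_le_of_lt (norm_nonneg _) hz₀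
  obtain ⟨p, hp, hlim⟩ := exists_entire_approx hF hs0 hs (differentiableOn_indicator_lemComp hh)
  choose P hP0 hP using fun n => (hp n).isExactOn_univ.with_val_at z₀ 0
  have hlim' := hlim.mono (connectedComponentIn_subset (lem F s) z₀)
  have hc : ∀ z ∈ lemComp F s z₀, Cauchy (map (fun n => P n z) atTop) := by
    intro z hz
    refine cauchy_map_of_uniformCauchySeqOn_fderiv (𝕜 := ℂ)
      (f' := fun n z => (ContinuousLinearMap.toSpanSingleton ℂ (p n z)))
      (isOpen_lemComp F s z₀) (isPreconnected_lemComp F s z₀) ?_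
      (fun n y _ => (hP n y (mem_univ _)).hasFDerivAt) (mem_lemComp hz₀) hz ?_
    · have := hlim'.uniformCauchySeqOn
      rw [Metric.uniformCauchySeqOn_iff] at this ⊢
      intro ε hε
      obtain ⟨N, hN⟩ := this ε hε
      refine ⟨N, fun m hm n hn x hx => ?_⟩
      have e : ContinuousLinearMap.toSpanSingleton ℂ (p m x) -
        ContinuousLinearMap.toSpanSingleton ℂ (p n x) =
        ContinuousLinearMap.toSpanSingleton ℂ (p m x - p n x) := by ext; simp
      rw [dist_eq_norm, e, ContinuousLinearMap.norm_toSpanSingleton, ← dist_eq_norm]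
      exact hN m hm n hn x hx
    · simp only [hP0]
      exact tendsto_const_nhds.cauchy_map
  have hl : ∀ z ∈ lemComp F s z₀, ∃ a, Tendsto (fun n => P n z) atTop (𝓝 a) :=
    fun z hz => CompleteSpace.complete (hc z hz)
  choose! H hH using hl
  refine ⟨H, ?_, fun z hz => ?_⟩
  · have := hH z₀ (mem_lemComp hz₀)
    simp only [hP0] at this
    exact tendsto_nhds_unique this tendsto_const_nhds
  · have := hasDerivAt_of_tendstoUniformlyOn (isOpen_lemComp F s z₀) hlim'
      (Eventually.of_forall fun n x _ => hP n x (mem_univ _)) hH hz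
    rwa [indicator_of_mem (lemComp_mono F hs.le z₀ hz)] at this

lemma exists_primitive {F : ℂ[X]} (hF : 0 < F.degree) {R : ℝ} {z₀ : ℂ}
    (hz₀ : z₀ ∈ lem F R) {h : ℂ → ℂ} (hh : DifferentiableOn ℂ h (lemComp F R z₀)) :
    ∃ H : ℂ → ℂ, ∀ z ∈ lemComp F R z₀, HasDerivAt H (h z) z := by
  have key : ∀ s : ℝ, ∃ H : ℂ → ℂ, s < R → z₀ ∈ lem F s →
      H z₀ = 0 ∧ ∀ z ∈ lemComp F s z₀, HasDerivAt H (h z) z := by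
    intro s
    by_cases hs : s < R ∧ z₀ ∈ lem F s
    · obtain ⟨H, hH⟩ := exists_primitive_of_lt hF hs.1 hs.2 hh
      exact ⟨H, fun _ _ => hH⟩
    · exact ⟨0, fun h1 h2 => absurd ⟨h1, h2⟩ hs⟩
  choose P hP using key
  choose! s hsR hs0 hsz using fun z (hz : z ∈ lemComp F R z₀) => exists_lt_mem_lemComp F hz₀ hz
  have huniq : ∀ s t, s ≤ t → t < R → z₀ ∈ lem F s → ∀ z ∈ lemComp F s z₀, P s z = P t z := by
    intro s t hst ht hs z hz
    have h1 := hP s (hst.trans_lt ht) hs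
    have h2 := hP t ht (lem_mono F hst hs)
    have hsub := lemComp_mono F hst z₀
    refine (isOpen_lemComp F s z₀).eqOn_of_deriv_eq (𝕜 := ℂ) (isPreconnected_lemComp F s z₀)
      (fun y hy => (h1.2 y hy).differentiableAt.differentiableWithinAt)
      (fun y hy => (h2.2 y (hsub hy)).differentiableAt.differentiableWithinAt)
      (fun y hy => ?_) (mem_lemComp hs) (h1.1.trans h2.1.symm) hz
    rw [(h1.2 y hy).deriv, (h2.2 y (hsub hy)).deriv]
  refine ⟨fun z => P (s z) z, fun z hz => ?_⟩
  refine ((hP (s z) (hsR z hz) (hs0 z hz)).2 z (hsz z hz)).congr_of_eventuallyEq ?_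
  filter_upwards [(isOpen_lemComp F (s z) z₀).mem_nhds (hsz z hz)] with y hy
  have hyR := lemComp_mono F (hsR z hz).le z₀ hy
  rcases le_total (s y) (s z) with h | h
  · exact huniq _ _ h (hsR z hz) (hs0 y hyR) y (hsz y hyR)
  · exact (huniq _ _ h (hsR y hyR) (hs0 z hz) y hy).symm

/-- Nonvanishing holomorphic functions on lemniscate components have holomorphic square roots. -/
lemma exists_sqrt {F : ℂ[X]} (hF : 0 < F.degree) {R : ℝ} {z₀ : ℂ}
    (hz₀ : z₀ ∈ lem F R) {h : ℂ → ℂ} (hh : DifferentiableOn ℂ h (lemComp F R z₀))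
    (hne : ∀ z ∈ lemComp F R z₀, h z ≠ 0) :
    ∃ g : ℂ → ℂ, DifferentiableOn ℂ g (lemComp F R z₀) ∧ ∀ z ∈ lemComp F R z₀, g z ^ 2 = h z := by
  have hW := isOpen_lemComp F R z₀
  obtain ⟨H, hH⟩ := exists_primitive hF hz₀ ((hh.deriv hW).div hh hne)
  set c : ℂ := Complex.log (h z₀ * Complex.exp (-H z₀)) with hc
  have hcd : ∀ z ∈ lemComp F R z₀, h z * Complex.exp (-H z) = Complex.exp c := by
    intro z hz
    have h0 := mem_lemComp hz₀
    rw [hc, Complex.exp_log (mul_ne_zero (hne z₀ h0) (Complex.exp_ne_zero _))]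
    have hd : ∀ y ∈ lemComp F R z₀, HasDerivAt (fun z => h z * Complex.exp (-H z)) 0 y := by
      intro y hy
      have h1 := (hh.differentiableAt (hW.mem_nhds hy)).hasDerivAt
      refine (h1.fun_mul (hH y hy).fun_neg.cexp).congr_deriv ?_
      have := hne y hy
      simp only [Pi.div_apply]
      field_simp
      ring
    exact hW.is_const_of_deriv_eq_zero (𝕜 := ℂ) (isPreconnected_lemComp F R z₀)
      (fun y hy => (hd y hy).differentiableAt.differentiableWithinAt)
      (fun y hy => (hd y hy).deriv) hz h0
  refine ⟨fun z => Complex.exp ((H z + c) / 2), fun z hz => ?_, fun z hz => ?_⟩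
  · exact (((hH z hz).differentiableAt.add_const c).div_const 2).cexp.differentiableWithinAt
  · rw [← Complex.exp_nat_mul]
    have : ((2 : ℕ) : ℂ) * ((H z + c) / 2) = H z + c := by push_cast; ring
    rw [this, Complex.exp_add, ← hcd z hz, mul_left_comm, ← Complex.exp_add]
    simp

lemma exists_tendstoLocallyUniformlyOn {W : Set ℂ} (hW : IsOpen W) (l : Ultrafilter ℕ)
    {G : ℕ → ℂ → ℂ} (hd : ∀ n, DifferentiableOn ℂ (G n) W)
    (hm : ∀ n, MapsTo (G n) W (ball 0 1)) :
    ∃ g, TendstoLocallyUniformlyOn G g l W := by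
  have hl : ∀ z ∈ W, ∃ a, Tendsto (fun n => G n z) l (𝓝 a) := by
    intro z hz
    have hc : IsCompact (closedBall (0 : ℂ) 1) := isCompact_closedBall 0 1
    obtain ⟨a, _, ha⟩ := hc.ultrafilter_le_nhds (l.map fun n => G n z)
      (le_principal_iff.2 (mem_map.2 (univ_mem' fun n => ball_subset_closedBall (hm n hz))))
    exact ⟨a, ha⟩
  choose! g hg using hl
  refine ⟨g, Metric.tendstoLocallyUniformlyOn_iff.2 fun ε hε z hz => ?_⟩
  obtain ⟨r, hr, hrW⟩ := Metric.isOpen_iff.1 hW z hz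
  have hlip : ∀ n, ∀ y ∈ ball z r, dist (G n y) (G n z) ≤ 2 / r * dist y z := by
    intro n y hy
    refine Complex.dist_le_div_mul_dist_of_mapsTo_ball ((hd n).mono hrW) ?_ hy
    intro x hx
    have h1 := hm n (hrW hx)
    have h2 := hm n hz
    rw [mem_ball_zero_iff] at h1 h2
    rw [mem_closedBall, dist_eq_norm]
    linarith [norm_sub_le (G n x) (G n z)]
  have hlip' : ∀ y ∈ ball z r, dist (g y) (g z) ≤ 2 / r * dist y z := fun y hy =>
    le_of_tendsto ((hg y (hrW hy)).dist (hg z hz)) (Eventually.of_forall fun n => hlip n y hy)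
  have hη : 0 < min r (r * ε / 6) := by positivity
  refine ⟨ball z (min r (r * ε / 6)), mem_nhdsWithin_of_mem_nhds (ball_mem_nhds z hη), ?_⟩
  filter_upwards [(hg z hz).eventually (ball_mem_nhds (g z) (show 0 < ε / 3 by positivity))]
    with n hn y hy
  have hyr : y ∈ ball z r := ball_subset_ball (min_le_left _ _) hy
  have hy2 : dist y z < r * ε / 6 := lt_of_lt_of_le hy (min_le_right _ _)
  have h3 : 2 / r * dist y z < ε / 3 := by
    calc 2 / r * dist y z < 2 / r * (r * ε / 6) := by gcongr
      _ = ε / 3 := by field_simp; ring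
  have h1 := hlip n y hyr
  have h2 := hlip' y hyr
  have := dist_triangle4 (g y) (g z) (G n z) (G n y)
  rw [dist_comm (G n z), dist_comm (g z) (G n z)] at this
  linarith

lemma injOn_of_tendstoLocallyUniformlyOn {W : Set ℂ} (hW : IsOpen W) (hWc : IsPreconnected W)
    {l : Filter ℕ} [l.NeBot] {G : ℕ → ℂ → ℂ} {g : ℂ → ℂ} (hd : ∀ n, DifferentiableOn ℂ (G n) W)
    (hi : ∀ n, InjOn (G n) W) (hg : TendstoLocallyUniformlyOn G g l W)
    {z₀ : ℂ} (hz₀ : z₀ ∈ W) (hz : deriv g z₀ ≠ 0) : InjOn g W := by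
  have hgd : DifferentiableOn ℂ g W := hg.differentiableOn (Eventually.of_forall hd) hW
  intro a ha b hb hab
  by_contra hne
  have hga : AnalyticOnNhd ℂ g W := hgd.analyticOnNhd hW
  have hp : ∀ x ∈ W, Tendsto (fun n => G n x) l (𝓝 (g x)) := fun x hx => hg.tendsto_at hx
  have hev : ∀ᶠ z in 𝓝[≠] b, g z ≠ g a := by
    rcases (hga b hb).eventually_eq_or_eventually_ne (analyticAt_const (v := g a)) with h | h
    · exfalso
      have := hga.eqOn_of_preconnected_of_eventuallyEq analyticOnNhd_const hWc hb h
      apply hz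
      have h2 : g =ᶠ[𝓝 z₀] fun _ => g a := by
        filter_upwards [hW.mem_nhds hz₀] with y hy using this hy
      rw [h2.deriv_eq, deriv_const]
    · exact h
  have hopen : W ∩ {a}ᶜ ∈ 𝓝 b := (hW.inter isOpen_compl_singleton).mem_nhds ⟨hb, Ne.symm hne⟩
  rw [eventually_nhdsWithin_iff] at hev
  obtain ⟨r, hr, hball⟩ := Metric.nhds_basis_closedBall.mem_iff.1 (inter_mem hev hopen)
  have hsub : closedBall b r ⊆ W := fun z hz => (hball hz).2.1
  have hsph : ∀ z ∈ sphere b r, g z ≠ g a := fun z hz =>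
    (hball (sphere_subset_closedBall hz)).1 (by
      rintro rfl
      simp at hz
      exact hr.ne hz)
  have hcs : IsCompact (sphere b r) := isCompact_sphere b r
  have hne' : (sphere b r).Nonempty := NormedSpace.sphere_nonempty.2 hr.le
  obtain ⟨w, hw, hwm⟩ := hcs.exists_isMinOn hne' (f := fun z => ‖g z - g a‖)
    ((hgd.continuousOn.mono (sphere_subset_closedBall.trans hsub)).sub continuousOn_const).norm
  set m := ‖g w - g a‖ with hm
  have hm0 : 0 < m := norm_pos_iff.2 (sub_ne_zero.2 (hsph w hw))
  have hu : TendstoUniformlyOn G g l (sphere b r) :=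
    (tendstoLocallyUniformlyOn_iff_forall_isCompact hW).1 hg _
      (sphere_subset_closedBall.trans hsub) hcs
  have e1 := Metric.tendstoUniformlyOn_iff.1 hu (m / 8) (by positivity)
  have e2 := (hp a ha).eventually (ball_mem_nhds (g a) (show 0 < m / 8 by positivity))
  have e3 := (hp b hb).eventually (ball_mem_nhds (g b) (show 0 < m / 8 by positivity))
  obtain ⟨n, h1, h2, h3⟩ := (e1.and (e2.and e3)).exists
  rw [dist_eq_norm] at h2 h3
  have hGne : ∀ z ∈ closedBall b r, G n z - G n a ≠ 0 := by
    intro z hz h0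
    exact (hball hz).2.2 (hi n (hsub hz) ha (sub_eq_zero.1 h0))
  have hdc : DiffContOnCl ℂ (fun z => (G n z - G n a)⁻¹) (ball b r) := by
    refine DifferentiableOn.diffContOnCl ?_
    rw [closure_ball b hr.ne']
    exact (((hd n).mono hsub).sub_const _).inv hGne
  have hmax := Complex.norm_le_of_forall_mem_frontier_norm_le (C := (m / 2)⁻¹) isBounded_ball hdc
    (by
      intro z hz
      rw [frontier_ball b hr.ne'] at hz
      rw [norm_inv]
      refine inv_anti₀ (by positivity) ?_
      have q1 := h1 z hz
      rw [dist_eq_norm] at q1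
      have q2 : m ≤ ‖g z - g a‖ := hwm hz
      have q3 : g z - g a = (g z - G n z) + (G n z - G n a) + (G n a - g a) := by ring
      have q4 := norm_add₃_le (a := g z - G n z) (b := G n z - G n a) (c := G n a - g a)
      rw [← q3] at q4
      linarith) (subset_closure (mem_ball_self hr))
  rw [norm_inv] at hmax
  have hpos : 0 < ‖G n b - G n a‖ := norm_pos_iff.2 (hGne b (mem_closedBall_self hr.le))
  have := (inv_le_inv₀ hpos (by positivity)).1 hmax
  have q3 : G n b - G n a = (G n b - g b) - (G n a - g a) := by rw [hab]; ring
  have := norm_sub_le (G n b - g b) (G n a - g a)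
  rw [← q3] at this
  linarith

/-- The Möbius automorphism of the unit disc sending `a` to `0`. -/
noncomputable def mob (a w : ℂ) : ℂ := (w - a) / (1 - (starRingEnd ℂ) a * w)

lemma mob_denom_ne {a w : ℂ} (ha : ‖a‖ < 1) (hw : ‖w‖ < 1) : 1 - (starRingEnd ℂ) a * w ≠ 0 := by
  intro h
  have : ‖(starRingEnd ℂ) a * w‖ = 1 := by rw [← sub_eq_zero.1 h]; simp
  rw [norm_mul, RCLike.norm_conj] at this
  nlinarith [norm_nonneg a, norm_nonneg w]

lemma norm_mob_lt {a w : ℂ} (ha : ‖a‖ < 1) (hw : ‖w‖ < 1) : ‖mob a w‖ < 1 := by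
  rw [mob, norm_div, div_lt_one (norm_pos_iff.2 (mob_denom_ne ha hw))]
  have h1 : Complex.normSq (w - a) < Complex.normSq (1 - (starRingEnd ℂ) a * w) := by
    have ha' : Complex.normSq a < 1 := by
      rw [Complex.normSq_eq_norm_sq]; nlinarith [norm_nonneg a]
    have hw' : Complex.normSq w < 1 := by
      rw [Complex.normSq_eq_norm_sq]; nlinarith [norm_nonneg w]
    simp only [Complex.normSq_apply, Complex.sub_re, Complex.sub_im, Complex.one_re,
      Complex.one_im, Complex.mul_re, Complex.mul_im, Complex.conj_re, Complex.conj_im] at *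
    nlinarith [mul_pos (sub_pos.2 ha') (sub_pos.2 hw')]
  rw [Complex.normSq_eq_norm_sq, Complex.normSq_eq_norm_sq] at h1
  exact lt_of_pow_lt_pow_left₀ 2 (norm_nonneg _) h1

lemma hasDerivAt_mob {a w : ℂ} (ha : ‖a‖ < 1) (hw : ‖w‖ < 1) :
    HasDerivAt (mob a) ((1 - (starRingEnd ℂ) a * a) / (1 - (starRingEnd ℂ) a * w) ^ 2) w := by
  have h0 := mob_denom_ne ha hw
  have h1 : HasDerivAt (fun w => w - a) 1 w := (hasDerivAt_id w).sub_const a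
  have h2 : HasDerivAt (fun w => 1 - (starRingEnd ℂ) a * w) (-((starRingEnd ℂ) a * 1)) w :=
    ((hasDerivAt_id w).const_mul _).const_sub 1
  refine (h1.fun_div h2 h0).congr_deriv ?_
  congr 1
  ring

lemma mob_injOn {a : ℂ} (ha : ‖a‖ < 1) : InjOn (mob a) (ball 0 1) := by
  intro w hw w' hw' h
  rw [mem_ball_zero_iff] at hw hw'
  rw [mob, mob, div_eq_div_iff (mob_denom_ne ha hw) (mob_denom_ne ha hw')] at h
  have h2 : (w - w') * (1 - (starRingEnd ℂ) a * a) = 0 := by linear_combination h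
  rcases mul_eq_zero.1 h2 with h3 | h3
  · exact sub_eq_zero.1 h3
  · exact absurd h3 (mob_denom_ne ha ha)

/-- **Riemann mapping theorem** for bounded domains admitting square roots. -/
theorem exists_conformal {W : Set ℂ} (hW : IsOpen W) (hWc : IsPreconnected W)
    (hb : Bornology.IsBounded W) {z₀ : ℂ} (hz₀ : z₀ ∈ W)
    (hs : ∀ h : ℂ → ℂ, DifferentiableOn ℂ h W → (∀ z ∈ W, h z ≠ 0) →
      ∃ g : ℂ → ℂ, DifferentiableOn ℂ g W ∧ ∀ z ∈ W, g z ^ 2 = h z) :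
    ∃ g : ℂ → ℂ, DifferentiableOn ℂ g W ∧ InjOn g W ∧ g '' W = ball 0 1 := by
  set 𝓕 : Set (ℂ → ℂ) := {g | DifferentiableOn ℂ g W ∧ InjOn g W ∧ MapsTo g W (ball 0 1) ∧ g z₀ = 0}
    with h𝓕
  set S : Set ℝ := (fun g : ℂ → ℂ => ‖deriv g z₀‖) '' 𝓕 with hS
  obtain ⟨r, hr, hrW⟩ := Metric.isOpen_iff.1 hW z₀ hz₀
  have hbdd : BddAbove S := by
    refine ⟨1 / r, ?_⟩
    rintro _ ⟨g, ⟨h1, h2, h3, h4⟩, rfl⟩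
    refine Complex.norm_deriv_le_div_of_mapsTo_ball (h1.mono hrW) ?_ hr
    rw [h4]
    exact fun x hx => ball_subset_closedBall (h3 (hrW hx))
  obtain ⟨M, hM⟩ := hb.subset_closedBall z₀
  have hMpos : 0 < |M| + 1 := by positivity
  have hg₁ : (fun z => (z - z₀) / ((|M| + 1 : ℝ) : ℂ)) ∈ 𝓕 := by
    have hne : ((|M| + 1 : ℝ) : ℂ) ≠ 0 := by exact_mod_cast hMpos.ne'
    refine ⟨by fun_prop, ?_, ?_, by simp⟩
    · intro x _ y _ h
      simp only [div_left_inj' hne] at h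
      linear_combination h
    · intro x hx
      have := hM hx
      rw [mem_closedBall, dist_eq_norm] at this
      rw [mem_ball_zero_iff, norm_div, Complex.norm_real, Real.norm_of_nonneg hMpos.le,
        div_lt_one hMpos]
      linarith [le_abs_self M]
  have hSne : S.Nonempty := ⟨_, mem_image_of_mem _ hg₁⟩
  have hSpos : 0 < sSup S := by
    refine lt_of_lt_of_le ?_ (le_csSup hbdd (mem_image_of_mem _ hg₁))
    have hne : ((|M| + 1 : ℝ) : ℂ) ≠ 0 := by exact_mod_cast hMpos.ne'
    have : HasDerivAt (fun z => (z - z₀) / ((|M| + 1 : ℝ) : ℂ)) (1 / ((|M| + 1 : ℝ) : ℂ)) z₀ :=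
      ((hasDerivAt_id z₀).sub_const z₀).div_const _
    rw [this.deriv]
    exact norm_pos_iff.2 (div_ne_zero one_ne_zero hne)
  obtain ⟨u, -, hu, huS⟩ := exists_seq_tendsto_sSup hSne hbdd
  choose G hGF hGu using huS
  set l : Ultrafilter ℕ := Ultrafilter.of atTop with hl
  have hle : (l : Filter ℕ) ≤ atTop := Ultrafilter.of_le _
  obtain ⟨g, hg⟩ := exists_tendstoLocallyUniformlyOn hW l (fun n => (hGF n).1)
    (fun n => (hGF n).2.2.1)
  have hgd : DifferentiableOn ℂ g W :=
    hg.differentiableOn (Eventually.of_forall fun n => (hGF n).1) hW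
  have hgderiv : ‖deriv g z₀‖ = sSup S := by
    have h1 := ((hg.deriv (Eventually.of_forall fun n => (hGF n).1) hW).tendsto_at hz₀).norm
    have h2 : Tendsto u l (𝓝 (sSup S)) := hu.mono_left hle
    refine tendsto_nhds_unique h1 (h2.congr fun n => ?_)
    exact (hGu n).symm
  have hg0 : g z₀ = 0 := by
    have := hg.tendsto_at hz₀
    simp only [(hGF _).2.2.2] at this
    exact tendsto_nhds_unique this tendsto_const_nhds
  have hd0 : deriv g z₀ ≠ 0 := by
    rw [← norm_pos_iff, hgderiv]; exact hSpos
  have hgi : InjOn g W := injOn_of_tendstoLocallyUniformlyOn hW hWc (fun n => (hGF n).1)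
    (fun n => (hGF n).2.1) hg hz₀ hd0
  have hgm : MapsTo g W (ball 0 1) := by
    have hle1 : ∀ z ∈ W, ‖g z‖ ≤ 1 := fun z hz =>
      le_of_tendsto (hg.tendsto_at hz).norm (Eventually.of_forall fun n =>
        (mem_ball_zero_iff.1 ((hGF n).2.2.1 hz)).le)
    have hop : IsOpen (g '' W) := by
      rcases (hgd.analyticOnNhd hW).is_constant_or_isOpen hWc with ⟨w, hw⟩ | h
      · exfalso
        apply hd0
        have h2 : g =ᶠ[𝓝 z₀] fun _ => w := by
          filter_upwards [hW.mem_nhds hz₀] with y hy using hw y hy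
        rw [h2.deriv_eq, deriv_const]
      · exact h W subset_rfl hW
    have hsub : g '' W ⊆ interior (closedBall 0 1) :=
      interior_maximal (by rintro _ ⟨z, hz, rfl⟩; simpa using hle1 z hz) hop
    rw [interior_closedBall _ one_ne_zero] at hsub
    exact fun z hz => hsub (mem_image_of_mem _ hz)
  refine ⟨g, hgd, hgi, (image_subset_iff.2 hgm).antisymm fun a ha => ?_⟩
  by_contra hna
  rw [mem_ball_zero_iff] at ha
  have hg1 : ∀ z ∈ W, ‖g z‖ < 1 := fun z hz => mem_ball_zero_iff.1 (hgm hz)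
  have hGd : ∀ z ∈ W, HasDerivAt (fun z => mob a (g z))
      ((1 - (starRingEnd ℂ) a * a) / (1 - (starRingEnd ℂ) a * g z) ^ 2 * deriv g z) z :=
    fun z hz => (hasDerivAt_mob ha (hg1 z hz)).comp z
      (hgd.differentiableAt (hW.mem_nhds hz)).hasDerivAt
  obtain ⟨s, hsd, hs2⟩ := hs (fun z => mob a (g z))
    (fun z hz => (hGd z hz).differentiableAt.differentiableWithinAt) (by
      intro z hz h0
      rw [mob, div_eq_zero_iff] at h0
      rcases h0 with h0 | h0
      · exact hna ⟨z, hz, sub_eq_zero.1 h0⟩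
      · exact mob_denom_ne ha (hg1 z hz) h0)
  have hs1 : ∀ z ∈ W, ‖s z‖ < 1 := by
    intro z hz
    have := norm_mob_lt ha (hg1 z hz)
    rw [← hs2 z hz, norm_pow] at this
    exact (pow_lt_one_iff_of_nonneg (norm_nonneg _) two_ne_zero).1 this
  set b := s z₀ with hbdef
  have hb1 : ‖b‖ < 1 := hs1 z₀ hz₀
  have hb2 : b ^ 2 = -a := by rw [hbdef, hs2 z₀ hz₀, hg0]; simp [mob]
  have ha0 : a ≠ 0 := by
    rintro rfl
    exact hna ⟨z₀, hz₀, hg0⟩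
  have hb0 : b ≠ 0 := by
    intro h
    rw [h] at hb2
    exact ha0 (by simpa using hb2.symm)
  have hsD : ∀ z ∈ W, HasDerivAt s (deriv s z) z :=
    fun z hz => (hsd.differentiableAt (hW.mem_nhds hz)).hasDerivAt
  have hmem : (fun z => mob b (s z)) ∈ 𝓕 := by
    refine ⟨fun z hz => ((hasDerivAt_mob hb1 (hs1 z hz)).comp z
      (hsD z hz)).differentiableAt.differentiableWithinAt, ?_, ?_, by simp [mob, hbdef]⟩
    · intro x hx y hy hxy
      have h1 := mob_injOn hb1 (mem_ball_zero_iff.2 (hs1 x hx)) (mem_ball_zero_iff.2 (hs1 y hy)) hxy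
      have h2 : mob a (g x) = mob a (g y) := by rw [← hs2 x hx, ← hs2 y hy, h1]
      exact hgi hx hy (mob_injOn ha (hgm hx) (hgm hy) h2)
    · exact fun z hz => mem_ball_zero_iff.2 (norm_mob_lt hb1 (hs1 z hz))
  have hle' := le_csSup hbdd (mem_image_of_mem (fun g : ℂ → ℂ => ‖deriv g z₀‖) hmem)
  have hcomp : HasDerivAt (fun z => mob b (s z))
      ((1 - (starRingEnd ℂ) b * b) / (1 - (starRingEnd ℂ) b * s z₀) ^ 2 * deriv s z₀) z₀ :=
    (hasDerivAt_mob hb1 (hs1 z₀ hz₀)).comp z₀ (hsD z₀ hz₀)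
  rw [hcomp.deriv, ← hbdef, ← hgderiv] at hle'
  have hsq : 2 * b * deriv s z₀ = (1 - (starRingEnd ℂ) a * a) * deriv g z₀ := by
    have h1 := (hsD z₀ hz₀).fun_pow 2
    have h2 := hGd z₀ hz₀
    have h3 : (fun z => s z ^ 2) =ᶠ[𝓝 z₀] fun z => mob a (g z) := by
      filter_upwards [hW.mem_nhds hz₀] with y hy using hs2 y hy
    have := h1.unique (h2.congr_of_eventuallyEq h3)
    rw [hg0] at this
    simpa [hbdef] using this
  have hcb : (starRingEnd ℂ) b * b = ((‖b‖ ^ 2 : ℝ) : ℂ) := by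
    rw [mul_comm, Complex.mul_conj, Complex.normSq_eq_norm_sq]
  have hca : (starRingEnd ℂ) a * a = ((‖b‖ ^ 4 : ℝ) : ℂ) := by
    have : ‖a‖ = ‖b‖ ^ 2 := by rw [← norm_pow, hb2, norm_neg]
    rw [mul_comm, Complex.mul_conj, Complex.normSq_eq_norm_sq, this]
    congr 1; ring
  rw [hcb] at hle'
  rw [hca] at hsq
  have hbpos : 0 < ‖b‖ := norm_pos_iff.2 hb0
  have hb2lt : 0 < 1 - ‖b‖ ^ 2 := by nlinarith
  have hn1 : ‖(1 - ((‖b‖ ^ 2 : ℝ) : ℂ)) / (1 - ((‖b‖ ^ 2 : ℝ) : ℂ)) ^ 2‖ = (1 - ‖b‖ ^ 2)⁻¹ := by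
    have : (1 - ((‖b‖ ^ 2 : ℝ) : ℂ)) = ((1 - ‖b‖ ^ 2 : ℝ) : ℂ) := by push_cast; ring
    rw [this, norm_div, norm_pow, Complex.norm_real, Real.norm_of_nonneg hb2lt.le]
    field_simp
  have hn2 : 2 * ‖b‖ * ‖deriv s z₀‖ = (1 - ‖b‖ ^ 4) * ‖deriv g z₀‖ := by
    have := congrArg norm hsq
    have e : (1 - ((‖b‖ ^ 4 : ℝ) : ℂ)) = ((1 - ‖b‖ ^ 4 : ℝ) : ℂ) := by push_cast; ring
    have h4 : 0 < 1 - ‖b‖ ^ 4 := by nlinarith [sq_nonneg ‖b‖]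
    rw [e, norm_mul, norm_mul, norm_mul, Complex.norm_real, Real.norm_of_nonneg h4.le] at this
    simpa using this
  rw [norm_mul, hn1, inv_mul_le_iff₀ hb2lt] at hle'
  have hgp : 0 < ‖deriv g z₀‖ := norm_pos_iff.2 hd0
  have h5 : (1 - ‖b‖ ^ 4) * ‖deriv g z₀‖ ≤ 2 * ‖b‖ * ((1 - ‖b‖ ^ 2) * ‖deriv g z₀‖) := by
    rw [← hn2]; gcongr
  have h6 : 1 - ‖b‖ ^ 4 ≤ 2 * ‖b‖ * (1 - ‖b‖ ^ 2) := by
    refine le_of_mul_le_mul_right ?_ hgp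
    linarith
  have h7 : (1 - ‖b‖ ^ 2) * (1 + ‖b‖ ^ 2) ≤ (1 - ‖b‖ ^ 2) * (2 * ‖b‖) := by nlinarith
  have h8 := le_of_mul_le_mul_left h7 hb2lt
  nlinarith [sq_pos_of_pos (sub_pos.2 hb1)]

lemma isBounded_lem {F : ℂ[X]} (hF : 0 < F.degree) (R : ℝ) : Bornology.IsBounded (lem F R) :=
  (isCompact_closedLem hF R).isBounded.subset fun z hz => show ‖F.eval z‖ ≤ R from le_of_lt hz

lemma contractibleSpace_lemComp {F : ℂ[X]} (hF : 0 < F.degree) {R : ℝ} {z₀ : ℂ}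
    (hz₀ : z₀ ∈ lem F R) : ContractibleSpace (lemComp F R z₀) := by
  have hW := isOpen_lemComp F R z₀
  have hWc := isPreconnected_lemComp F R z₀
  obtain ⟨g, hgd, hgi, hgs⟩ := exists_conformal hW hWc
    ((isBounded_lem hF R).subset (connectedComponentIn_subset _ _)) (mem_lemComp hz₀)
    fun h hh hne => exists_sqrt hF hz₀ hh hne
  have hop : ∀ V ⊆ lemComp F R z₀, IsOpen V → IsOpen (g '' V) := by
    rcases (hgd.analyticOnNhd hW).is_constant_or_isOpen hWc with ⟨w, hw⟩ | h
    · exfalso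
      have h1 : g '' lemComp F R z₀ ⊆ {w} := by rintro _ ⟨z, hz, rfl⟩; exact hw z hz
      rw [hgs] at h1
      have h2 : (0 : ℂ) ∈ ({w} : Set ℂ) := h1 (by simp)
      have h3 : (1 / 2 : ℂ) ∈ ({w} : Set ℂ) := h1 (by simp; norm_num)
      rw [mem_singleton_iff] at h2 h3
      rw [← h2] at h3
      norm_num at h3
    · exact h
  have hbij : BijOn g (lemComp F R z₀) (ball 0 1) := ⟨mapsTo_iff_image_subset.2 hgs.subset, hgi,
    hgs.ge⟩
  let e : lemComp F R z₀ ≃ ball (0 : ℂ) 1 := hbij.equiv g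
  have hec : Continuous e :=
    (continuousOn_iff_continuous_domRestrict.1 hgd.continuousOn).subtype_mk _
  have heo : IsOpenMap e := by
    intro V hV
    have h1 := hop _ (Subtype.coe_image_subset _ V) (hW.isOpenMap_subtype_val V hV)
    have h2 : e '' V = Subtype.val ⁻¹' (g '' (Subtype.val '' V)) := by
      ext y
      constructor
      · rintro ⟨x, hx, rfl⟩
        exact ⟨x, ⟨x, hx, rfl⟩, rfl⟩
      · rintro ⟨_, ⟨x, hx, rfl⟩, hxy⟩
        exact ⟨x, hx, Subtype.ext hxy⟩
    rw [h2]
    exact h1.preimage continuous_subtype_val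
  have : ContractibleSpace (ball (0 : ℂ) 1) :=
    (convex_ball 0 1).contractibleSpace ⟨0, by simp⟩
  exact (e.toHomeomorphOfContinuousOpen hec heo).contractibleSpace

/-- The component of `u` in the preimage of `Ω` under the polynomial `F`. -/
def preComp (F : ℂ[X]) (Ω : Set ℂ) (u : ℂ) : Set ℂ := connectedComponentIn (F.eval ⁻¹' Ω) u

lemma isOpen_preComp (F : ℂ[X]) {Ω : Set ℂ} (hΩ : IsOpen Ω) (u : ℂ) : IsOpen (preComp F Ω u) :=
  (hΩ.preimage F.continuous).connectedComponentIn

lemma isPreconnected_preComp (F : ℂ[X]) (Ω : Set ℂ) (u : ℂ) : IsPreconnected (preComp F Ω u) :=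
  isPreconnected_connectedComponentIn

lemma mem_preComp {F : ℂ[X]} {Ω : Set ℂ} {u : ℂ} (h : F.eval u ∈ Ω) : u ∈ preComp F Ω u :=
  mem_connectedComponentIn h

lemma preComp_mapsTo (F : ℂ[X]) (Ω : Set ℂ) (u : ℂ) : MapsTo F.eval (preComp F Ω u) Ω :=
  fun _ hx => connectedComponentIn_subset (F.eval ⁻¹' Ω) u hx

lemma preComp_eq {F : ℂ[X]} {Ω : Set ℂ} {u v : ℂ} (h : v ∈ preComp F Ω u) :
    preComp F Ω u = preComp F Ω v := connectedComponentIn_eq h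

lemma subset_preComp {F : ℂ[X]} {Ω s : Set ℂ} {u : ℂ} (hs : IsPreconnected s)
    (hsΩ : MapsTo F.eval s Ω) (hu : u ∈ s) : s ⊆ preComp F Ω u :=
  hs.subset_connectedComponentIn hu hsΩ

lemma preComp_mono (F : ℂ[X]) {Ω Ω' : Set ℂ} (h : Ω ⊆ Ω') (u : ℂ) :
    preComp F Ω u ⊆ preComp F Ω' u :=
  connectedComponentIn_mono u (preimage_mono h)

/-- Components of an open set are relatively closed. -/
lemma closure_connectedComponentIn_inter {A : Set ℂ} (hA : IsOpen A) {u x : ℂ}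
    (hx : x ∈ closure (connectedComponentIn A u)) (hxA : x ∈ A) :
    x ∈ connectedComponentIn A u := by
  obtain ⟨y, hy, hy'⟩ := mem_closure_iff.1 hx _ (hA.connectedComponentIn (x := x))
    (mem_connectedComponentIn hxA)
  rw [connectedComponentIn_eq hy', ← connectedComponentIn_eq hy]
  exact mem_connectedComponentIn hxA

lemma isOpenMap_eval {F : ℂ[X]} (hF : 0 < F.degree) : IsOpenMap fun z => F.eval z := by
  have han : AnalyticOnNhd ℂ (fun z => F.eval z) univ :=
    F.differentiable.differentiableOn.analyticOnNhd isOpen_univ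
  rcases han.is_constant_or_isOpen isPreconnected_univ with ⟨w, hw⟩ | h
  · exfalso
    have : F = C w := Polynomial.funext fun z => by simpa using hw z (mem_univ z)
    rw [this] at hF
    exact absurd hF (not_lt.2 degree_C_le)
  · exact fun V hV => h V (subset_univ _) hV

lemma image_preComp {F : ℂ[X]} (hF : 0 < F.degree) {Ω : Set ℂ} (hΩ : IsOpen Ω)
    (hΩc : IsPreconnected Ω) {u : ℂ} (hu : F.eval u ∈ Ω) : F.eval '' preComp F Ω u = Ω := by
  refine (image_subset_iff.2 (preComp_mapsTo F Ω u)).antisymm ?_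
  refine hΩc.subset_of_closure_inter_subset (isOpenMap_eval hF _ (isOpen_preComp F hΩ u))
    ⟨F.eval u, hu, mem_image_of_mem _ (mem_preComp hu)⟩ ?_
  rintro y ⟨hy, hyΩ⟩
  obtain ⟨x, hx, rfl⟩ := F.isClosedMap_eval.closure_image_subset _ hy
  exact ⟨x, closure_connectedComponentIn_inter (hΩ.preimage F.continuous) hx hyΩ, rfl⟩

lemma finite_fiber {F : ℂ[X]} (hF : 0 < F.degree) (w : ℂ) : {z | F.eval z = w}.Finite := by
  have hne : F - C w ≠ 0 := by
    intro h
    rw [sub_eq_zero.1 h] at hF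
    exact absurd hF (not_lt.2 degree_C_le)
  refine ((F - C w).roots.toFinset.finite_toSet).subset fun z hz => ?_
  simp only [mem_ofPred_eq] at hz
  simp [hne, hz]

/-- Unbranched components of preimages of simply connected domains are mapped injectively. -/
lemma injOn_preComp {F : ℂ[X]} (hF : 0 < F.degree) {Ω : Set ℂ} (hΩ : IsOpen Ω)
    [ContractibleSpace Ω] {u : ℂ} (hcrit : ∀ v ∈ preComp F Ω u, F.derivative.eval v ≠ 0) :
    InjOn F.eval (preComp F Ω u) := by
  set U := preComp F Ω u with hU
  have hUo : IsOpen U := isOpen_preComp F hΩ u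
  let p : U → Ω := (preComp_mapsTo F Ω u).restrict _ _ _
  have hpc : Continuous p := (F.continuous.comp continuous_subtype_val).subtype_mk _
  have hlocF : IsLocalHomeomorphOn F.eval U := fun x hx =>
    ⟨_, ((F.hasStrictDerivAt x).hasStrictFDerivAt_equiv
      (hcrit x hx)).mem_toOpenPartialHomeomorph_source, by simp⟩
  have hloc : IsLocalHomeomorph p := by
    have h1 : IsLocalHomeomorph (Subtype.val : Ω → ℂ) :=
        hΩ.isOpenEmbedding_subtypeVal.isLocalHomeomorph
    have h2 : IsLocalHomeomorph (Subtype.val : U → ℂ) :=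
        hUo.isOpenEmbedding_subtypeVal.isLocalHomeomorph
    refine IsLocalHomeomorph.of_comp (g := Subtype.val) ?_ h1 hpc
    rw [isLocalHomeomorph_iff_isLocalHomeomorphOn_univ] at h2 ⊢
    exact hlocF.comp h2 fun x _ => x.2
  have hclosed : IsClosedMap p := by
    intro A hA
    obtain ⟨B, hB, rfl⟩ := isClosed_induced_iff.1 hA
    rw [isClosed_induced_iff]
    refine ⟨F.eval '' (closure U ∩ B), F.isClosedMap_eval _ (isClosed_closure.inter hB), ?_⟩
    ext y
    constructor
    · rintro ⟨x, ⟨hx, hxB⟩, hxy⟩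
      have hxU : x ∈ U := closure_connectedComponentIn_inter (hΩ.preimage F.continuous) hx
        (show F.eval x ∈ Ω from (show F.eval x = y from hxy) ▸ y.2)
      exact ⟨⟨x, hxU⟩, hxB, Subtype.ext hxy⟩
    · rintro ⟨x, hx, rfl⟩
      exact ⟨x, ⟨subset_closure x.2, hx⟩, rfl⟩
  have hcov : IsCoveringMap p := by
    rw [isCoveringMap_iff_isCoveringMapOn_univ]
    refine hclosed.isCoveringMapOn_of_isLocalHomeomorphOn (fun y _ => ?_) ?_
    · refine Finite.of_finite_image (f := Subtype.val) ((finite_fiber hF y).subset ?_)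
        Subtype.val_injective.injOn
      rintro _ ⟨x, hx, rfl⟩
      exact congrArg Subtype.val hx
    · rw [preimage_univ]
      exact isLocalHomeomorph_iff_isLocalHomeomorphOn_univ.1 hloc
  have : LocallyPathConnectedSpace Ω := hΩ.locallyPathConnectedSpace
  have : PreconnectedSpace U :=
      isPreconnected_iff_preconnectedSpace.1 (isPreconnected_preComp F Ω u)
  intro x hx y hy hxy
  obtain ⟨s, ⟨hs1, hs2⟩, -⟩ := hcov.existsUnique_continuousMap_lifts (ContinuousMap.id Ω)
    (p ⟨x, hx⟩) ⟨x, hx⟩ rfl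
  have hid : s ∘ p = id := by
    refine hcov.eq_of_comp_eq (s.continuous.comp hpc) continuous_id ?_ ⟨x, hx⟩ hs1
    rw [← Function.comp_assoc, hs2]
    rfl
  have h1 := congrFun hid ⟨x, hx⟩
  have h2 := congrFun hid ⟨y, hy⟩
  have h3 : p ⟨x, hx⟩ = p ⟨y, hy⟩ := Subtype.ext hxy
  simp only [Function.comp_apply, id] at h1 h2
  rw [h3, h2] at h1
  exact (congrArg Subtype.val h1).symm

/-- The `n`-th iterate of a polynomial, as a polynomial. -/
noncomputable def it (f : ℂ[X]) (n : ℕ) : ℂ[X] := f.comp^[n] X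

@[simp] lemma it_zero (f : ℂ[X]) : it f 0 = X := rfl

lemma eval_it (f : ℂ[X]) (n : ℕ) (z : ℂ) : (it f n).eval z = (fun w => f.eval w)^[n] z := by
  rw [it, iterate_comp_eval]; simp

lemma eval_it_add (f : ℂ[X]) (m n : ℕ) (z : ℂ) :
    (it f (m + n)).eval z = (it f m).eval ((it f n).eval z) := by
  simp only [eval_it, Function.iterate_add_apply]

lemma eval_it_succ (f : ℂ[X]) (n : ℕ) (z : ℂ) :
    (it f (n + 1)).eval z = (it f n).eval (f.eval z) := by
  simp only [eval_it, Function.iterate_succ_apply]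

lemma eval_it_succ' (f : ℂ[X]) (n : ℕ) (z : ℂ) :
    (it f (n + 1)).eval z = f.eval ((it f n).eval z) := by
  simp only [eval_it, Function.iterate_succ_apply']

lemma it_one_eval (f : ℂ[X]) (z : ℂ) : (it f 1).eval z = f.eval z := by
  simp [eval_it]

lemma degree_it_pos {f : ℂ[X]} (hf : 0 < f.degree) (n : ℕ) : 0 < (it f n).degree := by
  rw [← natDegree_pos_iff_degree_pos] at hf ⊢
  rw [it, natDegree_iterate_comp, natDegree_X, mul_one]
  exact pow_pos hf n

/-- A component of a lemniscate domain. -/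
def IsLemn (Ω : Set ℂ) : Prop :=
  ∃ (G : ℂ[X]) (R : ℝ) (p : ℂ), 0 < G.degree ∧ p ∈ lem G R ∧ Ω = lemComp G R p

lemma IsLemn.isOpen {Ω : Set ℂ} (h : IsLemn Ω) : IsOpen Ω := by
  obtain ⟨G, R, p, _, _, rfl⟩ := h
  exact isOpen_lemComp G R p

lemma IsLemn.contractibleSpace {Ω : Set ℂ} (h : IsLemn Ω) : ContractibleSpace Ω := by
  obtain ⟨G, R, p, hG, hp, rfl⟩ := h
  exact contractibleSpace_lemComp hG hp

lemma isLemn_ball (c : ℂ) {r : ℝ} (hr : 0 < r) : IsLemn (ball c r) := by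
  have e : lem (X - C c) r = ball c r := by
    ext z; simp [lem, dist_eq_norm]
  have hc : c ∈ lem (X - C c) r := by rw [e]; exact mem_ball_self hr
  refine ⟨X - C c, r, c, by rw [degree_X_sub_C]; exact zero_lt_one, hc, ?_⟩
  refine Subset.antisymm ?_ ?_
  · exact (convex_ball c r).isPreconnected.subset_connectedComponentIn (mem_ball_self hr) e.ge
  · exact (connectedComponentIn_subset _ _).trans e.le

lemma preComp_lemComp {G F : ℂ[X]} {R : ℝ} {p u : ℂ} (hu : F.eval u ∈ lemComp G R p) :
    preComp F (lemComp G R p) u = lemComp (G.comp F) R u := by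
  have hu' : u ∈ lem (G.comp F) R := by
    have := connectedComponentIn_subset (lem G R) p hu
    simpa [lem] using this
  refine Subset.antisymm ?_ ?_
  · refine (isPreconnected_preComp F _ u).subset_connectedComponentIn (mem_preComp hu) ?_
    intro z hz
    have := connectedComponentIn_subset (lem G R) p (preComp_mapsTo F _ u hz)
    simpa [lem] using this
  · refine subset_preComp (isPreconnected_lemComp _ _ _) ?_ (mem_lemComp hu')
    rw [mapsTo_iff_image_subset]
    have e : lemComp G R p = lemComp G R (F.eval u) := connectedComponentIn_eq hu
    rw [e]
    refine ((isPreconnected_lemComp _ _ _).image _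
      F.continuous.continuousOn).subset_connectedComponentIn
      (mem_image_of_mem _ (mem_lemComp hu')) ?_
    rintro _ ⟨z, hz, rfl⟩
    have := connectedComponentIn_subset (lem (G.comp F) R) u hz
    simpa [lem] using this

lemma degree_comp_pos {G F : ℂ[X]} (hG : 0 < G.degree) (hF : 0 < F.degree) :
    0 < (G.comp F).degree := by
  rw [← natDegree_pos_iff_degree_pos] at *
  rw [natDegree_comp]
  exact Nat.mul_pos hG hF

lemma IsLemn.preComp {Ω : Set ℂ} (h : IsLemn Ω) {F : ℂ[X]} (hF : 0 < F.degree) {u : ℂ}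
    (hu : F.eval u ∈ Ω) : IsLemn (preComp F Ω u) := by
  obtain ⟨G, R, p, hG, hp, rfl⟩ := h
  refine ⟨G.comp F, R, u, degree_comp_pos hG hF, ?_, preComp_lemComp hu⟩
  have := connectedComponentIn_subset (lem G R) p hu
  simpa [lem] using this

/-- The component of `u` in the `n`-th iterated preimage of `Ω`. -/
def pull (f : ℂ[X]) (n : ℕ) (Ω : Set ℂ) (u : ℂ) : Set ℂ := preComp (it f n) Ω u

lemma pull_add {f : ℂ[X]} (m n : ℕ) {Ω : Set ℂ} {u : ℂ} (hu : (it f (m + n)).eval u ∈ Ω) :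
    pull f (m + n) Ω u = pull f n (pull f m Ω ((it f n).eval u)) u := by
  have hu' : (it f m).eval ((it f n).eval u) ∈ Ω := by rwa [← eval_it_add]
  refine Subset.antisymm ?_ ?_
  · refine subset_preComp (isPreconnected_preComp _ _ _) ?_ (mem_preComp hu)
    rw [mapsTo_iff_image_subset]
    refine subset_preComp ((isPreconnected_preComp _ _ _).image _
      (it f n).continuous.continuousOn) ?_ (mem_image_of_mem _ (mem_preComp hu))
    rintro _ ⟨z, hz, rfl⟩
    have := preComp_mapsTo (it f (m + n)) Ω u hz
    simp only [eval_it_add] at this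
    exact this
  · refine subset_preComp (isPreconnected_preComp _ _ _) ?_ (mem_preComp (mem_preComp hu'))
    intro z hz
    simp only [eval_it_add]
    exact preComp_mapsTo _ _ _ (preComp_mapsTo _ _ _ hz)

lemma image_pull_add {f : ℂ[X]} (hf : 0 < f.degree) (m n : ℕ) {Ω : Set ℂ} (hΩ : IsOpen Ω) {u : ℂ}
    (hu : (it f (m + n)).eval u ∈ Ω) :
    (it f n).eval '' pull f (m + n) Ω u = pull f m Ω ((it f n).eval u) := by
  rw [pull_add m n hu]
  exact image_preComp (degree_it_pos hf n) (isOpen_preComp _ hΩ _) (isPreconnected_preComp _ _ _)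
    (mem_preComp (by rwa [← eval_it_add]))

lemma pull_one_eq (f : ℂ[X]) (Ω : Set ℂ) (u : ℂ) : pull f 1 Ω u = preComp f Ω u := by
  have : it f 1 = f := by simp [it]
  rw [pull, this]

lemma ncard_fiber_le {f : ℂ[X]} (hf : 0 < f.degree) (w : ℂ) :
    {z | f.eval z = w}.ncard ≤ f.natDegree := by
  have hne : f - C w ≠ 0 := by
    intro h
    rw [sub_eq_zero.1 h] at hf
    exact absurd hf (not_lt.2 degree_C_le)
  have h1 : {z | f.eval z = w} = ((f - C w).roots.toFinset : Set ℂ) := by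
    ext z; simp [hne, sub_eq_zero]
  rw [h1, Set.ncard_coe_finset]
  refine (Multiset.toFinset_card_le _).trans ((card_roots' _).trans ?_)
  rw [natDegree_sub_C]

lemma ncard_fiber_pull_le {f : ℂ[X]} (hf : 0 < f.degree) (n : ℕ) {Ω : Set ℂ} (hΩ : IsLemn Ω)
    (u : ℂ) (hu : (it f n).eval u ∈ Ω) (w : ℂ) (T : Finset ℕ)
    (hT : ∀ t < n, ∀ c ∈ pull f (n - t) Ω ((it f t).eval u), f.derivative.eval c = 0 → t ∈ T) :
    {z | z ∈ pull f n Ω u ∧ (it f n).eval z = w}.ncard ≤ f.natDegree ^ T.card := by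
  classical
  have hd1 : 1 ≤ f.natDegree := natDegree_pos_iff_degree_pos.2 hf
  induction n generalizing u T with
  | zero =>
    refine le_trans ?_ (Nat.one_le_pow _ _ hd1)
    refine (Set.ncard_le_ncard (t := {w}) ?_ (finite_singleton w)).trans (by simp)
    rintro z ⟨-, hz⟩
    simpa using hz
  | succ n ih =>
    set v := f.eval u with hv
    have hv' : (it f n).eval v ∈ Ω := by rwa [hv, ← eval_it_succ]
    set T' : Finset ℕ := (T.erase 0).image Nat.pred with hT'
    have hIH := ih v hv' T' (by
      intro t ht c hc hc0
      have h1 := hT (t + 1) (by omega) c (by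
        rw [eval_it_succ]; convert hc using 2; omega) hc0
      rw [hT', Finset.mem_image]
      exact ⟨t + 1, by simp [h1], rfl⟩)
    have hV1 : pull f (n + 1) Ω u = preComp f (pull f n Ω v) u := by
      rw [pull_add n 1 hu, pull_one_eq, it_one_eval]
    have hL1 : IsLemn (pull f n Ω v) := hΩ.preComp (degree_it_pos hf n) hv'
    have hcT : T'.card ≤ (T.erase 0).card := Finset.card_image_le
    have hfin1 : {z | z ∈ pull f (n + 1) Ω u ∧ (it f (n + 1)).eval z = w}.Finite :=
      (finite_fiber (degree_it_pos hf (n + 1)) w).subset fun z hz => hz.2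
    have hfin2 : {z | z ∈ pull f n Ω v ∧ (it f n).eval z = w}.Finite :=
      (finite_fiber (degree_it_pos hf n) w).subset fun z hz => hz.2
    set A := hfin1.toFinset with hA
    set B := hfin2.toFinset with hB
    rw [Set.ncard_eq_toFinset_card _ hfin1]
    rw [Set.ncard_eq_toFinset_card _ hfin2] at hIH
    have himg : A.image f.eval ⊆ B := by
      intro y hy
      obtain ⟨z, hz, rfl⟩ := Finset.mem_image.1 hy
      rw [hA, Set.Finite.mem_toFinset] at hz
      rw [hB, Set.Finite.mem_toFinset]
      have h1 := hz.1
      rw [hV1] at h1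
      exact ⟨preComp_mapsTo _ _ _ h1, by rw [← eval_it_succ]; exact hz.2⟩
    have hmul : ∀ N : ℕ, (∀ y, (A.filter fun z => f.eval z = y).card ≤ N) →
        A.card ≤ N * f.natDegree ^ T'.card := by
      intro N hN
      refine (Finset.card_le_mul_card_image (f := f.eval) A N fun y _ => hN y).trans ?_
      exact Nat.mul_le_mul_left _ ((Finset.card_le_card himg).trans hIH)
    by_cases h0 : 0 ∈ T
    · refine (hmul f.natDegree fun y => ?_).trans ?_
      · refine le_trans ?_ (ncard_fiber_le hf y)
        rw [Set.ncard_eq_toFinset_card _ (finite_fiber hf y)]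
        refine Finset.card_le_card fun z hz => ?_
        simpa using (Finset.mem_filter.1 hz).2
      · rw [← pow_succ']
        refine Nat.pow_le_pow_right hd1 ?_
        rw [← Finset.card_erase_add_one h0]
        omega
    · refine (hmul 1 fun y => ?_).trans ?_
      · have := hL1.contractibleSpace
        have hinj : InjOn f.eval (preComp f (pull f n Ω v) u) := by
          refine injOn_preComp hf hL1.isOpen fun c hc hc0 => h0 (hT 0 (by omega) c ?_ hc0)
          rw [← hV1] at hc
          simpa using hc
        rw [Finset.card_le_one]
        intro a ha b hb
        rw [Finset.mem_filter, hA, Set.Finite.mem_toFinset] at ha hb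
        have ha1 := ha.1.1
        have hb1 := hb.1.1
        rw [hV1] at ha1 hb1
        exact hinj ha1 hb1 (ha.2.trans hb.2.symm)
      · rw [one_mul]
        refine Nat.pow_le_pow_right hd1 (hcT.trans ?_)
        exact Finset.card_le_card (Finset.erase_subset _ _)

/-- The bound for the multiplicity of pullbacks meeting every critical point at most once. -/
noncomputable def degBound (f : ℂ[X]) : ℕ := f.natDegree ^ f.derivative.roots.toFinset.card

lemma ncard_fiber_pull_le_degBound {f : ℂ[X]} (hf : 0 < f.degree) (n : ℕ) {Ω : Set ℂ}
    (hΩ : IsLemn Ω) (u : ℂ) (hu : (it f n).eval u ∈ Ω)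
    (h : ∀ t₁ t₂ c, t₁ < t₂ → t₂ < n → f.derivative.eval c = 0 →
      c ∈ pull f (n - t₁) Ω ((it f t₁).eval u) → c ∉ pull f (n - t₂) Ω ((it f t₂).eval u)) (w : ℂ) :
    {z | z ∈ pull f n Ω u ∧ (it f n).eval z = w}.ncard ≤ degBound f := by
  classical
  have hd1 : 1 ≤ f.natDegree := natDegree_pos_iff_degree_pos.2 hf
  have hder : f.derivative ≠ 0 := by
    intro h0
    have := derivative_eq_zero.1 h0
    omega
  set T : Finset ℕ := (Finset.range n).filter fun t =>
    ∃ c, c ∈ pull f (n - t) Ω ((it f t).eval u) ∧ f.derivative.eval c = 0 with hT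
  refine (ncard_fiber_pull_le hf n hΩ u hu w T ?_).trans ?_
  · intro t ht c hc hc0
    simp only [hT, Finset.mem_filter, Finset.mem_range]
    exact ⟨ht, c, hc, hc0⟩
  · refine Nat.pow_le_pow_right hd1 ?_
    have hch : ∀ t ∈ T, ∃ c, c ∈ pull f (n - t) Ω ((it f t).eval u) ∧ f.derivative.eval c = 0 :=
      fun t ht => (Finset.mem_filter.1 ht).2
    choose! c hc1 hc2 using hch
    refine Finset.card_le_card_of_injOn c (fun t ht => ?_) ?_
    · simp [hder, hc2 t ht]
    · intro s hs t ht hst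
      have hsn := Finset.mem_range.1 (Finset.mem_filter.1 hs).1
      have htn := Finset.mem_range.1 (Finset.mem_filter.1 ht).1
      by_contra hne
      rcases lt_or_gt_of_ne hne with hlt | hlt
      · exact h s t (c s) hlt htn (hc2 s hs) (hc1 s hs) (by rw [hst]; exact hc1 t ht)
      · exact h t s (c t) hlt hsn (hc2 t ht) (hc1 t ht) (by rw [← hst]; exact hc1 s hs)

lemma hasFDerivAt_real_eval (F : ℂ[X]) (z : ℂ) :
    HasFDerivAt (fun z => F.eval z)
      ((ContinuousLinearMap.toSpanSingleton ℂ (F.derivative.eval z)).restrictScalars ℝ) z :=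
  (F.hasDerivAt z).hasFDerivAt.restrictScalars ℝ

lemma det_restrictScalars_toSpanSingleton (a : ℂ) :
    ((ContinuousLinearMap.toSpanSingleton ℂ a).restrictScalars ℝ).det = ‖a‖ ^ 2 := by
  have h : LinearMap.det (ContinuousLinearMap.toSpanSingleton ℂ a).toLinearMap = a := by
    rw [LinearMap.det_ring]; simp
  rw [ContinuousLinearMap.det]
  have := LinearMap.det_restrictScalars (R := ℝ) (S := ℂ)
    (f := (ContinuousLinearMap.toSpanSingleton ℂ a).toLinearMap)
  rw [h, Algebra.norm_complex_apply, Complex.normSq_eq_norm_sq] at this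
  rw [← this]
  rfl

lemma lintegral_norm_sq_derivative_of_injOn {F : ℂ[X]} {A : Set ℂ} (hA : MeasurableSet A)
    (hinj : InjOn F.eval A) :
    ∫⁻ z in A, ENNReal.ofReal (‖F.derivative.eval z‖ ^ 2) = volume (F.eval '' A) := by
  rw [← lintegral_abs_det_fderiv_eq_addHaar_image volume hA
    (fun z _ => (hasFDerivAt_real_eval F z).hasFDerivWithinAt) hinj]
  simp only [det_restrictScalars_toSpanSingleton, abs_pow, abs_norm]

lemma exists_ball_injOn {F : ℂ[X]} {z : ℂ} (hz : F.derivative.eval z ≠ 0) :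
    ∃ r > 0, InjOn F.eval (ball z r) := by
  have h1 := (F.hasStrictDerivAt z).hasStrictFDerivAt_equiv hz
  obtain ⟨r, hr, h⟩ := Metric.mem_nhds_iff.1
    ((h1.toOpenPartialHomeomorph _).open_source.mem_nhds h1.mem_toOpenPartialHomeomorph_source)
  exact ⟨r, hr, (h1.toOpenPartialHomeomorph _).injOn.mono h⟩

/-- The area formula bound: a map with fibres of cardinality at most `D`. -/
lemma lintegral_norm_sq_derivative_le {F : ℂ[X]} (hF : 0 < F.degree) {V B : Set ℂ} (hV : IsOpen V)
    (hB : MeasurableSet B) (hVB : MapsTo F.eval V B) {D : ℕ}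
    (hD : ∀ w, {z | z ∈ V ∧ F.eval z = w}.ncard ≤ D) :
    ∫⁻ z in V, ENNReal.ofReal (‖F.derivative.eval z‖ ^ 2) ≤ D * volume B := by
  classical
  set S : Set ℂ := {z | F.derivative.eval z = 0} with hS
  have hSfin : S.Finite := by
    have hne : F.derivative ≠ 0 := fun h => by
      have := Polynomial.derivative_eq_zero.1 h
      exact absurd (natDegree_pos_iff_degree_pos.2 hF) (by omega)
    refine (F.derivative.roots.toFinset.finite_toSet).subset fun z hz => ?_
    simpa [hne] using (show F.derivative.eval z = 0 from hz)
  have hWo : IsOpen (V \ S) := hV.sdiff hSfin.isClosed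
  have key : ∀ z ∈ V \ S, ∃ r > 0, InjOn F.eval (ball z r) := fun z hz => exists_ball_injOn hz.2
  choose! r hr hinj using key
  obtain ⟨t, htV, htc, htcov⟩ := TopologicalSpace.countable_cover_nhdsWithin
    (f := fun z => ball z (r z)) (s := V \ S)
    (fun z hz => mem_nhdsWithin_of_mem_nhds (ball_mem_nhds z (hr z hz)))
  rcases (V \ S).eq_empty_or_nonempty with he | ⟨z0, hz0⟩
  · have : volume V = 0 := by
      have h1 : V ⊆ S := sdiff_eq_empty.1 he
      exact measure_mono_null h1 (hSfin.measure_zero _)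
    rw [setLIntegral_measure_zero _ _ this]; exact zero_le
  have htne : t.Nonempty := by
    obtain ⟨x, hx, _⟩ := mem_iUnion₂.1 (htcov hz0); exact ⟨x, hx⟩
  obtain ⟨x, rfl⟩ := htc.exists_eq_range htne
  set A : ℕ → Set ℂ := fun n => disjointed (fun n => ball (x n) (r (x n))) n ∩ V with hA
  have hAm : ∀ n, MeasurableSet (A n) := fun n =>
    (MeasurableSet.disjointed (fun n => measurableSet_ball) n).inter hV.measurableSet
  have hAd : Pairwise (Function.onFun Disjoint A) := fun i j hij =>
    (disjoint_disjointed _ hij).mono inter_subset_left inter_subset_left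
  have hAi : ∀ n, InjOn F.eval (A n) := fun n =>
    (hinj _ (htV (mem_range_self n))).mono (inter_subset_left.trans (disjointed_subset _ n))
  have hAV : ∀ n, A n ⊆ V := fun n => inter_subset_right
  have hcov : V ⊆ (⋃ n, A n) ∪ S := by
    intro z hz
    by_cases hzS : z ∈ S
    · exact Or.inr hzS
    left
    have := htcov ⟨hz, hzS⟩
    rw [biUnion_range, ← iUnion_disjointed] at this
    obtain ⟨n, hn⟩ := mem_iUnion.1 this
    exact mem_iUnion.2 ⟨n, hn, hz⟩
  calc ∫⁻ z in V, ENNReal.ofReal (‖F.derivative.eval z‖ ^ 2)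
      ≤ ∫⁻ z in (⋃ n, A n) ∪ S, ENNReal.ofReal (‖F.derivative.eval z‖ ^ 2) :=
        lintegral_mono_set hcov
    _ ≤ (∫⁻ z in (⋃ n, A n), ENNReal.ofReal (‖F.derivative.eval z‖ ^ 2)) +
        ∫⁻ z in S, ENNReal.ofReal (‖F.derivative.eval z‖ ^ 2) := lintegral_union_le _ _ _
    _ = ∑' n, ∫⁻ z in A n, ENNReal.ofReal (‖F.derivative.eval z‖ ^ 2) := by
        rw [setLIntegral_measure_zero _ _ (hSfin.measure_zero _), add_zero,
          lintegral_iUnion hAm hAd]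
    _ = ∑' n, volume (F.eval '' A n) := by
        simp only [lintegral_norm_sq_derivative_of_injOn (hAm _) (hAi _)]
    _ = ∑' n, ∫⁻ w, (F.eval '' A n).indicator 1 w := by
        congr 1; ext n
        rw [lintegral_indicator_one]
        exact (hAm n).image_of_continuousOn_injOn F.continuous.continuousOn (hAi n)
    _ = ∫⁻ w, ∑' n, (F.eval '' A n).indicator 1 w := by
        rw [lintegral_tsum]
        intro n
        exact ((measurable_one).indicator
          ((hAm n).image_of_continuousOn_injOn F.continuous.continuousOn (hAi n))).aemeasurable
    _ ≤ ∫⁻ w, B.indicator (fun _ => (D : ℝ≥0∞)) w := by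
        refine lintegral_mono fun w => ?_
        refine ENNReal.summable.tsum_le_of_sum_le fun s => ?_
        by_cases hw : w ∈ B
        swap
        · rw [indicator_of_notMem hw]
          refine (Finset.sum_eq_zero fun n _ => indicator_of_notMem ?_ _).le
          rintro ⟨z, hz, rfl⟩
          exact hw (hVB (hAV n hz))
        rw [indicator_of_mem hw]
        have e : ∑ n ∈ s, (F.eval '' A n).indicator (1 : ℂ → ℝ≥0∞) w =
            ((s.filter fun n => w ∈ F.eval '' A n).card : ℝ≥0∞) := by
          rw [Finset.card_filter, Nat.cast_sum]
          refine Finset.sum_congr rfl fun n _ => ?_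
          by_cases h : w ∈ F.eval '' A n <;> simp [indicator, h]
        rw [e, Nat.cast_le]
        refine le_trans ?_ (hD w)
        have hch : ∀ n ∈ (s.filter fun n => w ∈ F.eval '' A n), ∃ z ∈ A n, F.eval z = w :=
          fun n hn => (Finset.mem_filter.1 hn).2
        choose! g hgA hgw using hch
        have hfin : {z | z ∈ V ∧ F.eval z = w}.Finite :=
          (finite_fiber hF w).subset fun z hz => hz.2
        rw [Set.ncard_eq_toFinset_card _ hfin]
        refine Finset.card_le_card_of_injOn g (fun n hn => ?_) ?_
        · simpa using ⟨hAV n (hgA n hn), hgw n hn⟩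
        · intro i hi j hj hij
          by_contra hne
          exact disjoint_left.1 (hAd hne) (hgA i hi) (hij ▸ hgA j hj)
    _ = D * volume B := by rw [lintegral_indicator hB, setLIntegral_const]

/-- Squared norm of the derivative, cut off outside `V`. -/
noncomputable def energy (F : ℂ[X]) (V : Set ℂ) : ℂ → ℝ :=
  V.indicator fun z => ‖F.derivative.eval z‖ ^ 2

lemma energy_nonneg (F : ℂ[X]) (V : Set ℂ) (z : ℂ) : 0 ≤ energy F V z :=
  indicator_nonneg (fun _ _ => sq_nonneg _) z

lemma measurable_energy (F : ℂ[X]) {V : Set ℂ} (hV : IsOpen V) : Measurable (energy F V) :=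
  Measurable.indicator (by fun_prop) hV.measurableSet

lemma intervalIntegrable_energy (F : ℂ[X]) {V : Set ℂ} (hV : IsOpen V) (p : ℂ) (s a b : ℝ) :
    IntervalIntegrable (fun θ => energy F V (circleMap p s θ)) volume a b := by
  have h : IntervalIntegrable (fun θ => ‖F.derivative.eval (circleMap p s θ)‖ ^ 2) volume a b :=
    Continuous.intervalIntegrable (by fun_prop) a b
  rw [intervalIntegrable_iff] at h ⊢
  exact h.indicator (hV.measurableSet.preimage (continuous_circleMap p s).measurable)

lemma le_integral_energy_circle {F : ℂ[X]} {w u p a b : ℂ} {R ρ s : ℝ} (hs : 0 < s) (hρ : ρ < R)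
    (ha : a ∈ preComp F (ball w R) u) (hap : dist a p = s) (haρ : dist (F.eval a) w ≤ ρ)
    (hb : b ∉ preComp F (ball w R) u) (hbp : dist b p = s) :
    (R - ρ) ^ 2 / (2 * Real.pi * s ^ 2) ≤
      ∫ θ in -Real.pi..Real.pi, energy F (preComp F (ball w R) u) (circleMap p s θ) := by
  set V := preComp F (ball w R) u with hVdef
  have hVo : IsOpen V := isOpen_preComp F isOpen_ball u
  have hγ : Continuous (circleMap p s) := continuous_circleMap p s
  have hper : Function.Periodic (circleMap p s) (2 * Real.pi) := periodic_circleMap p s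
  have hex : ∀ z, dist z p = s → ∃ θ, circleMap p s θ = z := fun z hz => by
    have : z ∈ range (circleMap p s) := by
      rw [range_circleMap, mem_sphere, hz, abs_of_pos hs]
    exact this
  obtain ⟨θa, rfl⟩ := hex a hap
  obtain ⟨θb', rfl⟩ := hex b hbp
  obtain ⟨θb, hθb, hbe⟩ := hper.exists_mem_Ico (by positivity) θb' θa
  rw [hbe] at hb
  have hcomp : IsCompact (Icc θa θb ∩ (circleMap p s) ⁻¹' Vᶜ) :=
    isCompact_Icc.inter_right (hVo.isClosed_compl.preimage hγ)
  obtain ⟨θ1, ⟨hθ1, hθ1V⟩, hleast⟩ := hcomp.exists_isLeast ⟨θb, ⟨hθb.1, le_rfl⟩, hb⟩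
  have hlt : θa < θ1 := lt_of_le_of_ne hθ1.1 fun h => hθ1V (h ▸ ha)
  have hin : ∀ θ ∈ Ico θa θ1, circleMap p s θ ∈ V := fun θ hθ => by
    by_contra h
    exact absurd (hleast ⟨⟨hθ.1, (hθ.2.le).trans hθ1.2⟩, h⟩) (not_le.2 hθ.2)
  have hcl : circleMap p s θ1 ∈ closure V := by
    have : θ1 ∈ closure (Ico θa θ1) := by rw [closure_Ico hlt.ne]; exact ⟨hlt.le, le_rfl⟩
    exact map_mem_closure hγ this hin
  have hout : R ≤ dist (F.eval (circleMap p s θ1)) w := by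
    by_contra h
    exact hθ1V (closure_connectedComponentIn_inter (isOpen_ball.preimage F.continuous) hcl
      (show F.eval (circleMap p s θ1) ∈ ball w R from not_le.1 h))
  have hdiff : R - ρ ≤ ‖F.eval (circleMap p s θ1) - F.eval (circleMap p s θa)‖ := by
    have := dist_triangle (F.eval (circleMap p s θ1)) (F.eval (circleMap p s θa)) w
    rw [dist_eq_norm (F.eval (circleMap p s θ1)) (F.eval (circleMap p s θa))] at this
    linarith
  have hder : ∀ θ, HasDerivAt (fun θ => F.eval (circleMap p s θ))
      (F.derivative.eval (circleMap p s θ) * (circleMap 0 s θ * Complex.I)) θ := fun θ =>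
    (F.hasDerivAt _).comp_of_eq θ (hasDerivAt_circleMap p s θ) rfl
  have hcont : Continuous fun θ =>
      F.derivative.eval (circleMap p s θ) * (circleMap 0 s θ * Complex.I) := by fun_prop
  have hint := intervalIntegral.integral_eq_sub_of_hasDerivAt (a := θa) (b := θ1)
    (fun θ _ => hder θ) (hcont.intervalIntegrable _ _)
  have hnorm : ∀ θ, ‖F.derivative.eval (circleMap p s θ) * (circleMap 0 s θ * Complex.I)‖ =
      s * ‖F.derivative.eval (circleMap p s θ)‖ := fun θ => by
    rw [norm_mul, norm_mul, norm_circleMap_zero, Complex.norm_I, abs_of_pos hs]; ring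
  set g := fun θ => energy F V (circleMap p s θ) with hg
  have hgi : ∀ x y, IntervalIntegrable g volume x y := intervalIntegrable_energy F hVo p s
  have hgp : Function.Periodic g (2 * Real.pi) := fun θ => by
    simp only [hg, hper θ]
  set I := ∫ θ in -Real.pi..Real.pi, g θ with hI
  have hI1 : ∫ θ in θa..θ1, g θ ≤ I := by
    have e : I = ∫ θ in θa..θa + 2 * Real.pi, g θ := by
      rw [← hgp.intervalIntegral_add_eq (-Real.pi) θa, hI]; congr 1; ring
    rw [e]
    exact intervalIntegral.integral_mono_interval le_rfl hlt.le (hθ1.2.trans hθb.2.le)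
      (ae_of_all _ fun _ => energy_nonneg _ _ _) (hgi _ _)
  set lam := (R - ρ) / (2 * Real.pi * s) with hlam
  have hRρ : 0 < R - ρ := sub_pos.2 hρ
  have hlam0 : 0 < lam := by positivity
  have h1 : R - ρ ≤ ∫ θ in θa..θ1, (s * lam / 2 + s / (2 * lam) * g θ) := by
    calc R - ρ ≤ ‖∫ θ in θa..θ1, F.derivative.eval (circleMap p s θ) *
          (circleMap 0 s θ * Complex.I)‖ := by rw [hint]; exact hdiff
      _ ≤ ∫ θ in θa..θ1, ‖F.derivative.eval (circleMap p s θ) *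
          (circleMap 0 s θ * Complex.I)‖ := intervalIntegral.norm_integral_le_integral_norm hlt.le
      _ ≤ _ := by
        refine intervalIntegral.integral_mono_on_of_le_Ioo hlt.le
          (hcont.norm.intervalIntegrable _ _)
          ((intervalIntegrable_const).add ((hgi _ _).const_mul _)) fun θ hθ => ?_
        rw [hnorm]
        have : g θ = ‖F.derivative.eval (circleMap p s θ)‖ ^ 2 :=
          indicator_of_mem (hin θ (Ioo_subset_Ico_self hθ)) _
        rw [this]
        set y := ‖F.derivative.eval (circleMap p s θ)‖
        have e : s * lam / 2 + s / (2 * lam) * y ^ 2 - s * y =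
            s / (2 * lam) * (y - lam) ^ 2 := by field_simp; ring
        have : 0 ≤ s / (2 * lam) * (y - lam) ^ 2 := by positivity
        linarith
  rw [intervalIntegral.integral_add intervalIntegrable_const ((hgi _ _).const_mul _),
    intervalIntegral.integral_const, intervalIntegral.integral_const_mul, smul_eq_mul] at h1
  have h2 : (θ1 - θa) * (s * lam / 2) ≤ (2 * Real.pi) * (s * lam / 2) := by
    have : θ1 - θa ≤ 2 * Real.pi := by linarith [hθ1.2, hθb.2]
    gcongr
  have h3 : s / (2 * lam) * ∫ θ in θa..θ1, g θ ≤ s / (2 * lam) * I := by gcongr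
  have h4 : (2 * Real.pi) * (s * lam / 2) = (R - ρ) / 2 := by rw [hlam]; field_simp
  have h5 : s / (2 * lam) = Real.pi * s ^ 2 / (R - ρ) := by rw [hlam]; field_simp
  have h6 : (R - ρ) / 2 ≤ Real.pi * s ^ 2 / (R - ρ) * I := by rw [← h5]; linarith
  rw [div_le_iff₀ (by positivity)]
  rw [div_mul_eq_mul_div, le_div_iff₀ hRρ] at h6
  nlinarith

lemma lintegral_energy_polar {F : ℂ[X]} {V : Set ℂ} (hV : IsOpen V) (p : ℂ) :
    ∫⁻ z in V, ENNReal.ofReal (‖F.derivative.eval z‖ ^ 2) =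
      ∫⁻ s in Ioi (0 : ℝ), ENNReal.ofReal s *
        ENNReal.ofReal (∫ θ in -Real.pi..Real.pi, energy F V (circleMap p s θ)) := by
  have hm := measurable_energy F hV
  have e1 : ∫⁻ z in V, ENNReal.ofReal (‖F.derivative.eval z‖ ^ 2) =
      ∫⁻ z, ENNReal.ofReal (energy F V (p + z)) := by
    rw [lintegral_add_left_eq_self (fun z => ENNReal.ofReal (energy F V z)) p,
      ← lintegral_indicator hV.measurableSet]
    congr 1; ext z
    by_cases h : z ∈ V <;> simp [energy, h]
  rw [e1, ← Complex.lintegral_comp_polarCoord_symm, polarCoord_target,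
    Measure.volume_eq_prod, setLIntegral_prod]
  swap
  · refine Measurable.aemeasurable ?_
    simp only [Complex.polarCoord_symm_apply, smul_eq_mul]
    exact (by fun_prop : Measurable fun q : ℝ × ℝ => ENNReal.ofReal q.1).mul
      (ENNReal.measurable_ofReal.comp (hm.comp (by fun_prop)))
  refine setLIntegral_congr_fun measurableSet_Ioi fun s hs => ?_
  simp only [smul_eq_mul]
  rw [lintegral_const_mul']
  swap
  · exact ENNReal.ofReal_ne_top
  congr 1
  have hc : ∀ θ, p + Complex.polarCoord.symm (s, θ) = circleMap p s θ := fun θ => by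
    rw [Complex.polarCoord_symm_apply, circleMap, Complex.exp_mul_I]; simp
  simp only [hc]
  rw [intervalIntegral.integral_of_le (by linarith [Real.pi_pos]),
    ofReal_integral_eq_lintegral_ofReal, setLIntegral_congr Ioo_ae_eq_Ioc]
  · exact (intervalIntegrable_iff_integrableOn_Ioc_of_le (by linarith [Real.pi_pos])).1
      (intervalIntegrable_energy F hV p s _ _)
  · exact ae_of_all _ fun _ => energy_nonneg _ _ _

lemma closedBall_subset_preComp {F : ℂ[X]} {w u p : ℂ} {R s : ℝ} (hs : 0 < s)
    (h : sphere p s ⊆ preComp F (ball w R) u) : closedBall p s ⊆ preComp F (ball w R) u := by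
  obtain ⟨z0, hz0⟩ := (NormedSpace.sphere_nonempty (x := p)).2 hs.le
  rw [preComp_eq (h hz0)]
  refine subset_preComp (convex_closedBall p s).isPreconnected (fun z hz => ?_)
    (sphere_subset_closedBall hz0)
  obtain ⟨z1, hz1, hmax⟩ := (isCompact_sphere p s).exists_isMaxOn ⟨z0, hz0⟩
    (f := fun z => ‖F.eval z - w‖) (by fun_prop)
  have h1 : ‖F.eval z1 - w‖ < R := by
    have := preComp_mapsTo F _ u (h hz1)
    rwa [mem_ball, dist_eq_norm] at this
  have h2 : ‖F.eval z - w‖ ≤ ‖F.eval z1 - w‖ := by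
    refine Complex.norm_le_of_forall_mem_frontier_norm_le (f := fun z => F.eval z - w)
      (U := ball p s) isBounded_ball ?_ ?_ ?_
    · exact ((F.differentiable).sub_const w).diffContOnCl
    · intro x hx
      rw [frontier_ball p hs.ne'] at hx
      exact hmax hx
    · rwa [closure_ball p hs.ne']
  rw [mem_ball, dist_eq_norm]
  exact h2.trans_lt h1

lemma log_le_of_not_subset {F : ℂ[X]} (hF : 0 < F.degree) {w u p q : ℂ} {R ρ a b : ℝ} {V : Set ℂ}
    {D : ℕ} (hρ0 : 0 ≤ ρ) (hρ : ρ < R)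
    (hD : ∀ y, {z | z ∈ preComp F (ball w R) u ∧ F.eval z = y}.ncard ≤ D)
    (hVc : IsPreconnected V) (hV : V ⊆ preComp F (ball w R) u)
    (hVρ : MapsTo F.eval V (closedBall w ρ)) (hp : p ∈ V) (hq : q ∈ V) (ha : 0 < a) (hab : a < b)
    (hpq : b ≤ dist q p) (hnot : ¬ ball p a ⊆ preComp F (ball w R) u) :
    (R - ρ) ^ 2 / (2 * Real.pi) * Real.log (b / a) ≤ D * (Real.pi * R ^ 2) := by
  set V' := preComp F (ball w R) u with hV'
  have hV'o : IsOpen V' := isOpen_preComp F isOpen_ball u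
  have hR : 0 < R := hρ0.trans_lt hρ
  have hup := lintegral_norm_sq_derivative_le hF hV'o measurableSet_ball (preComp_mapsTo F _ u) hD
  rw [lintegral_energy_polar hV'o p, Complex.volume_ball] at hup
  have hlow : ∫⁻ s in Ioc a b, ENNReal.ofReal ((R - ρ) ^ 2 / (2 * Real.pi) * (1 / s)) ≤
      ∫⁻ s in Ioi (0 : ℝ), ENNReal.ofReal s *
        ENNReal.ofReal (∫ θ in -Real.pi..Real.pi, energy F V' (circleMap p s θ)) := by
    rw [setLIntegral_congr Ioo_ae_eq_Ioc.symm]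
    refine le_trans (setLIntegral_mono' measurableSet_Ioo fun s hs => ?_)
      (lintegral_mono_set fun s hs => ha.trans hs.1)
    have hs0 : 0 < s := ha.trans hs.1
    rw [← ENNReal.ofReal_mul hs0.le]
    refine ENNReal.ofReal_le_ofReal ?_
    obtain ⟨z, hzV, hzs⟩ : ∃ z ∈ V, dist z p = s := by
      have := hVc.image (fun z => dist z p) (by fun_prop)
      have h2 := this.Icc_subset (mem_image_of_mem _ hp) (mem_image_of_mem _ hq)
      have : s ∈ Icc (dist p p) (dist q p) := by
        rw [dist_self]; exact ⟨hs0.le, hs.2.le.trans hpq⟩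
      exact h2 this
    obtain ⟨y, hyV, hys⟩ : ∃ y, y ∉ V' ∧ dist y p = s := by
      by_contra! hcon
      refine hnot ((ball_subset_closedBall.trans (closedBall_subset_closedBall hs.1.le)).trans
        (closedBall_subset_preComp hs0 fun y hy => ?_))
      by_contra hyn
      exact hcon y hyn hy
    have := le_integral_energy_circle hs0 hρ (hV hzV) hzs (hVρ hzV) hyV hys
    calc (R - ρ) ^ 2 / (2 * Real.pi) * (1 / s) = s * ((R - ρ) ^ 2 / (2 * Real.pi * s ^ 2)) := by
          field_simp
      _ ≤ _ := by gcongr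
  have hlogint : ∫⁻ s in Ioc a b, ENNReal.ofReal ((R - ρ) ^ 2 / (2 * Real.pi) * (1 / s)) =
      ENNReal.ofReal ((R - ρ) ^ 2 / (2 * Real.pi) * Real.log (b / a)) := by
    rw [← integral_one_div_of_pos ha (ha.trans hab), ← intervalIntegral.integral_const_mul,
      intervalIntegral.integral_of_le hab.le, ofReal_integral_eq_lintegral_ofReal]
    · rw [← IntegrableOn, ← intervalIntegrable_iff_integrableOn_Ioc_of_le hab.le]
      refine ContinuousOn.intervalIntegrable fun s hs => ContinuousAt.continuousWithinAt ?_
      rw [uIcc_of_le hab.le] at hs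
      have : s ≠ 0 := (ha.trans_le hs.1).ne'
      fun_prop (disch := assumption)
    · refine (ae_restrict_iff' measurableSet_Ioc).2 (ae_of_all _ fun s hs => ?_)
      have : 0 < s := ha.trans hs.1
      show (0 : ℝ) ≤ _
      positivity
  rw [hlogint] at hlow
  have hfin := hlow.trans hup
  have e : (D : ℝ≥0∞) * (ENNReal.ofReal R ^ 2 * (NNReal.pi : ℝ≥0∞)) =
      ENNReal.ofReal (D * (Real.pi * R ^ 2)) := by
    rw [ENNReal.ofReal_mul (by positivity), ENNReal.ofReal_mul Real.pi_pos.le,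
      ENNReal.ofReal_pow hR.le, ENNReal.ofReal_natCast, mul_comm (ENNReal.ofReal R ^ 2)]
    congr 2
    rw [← NNReal.coe_real_pi, ENNReal.ofReal_coe_nnreal]
  rw [e, ENNReal.ofReal_le_ofReal_iff (by positivity)] at hfin
  exact hfin

/-- Large connected subsets of a bounded-degree preimage of a disc are surrounded by a definite
neighbourhood inside the preimage of a larger disc. -/
lemma exists_ball_subset_preComp (D : ℕ) {η : ℝ} (hη : 0 < η) :
    ∃ κ > 0, κ < 1 ∧ ∀ (F : ℂ[X]) (w u p q : ℂ) (R b : ℝ) (V : Set ℂ), 0 < F.degree → 0 < R →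
      0 < b → (∀ y, {z | z ∈ preComp F (ball w R) u ∧ F.eval z = y}.ncard ≤ D) →
      IsPreconnected V → V ⊆ preComp F (ball w R) u →
      MapsTo F.eval V (closedBall w (R - η * R)) → p ∈ V → q ∈ V → b ≤ dist q p →
      ball p (κ * b) ⊆ preComp F (ball w R) u := by
  refine ⟨Real.exp (-(2 * Real.pi ^ 2 * D / η ^ 2 + 1)), Real.exp_pos _, ?_, ?_⟩
  · rw [Real.exp_lt_one_iff]; rw [neg_lt_zero]; positivity
  intro F w u p q R b V hF hR hb hD hVc hV hVρ hp hq hbq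
  by_contra hnot
  set κ := Real.exp (-(2 * Real.pi ^ 2 * D / η ^ 2 + 1)) with hκ
  have hκ1 : κ < 1 := by rw [Real.exp_lt_one_iff]; rw [neg_lt_zero]; positivity
  have hκ0 : 0 < κ := Real.exp_pos _
  have hρ0 : 0 ≤ R - η * R := by
    have := hVρ hp
    exact dist_nonneg.trans (mem_closedBall.1 this)
  have hηR : 0 < η * R := by positivity
  have := log_le_of_not_subset hF hρ0 (by linarith) hD hVc hV hVρ hp hq (by positivity)
    (by nlinarith : κ * b < b) hbq hnot
  have e : Real.log (b / (κ * b)) = 2 * Real.pi ^ 2 * D / η ^ 2 + 1 := by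
    rw [div_mul_cancel_right₀ hb.ne', Real.log_inv, hκ, Real.log_exp, neg_neg]
  rw [e, sub_sub_cancel] at this
  have e2 : (η * R) ^ 2 / (2 * Real.pi) * (2 * Real.pi ^ 2 * D / η ^ 2 + 1) =
      D * (Real.pi * R ^ 2) + (η * R) ^ 2 / (2 * Real.pi) := by field_simp
  have : 0 < (η * R) ^ 2 / (2 * Real.pi) := by positivity
  linarith

/-- The filled-in Julia set. -/
def filled (f : ℂ[X]) : Set ℂ := {z | Bornology.IsBounded (range fun n => (it f n).eval z)}

/-- The component of the filled-in Julia set through `y`. -/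
def kcomp (f : ℂ[X]) (y : ℂ) : Set ℂ := connectedComponentIn (filled f) y

/-- Outside the disc of radius `R` the polynomial doubles the modulus. -/
def EscapeRadius (f : ℂ[X]) (R : ℝ) : Prop := 0 < R ∧ ∀ z, R ≤ ‖z‖ → 2 * ‖z‖ ≤ ‖f.eval z‖

lemma exists_escapeRadius {f : ℂ[X]} (hf : 2 ≤ f.natDegree) : ∃ R, EscapeRadius f R := by
  have hd : 0 < f.divX.degree := by
    rw [← natDegree_pos_iff_degree_pos, natDegree_divX_eq_natDegree_tsub_one]; omega
  have h1 : Tendsto (fun z : ℂ => ‖f.divX.eval z‖) (cocompact ℂ) atTop :=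
    f.divX.tendsto_norm_atTop hd tendsto_norm_cocompact_atTop
  have h2 := h1.eventually_ge_atTop 3
  obtain ⟨r, hr⟩ := (Filter.hasBasis_cocompact.eventually_iff.1 h2)
  obtain ⟨M, hM⟩ := hr.1.isBounded.exists_norm_le
  refine ⟨max (M + 1) (‖f.coeff 0‖ + 1), lt_max_of_lt_right (by positivity), fun z hz => ?_⟩
  have hz1 : M < ‖z‖ := by linarith [le_max_left (M + 1) (‖f.coeff 0‖ + 1)]
  have hz2 : ‖f.coeff 0‖ ≤ ‖z‖ := by linarith [le_max_right (M + 1) (‖f.coeff 0‖ + 1)]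
  have h3 : 3 ≤ ‖f.divX.eval z‖ := hr.2 fun h => absurd (hM z h) (not_le.2 hz1)
  have e : f.eval z = f.divX.eval z * z + f.coeff 0 := by
    conv_lhs => rw [← f.divX_mul_X_add]
    simp
  have h4 : ‖f.divX.eval z * z‖ - ‖f.coeff 0‖ ≤ ‖f.eval z‖ := by
    rw [e]
    have := norm_sub_norm_le (f.divX.eval z * z) (-f.coeff 0)
    rwa [norm_neg, sub_neg_eq_add] at this
  rw [norm_mul] at h4
  nlinarith [norm_nonneg z]

section

variable {f : ℂ[X]} {R : ℝ}

lemma EscapeRadius.two_pow_le (h : EscapeRadius f R) {z : ℂ} (hz : R ≤ ‖z‖) (n : ℕ) :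
    2 ^ n * R ≤ ‖(it f n).eval z‖ := by
  induction n with
  | zero => simpa using hz
  | succ n ih =>
    rw [eval_it_succ']
    have h1 : R ≤ ‖(it f n).eval z‖ :=
      le_trans (by nlinarith [one_le_pow₀ (one_le_two (α := ℝ)) (n := n), h.1]) ih
    have := h.2 _ h1
    rw [pow_succ]; linarith

lemma EscapeRadius.tendsto (h : EscapeRadius f R) {z : ℂ} {n : ℕ} (hz : R ≤ ‖(it f n).eval z‖) :
    Tendsto (fun n => ‖(it f n).eval z‖) atTop atTop := by
  rw [← tendsto_add_atTop_iff_nat n]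
  refine tendsto_atTop_mono (fun k => ?_)
    ((tendsto_pow_atTop_atTop_of_one_lt (one_lt_two (α := ℝ))).atTop_mul_const h.1)
  rw [eval_it_add]
  exact h.two_pow_le hz k

lemma EscapeRadius.mem_filled_iff (h : EscapeRadius f R) {z : ℂ} :
    z ∈ filled f ↔ ∀ n, ‖(it f n).eval z‖ < R := by
  constructor
  · intro hz n
    by_contra hn
    have ht := h.tendsto (not_lt.1 hn)
    obtain ⟨M, hM⟩ :=
      (show Bornology.IsBounded (range fun n => (it f n).eval z) from hz).exists_norm_le
    obtain ⟨k, hk⟩ := (ht.eventually_gt_atTop M).exists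
    exact absurd (hM _ (mem_range_self k)) (not_le.2 hk)
  · intro hz
    show Bornology.IsBounded (range fun n => (it f n).eval z)
    refine isBounded_iff_forall_norm_le.2 ⟨R, ?_⟩
    rintro _ ⟨n, rfl⟩
    exact (hz n).le

lemma EscapeRadius.norm_lt (h : EscapeRadius f R) {z : ℂ} (hz : ‖f.eval z‖ ≤ R) : ‖z‖ < R := by
  by_contra hn
  have := h.2 z (not_lt.1 hn)
  linarith [h.1, not_lt.1 hn]

/-- The puzzle piece of depth `m` around `y`. -/
def piece (f : ℂ[X]) (R : ℝ) (m : ℕ) (y : ℂ) : Set ℂ := pull f m (ball 0 R) y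

lemma EscapeRadius.norm_it_lt (h : EscapeRadius f R) {m n : ℕ} (hmn : m < n) {z : ℂ}
    (hz : ‖(it f n).eval z‖ ≤ R) : ‖(it f m).eval z‖ < R := by
  obtain ⟨k, rfl⟩ := Nat.exists_eq_add_of_lt hmn
  induction k with
  | zero =>
    rw [eval_it_succ'] at hz
    exact h.norm_lt hz
  | succ k ih =>
    refine ih (by omega) ?_
    rw [show m + (k + 1) + 1 = (m + k + 1) + 1 by ring, eval_it_succ'] at hz
    exact (h.norm_lt hz).le

lemma mem_piece_iff_self {m : ℕ} {y : ℂ} : y ∈ piece f R m y ↔ ‖(it f m).eval y‖ < R := by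
  constructor
  · intro h
    simpa using preComp_mapsTo _ _ _ h
  · intro h
    exact mem_preComp (by simpa using h)

lemma EscapeRadius.closure_piece_subset (h : EscapeRadius f R) {m n : ℕ} (hmn : m < n) {y : ℂ}
    (hy : ‖(it f n).eval y‖ < R) : closure (piece f R n y) ⊆ piece f R m y := by
  refine subset_preComp (isPreconnected_preComp _ _ _).closure (fun z hz => ?_)
    (subset_closure (mem_piece_iff_self.2 hy))
  have : closure (piece f R n y) ⊆ {z | ‖(it f n).eval z‖ ≤ R} := by
    refine closure_minimal (fun z hz => ?_) (isClosed_le (by fun_prop) continuous_const)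
    have : (it f n).eval z ∈ ball 0 R := preComp_mapsTo _ _ _ hz
    exact (mem_ball_zero_iff.1 this).le
  simpa using h.norm_it_lt hmn (this hz)

lemma EscapeRadius.piece_anti (h : EscapeRadius f R) {m n : ℕ} (hmn : m ≤ n) {y : ℂ}
    (hy : ‖(it f n).eval y‖ < R) : piece f R n y ⊆ piece f R m y := by
  rcases hmn.eq_or_lt with rfl | hlt
  · exact Subset.rfl
  · exact subset_closure.trans (h.closure_piece_subset hlt hy)

lemma EscapeRadius.isCompact_closure_piece (h : EscapeRadius f R) (m : ℕ) {y : ℂ}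
    (hy : ‖(it f m).eval y‖ < R) : IsCompact (closure (piece f R m y)) := by
  refine (isBounded_ball (x := (0 : ℂ)) (r := R)).isCompact_closure.of_isClosed_subset
    isClosed_closure (closure_mono ?_)
  refine (h.piece_anti (Nat.zero_le m) hy).trans fun z hz => ?_
  have : (it f 0).eval z ∈ ball 0 R := preComp_mapsTo _ _ _ hz
  simpa using this

lemma isOpen_piece (m : ℕ) (y : ℂ) : IsOpen (piece f R m y) := isOpen_preComp _ isOpen_ball _

lemma isPreconnected_piece (m : ℕ) (y : ℂ) : IsPreconnected (piece f R m y) :=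
  isPreconnected_preComp _ _ _

lemma piece_eq {m : ℕ} {y v : ℂ} (h : v ∈ piece f R m y) : piece f R m y = piece f R m v :=
  preComp_eq h

lemma norm_it_lt_of_mem_piece {m : ℕ} {y v : ℂ} (h : v ∈ piece f R m y) :
    ‖(it f m).eval v‖ < R := by
  simpa using preComp_mapsTo _ _ _ h

lemma image_piece (hf : 0 < f.degree) (m n : ℕ) {y : ℂ} (hy : ‖(it f (m + n)).eval y‖ < R) :
    (it f n).eval '' piece f R (m + n) y = piece f R m ((it f n).eval y) :=
  image_pull_add hf m n isOpen_ball (by simpa using hy)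

lemma piece_add (m n : ℕ) {y : ℂ} (hy : ‖(it f (m + n)).eval y‖ < R) :
    piece f R (m + n) y = pull f n (piece f R m ((it f n).eval y)) y :=
  pull_add m n (by simpa using hy)

lemma isLemn_piece (hR : 0 < R) (hf : 0 < f.degree) (m : ℕ) {y : ℂ}
    (hy : ‖(it f m).eval y‖ < R) : IsLemn (piece f R m y) :=
  (isLemn_ball 0 hR).preComp (degree_it_pos hf m) (by simpa using hy)

end

/-- A decreasing intersection of compact connected sets is connected. -/
lemma isPreconnected_iInter_of_antitone {X : ℕ → Set ℂ} (hX : Antitone X)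
    (hc : ∀ n, IsCompact (X n)) (hp : ∀ n, IsPreconnected (X n)) : IsPreconnected (⋂ n, X n) := by
  rw [isPreconnected_iff_subset_of_fully_disjoint_closed (isClosed_iInter fun n => (hc n).isClosed)]
  intro a b ha hb hab hdisj
  have hcomp : IsCompact (⋂ n, X n) := (hc 0).of_isClosed_subset
    (isClosed_iInter fun n => (hc n).isClosed) (iInter_subset _ 0)
  obtain ⟨u, v, hu, hv, hau, hbv, huv⟩ := SeparatedNhds.of_isCompact_isCompact
    (hcomp.inter_right ha) (hcomp.inter_right hb)
    (hdisj.mono inter_subset_right inter_subset_right)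
  obtain ⟨n, hn⟩ := exists_subset_nhds_of_isCompact (V := X) (U := u ∪ v)
    (hX.directed_ge) hc fun x hx => (hu.union hv).mem_nhds <| by
      rcases hab hx with h | h
      · exact Or.inl (hau ⟨hx, h⟩)
      · exact Or.inr (hbv ⟨hx, h⟩)
  rcases (hp n).subset_or_subset hu hv huv hn with h | h
  · left
    intro x hx
    refine (hab hx).resolve_right fun hxb => ?_
    exact disjoint_left.1 huv (h (mem_iInter.1 hx n)) (hbv ⟨hx, hxb⟩)
  · right
    intro x hx
    refine (hab hx).resolve_left fun hxa => ?_
    exact disjoint_left.1 huv (hau ⟨hx, hxa⟩) (h (mem_iInter.1 hx n))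

section

variable {f : ℂ[X]} {R : ℝ}

lemma EscapeRadius.filled_eq (h : EscapeRadius f R) :
    filled f = ⋂ n, {z | ‖(it f n).eval z‖ ≤ R} := by
  ext z
  rw [h.mem_filled_iff, mem_iInter]
  exact ⟨fun hz n => (hz n).le, fun hz n => h.norm_it_lt n.lt_succ_self (hz (n + 1))⟩

lemma EscapeRadius.isCompact_filled (h : EscapeRadius f R) : IsCompact (filled f) := by
  refine (isCompact_closedBall (0 : ℂ) R).of_isClosed_subset ?_ fun z hz => ?_
  · rw [h.filled_eq]
    exact isClosed_iInter fun n => isClosed_le (by fun_prop) continuous_const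
  · have := h.mem_filled_iff.1 hz 0
    simpa using this.le

lemma EscapeRadius.mem_filled_it (h : EscapeRadius f R) (n : ℕ) {z : ℂ} :
    (it f n).eval z ∈ filled f ↔ z ∈ filled f := by
  rw [h.mem_filled_iff, h.mem_filled_iff]
  simp only [← eval_it_add]
  refine ⟨fun hz k => ?_, fun hz k => hz _⟩
  rcases Nat.eq_zero_or_pos n with rfl | hn
  · exact hz k
  · exact h.norm_it_lt (by omega) (hz k).le

lemma kcomp_subset (f : ℂ[X]) (y : ℂ) : kcomp f y ⊆ filled f := connectedComponentIn_subset _ _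

lemma mem_kcomp {y : ℂ} (hy : y ∈ filled f) : y ∈ kcomp f y := mem_connectedComponentIn hy

lemma isPreconnected_kcomp (f : ℂ[X]) (y : ℂ) : IsPreconnected (kcomp f y) :=
  isPreconnected_connectedComponentIn

lemma kcomp_eq {y v : ℂ} (h : v ∈ kcomp f y) : kcomp f y = kcomp f v := connectedComponentIn_eq h

lemma subset_kcomp {s : Set ℂ} {y : ℂ} (hs : IsPreconnected s) (hsK : s ⊆ filled f) (hy : y ∈ s) :
    s ⊆ kcomp f y := hs.subset_connectedComponentIn hy hsK

lemma EscapeRadius.isCompact_kcomp (h : EscapeRadius f R) (y : ℂ) : IsCompact (kcomp f y) := by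
  by_cases hy : y ∈ filled f
  · refine h.isCompact_filled.of_isClosed_subset ?_ (kcomp_subset f y)
    refine isClosed_of_closure_subset ?_
    exact subset_kcomp (isPreconnected_kcomp f y).closure
      (closure_minimal (kcomp_subset f y) h.isCompact_filled.isClosed)
      (subset_closure (mem_kcomp hy))
  · rw [kcomp, connectedComponentIn_eq_empty hy]; exact isCompact_empty

lemma EscapeRadius.kcomp_subset_piece (h : EscapeRadius f R) {y : ℂ} (hy : y ∈ filled f) (m : ℕ) :
    kcomp f y ⊆ piece f R m y :=
  subset_preComp (isPreconnected_kcomp f y)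
    (fun z hz => by simpa using h.mem_filled_iff.1 (kcomp_subset f y hz) m) (mem_kcomp hy)

lemma EscapeRadius.antitone_closure_piece (h : EscapeRadius f R) {y : ℂ} (hy : y ∈ filled f) :
    Antitone fun m => closure (piece f R m y) := fun _ n hmn =>
  closure_mono (h.piece_anti hmn (h.mem_filled_iff.1 hy n))

lemma EscapeRadius.kcomp_eq_iInter_closure (h : EscapeRadius f R) {y : ℂ} (hy : y ∈ filled f) :
    kcomp f y = ⋂ m, closure (piece f R m y) := by
  refine Subset.antisymm
    (subset_iInter fun _ => (h.kcomp_subset_piece hy _).trans subset_closure) ?_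
  refine subset_kcomp (isPreconnected_iInter_of_antitone (h.antitone_closure_piece hy)
    (fun n => h.isCompact_closure_piece n (h.mem_filled_iff.1 hy n))
    fun n => (isPreconnected_piece n y).closure) (fun z hz => ?_)
    (mem_iInter.2 fun m => subset_closure (mem_piece_iff_self.2 (h.mem_filled_iff.1 hy m)))
  refine h.mem_filled_iff.2 fun m => ?_
  exact norm_it_lt_of_mem_piece (h.closure_piece_subset m.lt_succ_self
    (h.mem_filled_iff.1 hy (m + 1)) (mem_iInter.1 hz (m + 1)))

lemma EscapeRadius.mem_kcomp_iff (h : EscapeRadius f R) {y z : ℂ} (hy : y ∈ filled f) :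
    z ∈ kcomp f y ↔ ∀ m, z ∈ piece f R m y := by
  refine ⟨fun hz m => h.kcomp_subset_piece hy m hz, fun hz => ?_⟩
  rw [h.kcomp_eq_iInter_closure hy]
  exact mem_iInter.2 fun m => subset_closure (hz m)

lemma EscapeRadius.exists_piece_subset (h : EscapeRadius f R) {y : ℂ} (hy : y ∈ filled f)
    {O : Set ℂ} (hO : IsOpen O) (hyO : kcomp f y ⊆ O) : ∃ m, ∀ n ≥ m, piece f R n y ⊆ O := by
  obtain ⟨m, hm⟩ := exists_subset_nhds_of_isCompact (V := fun m => closure (piece f R m y)) (U := O)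
    (h.antitone_closure_piece hy).directed_ge
    (fun n => h.isCompact_closure_piece n (h.mem_filled_iff.1 hy n))
    (fun x hx => hO.mem_nhds (hyO (by rwa [h.kcomp_eq_iInter_closure hy])))
  exact ⟨m, fun n hn => subset_closure.trans ((h.antitone_closure_piece hy hn).trans hm)⟩

lemma EscapeRadius.image_kcomp (h : EscapeRadius f R) (hf : 0 < f.degree) (n : ℕ) {y : ℂ}
    (hy : y ∈ filled f) : (it f n).eval '' kcomp f y = kcomp f ((it f n).eval y) := by
  have hy' := (h.mem_filled_it n).2 hy
  refine Subset.antisymm ?_ fun w hw => ?_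
  · refine subset_kcomp ((isPreconnected_kcomp f y).image _ (it f n).continuous.continuousOn) ?_
      (mem_image_of_mem _ (mem_kcomp hy))
    rintro _ ⟨z, hz, rfl⟩
    exact (h.mem_filled_it n).2 (kcomp_subset f y hz)
  · by_contra hcon
    have key : ∀ v ∈ {v | (it f n).eval v = w}, ∃ m, v ∉ piece f R m y := fun v hv => by
      by_contra! hall
      exact hcon ⟨v, (h.mem_kcomp_iff hy).2 hall, hv⟩
    choose! m hm using key
    obtain ⟨M, hM⟩ := ((finite_fiber (degree_it_pos hf n) w).image m).bddAbove
    have hwM := (h.mem_kcomp_iff hy').1 hw M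
    have hb := h.mem_filled_iff.1 hy
    rw [← image_piece hf M n (hb _)] at hwM
    obtain ⟨v, hv, hvw⟩ := hwM
    refine hm v hvw (h.piece_anti ?_ (hb _) hv)
    exact (hM (mem_image_of_mem m hvw)).trans (Nat.le_add_right _ _)

lemma mem_frontier_of_eval_mem (h : EscapeRadius f R) (hf : 0 < f.degree) (n : ℕ) {v : ℂ}
    (hv : (it f n).eval v ∈ frontier (filled f)) : v ∈ frontier (filled f) := by
  have hcl := h.isCompact_filled.isClosed
  rw [hcl.frontier_eq] at hv ⊢
  refine ⟨(h.mem_filled_it n).1 hv.1, fun hint => hv.2 ?_⟩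
  have ho := isOpenMap_eval (degree_it_pos hf n) _ (isOpen_interior (s := filled f))
  refine interior_maximal ?_ ho (mem_image_of_mem _ hint)
  rintro _ ⟨z, hz, rfl⟩
  exact (h.mem_filled_it n).2 (interior_subset hz)

lemma eval_mem_frontier (h : EscapeRadius f R) (n : ℕ) {v : ℂ}
    (hv : v ∈ frontier (filled f)) : (it f n).eval v ∈ frontier (filled f) := by
  have hcl := h.isCompact_filled.isClosed
  rw [hcl.frontier_eq] at hv ⊢
  refine ⟨(h.mem_filled_it n).2 hv.1, fun hint => hv.2 ?_⟩
  refine mem_interior.2 ⟨_, fun z hz => ?_, isOpen_interior.preimage (it f n).continuous, hint⟩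
  exact (h.mem_filled_it n).1 (interior_subset hz)

lemma subset_filled_of_disjoint_frontier (h : EscapeRadius f R) {s : Set ℂ}
    (hs : IsPreconnected s) (hd : Disjoint s (frontier (filled f))) {x : ℂ} (hx : x ∈ s)
    (hxK : x ∈ filled f) : s ⊆ filled f := by
  have hcl := h.isCompact_filled.isClosed
  rw [hcl.frontier_eq] at hd
  have hint : ∀ z ∈ s, z ∈ filled f → z ∈ interior (filled f) := fun z hz hzK => by
    by_contra hn
    exact disjoint_left.1 hd hz ⟨hzK, hn⟩
  refine (hs.subset_left_of_subset_union isOpen_interior hcl.isOpen_compl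
    (disjoint_compl_right.mono_left interior_subset) (fun z hz => ?_)
    ⟨x, hx, hint x hx hxK⟩).trans interior_subset
  by_cases hzK : z ∈ filled f
  · exact Or.inl (hint z hz hzK)
  · exact Or.inr hzK

end

section

variable {f : ℂ[X]} {R₀ : ℝ}

lemma isCompact_frontier_filled (h : EscapeRadius f R₀) : IsCompact (frontier (filled f)) :=
  h.isCompact_filled.of_isClosed_subset isClosed_frontier
      h.isCompact_filled.isClosed.frontier_subset

lemma exists_finite_pairs (h : EscapeRadius f R₀) {σ : ℝ} (hσ : 0 < σ) :
    ∃ T : Set (ℂ × ℂ), T.Finite ∧ (∀ t ∈ T, t.1 ∉ filled f ∧ t.2 ∈ filled f) ∧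
      ∀ v ∈ frontier (filled f), ∃ t ∈ T, t.1 ∈ ball v σ ∧ t.2 ∈ ball v σ := by
  obtain ⟨t, htJ, htf, hcov⟩ := (isCompact_frontier_filled h).finite_cover_balls (half_pos hσ)
  have hex : ∀ v ∈ frontier (filled f), ∃ a ∉ filled f, dist a v < σ / 2 := fun v hv => by
    rw [frontier_eq_closure_inter_closure] at hv
    obtain ⟨a, ha, hav⟩ := Metric.mem_closure_iff.1 hv.2 _ (half_pos hσ)
    exact ⟨a, ha, by rwa [dist_comm]⟩
  choose! a haK ha using hex
  refine ⟨(fun v => (a v, v)) '' t, htf.image _, ?_, fun v hv => ?_⟩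
  · rintro _ ⟨v, hv, rfl⟩
    exact ⟨haK v (htJ hv), h.isCompact_filled.isClosed.frontier_subset (htJ hv)⟩
  · obtain ⟨w, hw, hvw⟩ := mem_iUnion₂.1 (hcov hv)
    rw [mem_ball, dist_comm] at hvw
    refine ⟨_, mem_image_of_mem _ hw, ?_, ?_⟩
    · have := ha w (htJ hw)
      have := dist_triangle (a w) w v
      rw [mem_ball]; linarith
    · rw [mem_ball]; linarith

lemma tendsto_dist_atTop (h : EscapeRadius f R₀) {a b : ℂ} (ha : a ∉ filled f)
    (hb : b ∈ filled f) :
    Tendsto (fun k => dist ((it f k).eval a) ((it f k).eval b)) atTop atTop := by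
  rw [h.mem_filled_iff] at ha hb
  push Not at ha
  obtain ⟨n, hn⟩ := ha
  refine tendsto_atTop_mono (fun k => ?_) (tendsto_atTop_add_const_right _ (-R₀) (h.tendsto hn))
  rw [dist_eq_norm]
  have := norm_sub_norm_le ((it f k).eval a) ((it f k).eval b)
  linarith [hb k]

/-- Iterates expand small discs centred on the Julia set to a large size, uniformly. -/
lemma exists_forall_le_dist_of_le (h : EscapeRadius f R₀) {σ : ℝ} (hσ : 0 < σ) (M : ℝ) :
    ∃ k₀, ∀ k ≥ k₀, ∀ v ∈ frontier (filled f), ∃ a ∈ ball v σ, ∃ b ∈ ball v σ,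
      M ≤ dist ((it f k).eval a) ((it f k).eval b) := by
  obtain ⟨T, hT, hTK, hTJ⟩ := exists_finite_pairs h hσ
  have : ∀ᶠ k in atTop, ∀ t ∈ T, M ≤ dist ((it f k).eval t.1) ((it f k).eval t.2) := by
    rw [Filter.eventually_all_finite hT]
    exact fun t ht => (tendsto_dist_atTop h (hTK t ht).1 (hTK t ht).2).eventually_ge_atTop M
  obtain ⟨k₀, hk₀⟩ := eventually_atTop.1 this
  refine ⟨k₀, fun k hk v hv => ?_⟩
  obtain ⟨t, ht, h1, h2⟩ := hTJ v hv
  exact ⟨_, h1, _, h2, hk₀ k hk t ht⟩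

/-- Iterates do not contract small discs centred on the Julia set. -/
lemma exists_pos_forall_le_dist (h : EscapeRadius f R₀) {σ : ℝ} (hσ : 0 < σ) :
    ∃ ρ > 0, ∀ k, ∀ v ∈ frontier (filled f), ∃ a ∈ ball v σ, ∃ b ∈ ball v σ,
      ρ ≤ dist ((it f k).eval a) ((it f k).eval b) := by
  obtain ⟨T, hT, hTK, hTJ⟩ := exists_finite_pairs h hσ
  have key : ∀ t ∈ T, ∃ ρ > 0, ∀ k, ρ ≤ dist ((it f k).eval t.1) ((it f k).eval t.2) := by
    intro t ht
    have hne : ∀ k, 0 < dist ((it f k).eval t.1) ((it f k).eval t.2) := fun k => by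
      rw [dist_pos]
      intro heq
      have h1 := (h.mem_filled_it k).2 (hTK t ht).2
      rw [← heq] at h1
      exact (hTK t ht).1 ((h.mem_filled_it k).1 h1)
    obtain ⟨k, hk⟩ := (continuous_of_discreteTopology (f := fun k : ℕ =>
      dist ((it f k).eval t.1) ((it f k).eval t.2))).exists_forall_le (by
        rw [cocompact_eq_atTop (α := ℕ)]
        exact tendsto_dist_atTop h (hTK t ht).1 (hTK t ht).2)
    exact ⟨_, hne k, hk⟩
  choose! ρ hρ0 hρ using key
  obtain ⟨r, hr, hrT⟩ : ∃ r > 0, ∀ t ∈ T, r ≤ ρ t := by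
    rcases T.eq_empty_or_nonempty with rfl | hne
    · exact ⟨1, one_pos, by simp⟩
    obtain ⟨t, ht, hmin⟩ := hT.exists_minimalFor ρ T hne
    refine ⟨ρ t, hρ0 t ht, fun s hs => ?_⟩
    rcases le_total (ρ t) (ρ s) with hle | hle
    · exact hle
    · exact hmin hs hle
  refine ⟨r, hr, fun k v hv => ?_⟩
  obtain ⟨t, ht, h1, h2⟩ := hTJ v hv
  exact ⟨_, h1, _, h2, (hrT t ht).trans (hρ t ht k)⟩

end

/-- A connected set covered by few small sets is small. -/
lemma dist_le_card_mul {ι : Type*} {V : Set ℂ} (hV : IsPreconnected V) (s : Finset ι)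
    (E : ι → Set ℂ)
    (hcov : V ⊆ ⋃ i ∈ s, E i) {σ : ℝ} (hσ : 0 ≤ σ)
    (hE : ∀ i ∈ s, ∀ a ∈ E i, ∀ b ∈ E i, dist a b ≤ σ) {a b : ℂ} (ha : a ∈ V) (hb : b ∈ V) :
    dist a b ≤ s.card * σ := by
  have hI := hV.image (fun z => dist a z) (by fun_prop)
  have h1 := hI.Icc_subset (mem_image_of_mem _ ha) (mem_image_of_mem _ hb)
  simp only [dist_self] at h1
  have h2 : Icc 0 (dist a b) ⊆ ⋃ i ∈ s, (fun z => dist a z) '' E i := by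
    refine h1.trans ?_
    rintro _ ⟨z, hz, rfl⟩
    obtain ⟨i, hi, hzi⟩ := mem_iUnion₂.1 (hcov hz)
    exact mem_iUnion₂.2 ⟨i, hi, mem_image_of_mem _ hzi⟩
  have h3 : ENNReal.ofReal (dist a b) ≤ ENNReal.ofReal (s.card * σ) := by
    calc ENNReal.ofReal (dist a b) = volume (Icc 0 (dist a b)) := by rw [Real.volume_Icc, sub_zero]
      _ ≤ volume (⋃ i ∈ s, (fun z => dist a z) '' E i) := measure_mono h2
      _ ≤ ∑ i ∈ s, volume ((fun z => dist a z) '' E i) := measure_biUnion_finset_le _ _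
      _ ≤ ∑ i ∈ s, ENNReal.ofReal σ := by
        refine Finset.sum_le_sum fun i hi => (Real.volume_le_diam _).trans ?_
        refine Metric.ediam_le ?_
        rintro _ ⟨x, hx, rfl⟩ _ ⟨y, hy, rfl⟩
        rw [edist_dist]
        refine ENNReal.ofReal_le_ofReal
            ((abs_dist_sub_le x y a |>.trans_eq' ?_).trans (hE i hi x hx y hy))
        rw [Real.dist_eq]
        simp only [dist_comm]
      _ = ENNReal.ofReal (s.card * σ) := by
        rw [Finset.sum_const, nsmul_eq_mul, ENNReal.ofReal_mul (by positivity),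
          ENNReal.ofReal_natCast]
  exact (ENNReal.ofReal_le_ofReal_iff (by positivity)).1 h3

/-- Large preimages of a disc `B(y, R / 16)` force a preimage of a disc centred at a nearby point
`w` to contain a definite disc, whose image stays close to `w`. -/
lemma exists_mapsTo_of_le_dist_fatou (D : ℕ) {M b : ℝ} (hM : 0 < M) (hb : 0 < b) :
    ∃ s > 0, ∀ (F : ℂ[X]) (y w u a a' : ℂ) (R : ℝ), 0 < F.degree → 0 < R → R / 4 ≤ dist y w →
      dist y w ≤ M * R →
      (∀ x, {z | z ∈ preComp F (ball y (dist y w)) u ∧ F.eval z = x}.ncard ≤ D) →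
      F.eval u ∈ ball y (R / 16) → a ∈ preComp F (ball y (R / 16)) u →
      a' ∈ preComp F (ball y (R / 16)) u → b ≤ dist a a' →
      ∃ p, MapsTo F.eval (ball p s) (ball w (R / 4)) := by
  obtain ⟨κ, hκ0, hκ1, hκ⟩ := exists_ball_subset_preComp D (η := 1 / (16 * M)) (by positivity)
  refine ⟨κ * (b / 2) / (16 * M), by positivity, ?_⟩
  intro F y w u a a' R hF hR hRw hwM hD hu ha ha' hbd
  set ρ := dist y w with hρ
  have hρ0 : 0 < ρ := by linarith
  set Ω := ball y (ρ - R / 16) with hΩ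
  have hsub : ball y (R / 16) ⊆ Ω := ball_subset_ball (by linarith)
  have huΩ : F.eval u ∈ Ω := hsub hu
  obtain ⟨y', hy'y, hy'w⟩ : ∃ y', dist y' y = ρ - R / 8 ∧ dist y' w = R / 8 := by
    have hc : 0 ≤ R / 8 / ρ ∧ R / 8 / ρ ≤ 1 :=
      ⟨by positivity, by rw [div_le_one hρ0]; linarith⟩
    refine ⟨AffineMap.lineMap w y (R / 8 / ρ), ?_, ?_⟩
    · rw [dist_lineMap_right, Real.norm_of_nonneg (by linarith [hc.2]), dist_comm w y, ← hρ]
      field_simp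
    · rw [dist_lineMap_left, Real.norm_of_nonneg hc.1, dist_comm w y, ← hρ]
      field_simp
  have hy'Ω : y' ∈ Ω := by
    change dist y' y < ρ - R / 16
    rw [hy'y]; linarith
  have himg : F.eval '' preComp F Ω u = Ω :=
    image_preComp hF isOpen_ball (convex_ball _ _).isPreconnected huΩ
  rw [← himg] at hy'Ω
  obtain ⟨p, hp, rfl⟩ := hy'Ω
  have hVV : preComp F Ω u ⊆ preComp F (ball y ρ) u :=
    preComp_mono F (ball_subset_ball (by linarith)) u
  have hle : ρ - R / 16 ≤ ρ - 1 / (16 * M) * ρ := by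
    have : 1 / (16 * M) * ρ ≤ R / 16 := by
      rw [div_mul_eq_mul_div, one_mul, div_le_iff₀ (by positivity)]
      nlinarith
    linarith
  obtain ⟨q, hq, hqp⟩ : ∃ q ∈ preComp F Ω u, b / 2 ≤ dist q p := by
    by_contra! hcon
    have h1 := hcon a (preComp_mono F hsub u ha)
    have h2 := hcon a' (preComp_mono F hsub u ha')
    have := dist_triangle_right a a' p
    linarith
  have hball := hκ F y u p q ρ (b / 2) (preComp F Ω u) hF hρ0 (by positivity) hD
    (isPreconnected_preComp _ _ _) hVV
    (fun z hz => (ball_subset_closedBall.trans (closedBall_subset_closedBall hle))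
      (preComp_mapsTo F _ u hz)) hp hq hqp
  refine ⟨p, fun z hz => ?_⟩
  have hz' : z ∈ ball p (κ * (b / 2)) := by
    refine ball_subset_ball ?_ hz
    refine div_le_self (by positivity) ?_
    nlinarith
  have hmaps : MapsTo F.eval (ball p (κ * (b / 2))) (closedBall (F.eval p) (2 * ρ)) := by
    intro x hx
    have h1 : dist (F.eval x) y < ρ := preComp_mapsTo F _ u (hball hx)
    have := dist_triangle_right (F.eval x) (F.eval p) y
    rw [mem_closedBall]; linarith
  have hS := Complex.dist_le_div_mul_dist_of_mapsTo_ball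
    (F.differentiable.differentiableOn) hmaps hz'
  have hlt : dist (F.eval z) (F.eval p) < R / 8 := by
    refine hS.trans_lt ?_
    rw [mem_ball] at hz
    calc 2 * ρ / (κ * (b / 2)) * dist z p < 2 * ρ / (κ * (b / 2)) * (κ * (b / 2) / (16 * M)) := by
          gcongr
      _ = ρ / (8 * M) := by field_simp; norm_num
      _ ≤ R / 8 := by rw [div_le_div_iff₀ (by positivity) (by norm_num)]; nlinarith
  have := dist_triangle (F.eval z) (F.eval p) w
  rw [mem_ball]; linarith

lemma exists_mapsTo_of_le_dist (D : ℕ) {M b : ℝ} (hM : 0 < M) (hb : 0 < b) :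
    ∃ σ > 0, ∀ (f : ℂ[X]) (R₀ : ℝ) (n : ℕ) (y w : ℂ) (R R' : ℝ), EscapeRadius f R₀ →
      0 < f.degree → w ∈ frontier (filled f) → 0 < R → dist y w ≤ M * R → 5 / 8 * R ≤ R' →
      (R / 4 ≤ dist y w → ∀ u, (it f n).eval u ∈ ball y (dist y w) →
        ∀ x, {z | z ∈ pull f n (ball y (dist y w)) u ∧ (it f n).eval z = x}.ncard ≤ D) →
      (∀ u, (it f n).eval u ∈ ball w R' →
        ∀ x, {z | z ∈ pull f n (ball w R') u ∧ (it f n).eval z = x}.ncard ≤ D) →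
      ∀ u a a', (it f n).eval u ∈ ball y (R / 16) → a ∈ pull f n (ball y (R / 16)) u →
        a' ∈ pull f n (ball y (R / 16)) u → b ≤ dist a a' →
        ∃ v ∈ frontier (filled f), MapsTo (it f n).eval (ball v σ) (ball w R') := by
  obtain ⟨s, hs, hfat⟩ := exists_mapsTo_of_le_dist_fatou D hM hb
  obtain ⟨κ, hκ0, hκ1, hκ⟩ := exists_ball_subset_preComp D (η := 1 / 2) (by norm_num)
  set b' := min b (s / 2) with hb'
  have hb'0 : 0 < b' := lt_min hb (half_pos hs)
  refine ⟨κ * (b' / 2), by positivity, ?_⟩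
  intro f R₀ n y w R R' h hf hw hR hyM hRR' hDf hDJ u a a' hu ha ha' hbd
  have hFn := degree_it_pos hf n
  have hR' : 0 < R' := by linarith
  -- reduce to two distant points in the preimage of `ball w (R' / 2)`
  obtain ⟨c, c', hc, hcc, hdc⟩ : ∃ c c', (it f n).eval c ∈ ball w (R' / 2) ∧
      c' ∈ preComp (it f n) (ball w (R' / 2)) c ∧ b' ≤ dist c c' := by
    rcases lt_or_ge (dist y w) (R / 4) with hlt | hge
    · have hsub : ball y (R / 16) ⊆ ball w (R' / 2) := ball_subset_ball' (by linarith)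
      have ha2 := preComp_mono (it f n) hsub u ha
      refine ⟨a, a', preComp_mapsTo _ _ _ ha2, ?_, (min_le_left _ _).trans hbd⟩
      rw [← preComp_eq ha2]
      exact preComp_mono (it f n) hsub u ha'
    · have hu' : (it f n).eval u ∈ ball y (dist y w) := ball_subset_ball (by linarith) hu
      obtain ⟨p, hp⟩ := hfat (it f n) y w u a a' R hFn hR hge hyM (hDf hge u hu') hu ha ha' hbd
      have hp' : MapsTo (it f n).eval (ball p s) (ball w (R' / 2)) :=
        hp.mono_right (ball_subset_ball (by linarith))
      refine ⟨p, p + (s / 2 : ℝ), hp' (mem_ball_self hs), ?_, ?_⟩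
      · refine subset_preComp (convex_ball p s).isPreconnected hp' (mem_ball_self hs) ?_
        rw [mem_ball, dist_eq_norm, add_sub_cancel_left, Complex.norm_real,
          Real.norm_of_nonneg (by positivity)]
        linarith
      · rw [dist_eq_norm, sub_add_cancel_left, norm_neg, Complex.norm_real,
          Real.norm_of_nonneg (by positivity)]
        exact min_le_right _ _
  have himg := image_preComp hFn isOpen_ball (convex_ball _ _).isPreconnected hc
  obtain ⟨v, hv, hvw⟩ : w ∈ (it f n).eval '' preComp (it f n) (ball w (R' / 2)) c := by
    rw [himg]; exact mem_ball_self (by positivity)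
  refine ⟨v, mem_frontier_of_eval_mem h hf n (by
    rw [show (it f n).eval v = w from hvw]; exact hw), ?_⟩
  obtain ⟨q, hq, hqv⟩ : ∃ q ∈ preComp (it f n) (ball w (R' / 2)) c, b' / 2 ≤ dist q v := by
    by_contra! hcon
    have h1 := hcon c (mem_preComp hc)
    have h2 := hcon c' hcc
    have := dist_triangle_right c c' v
    linarith
  have hcR' : (it f n).eval c ∈ ball w R' := ball_subset_ball (by linarith) hc
  have := hκ (it f n) w c v q R' (b' / 2) (preComp (it f n) (ball w (R' / 2)) c) hFn hR'
    (by positivity) (hDJ c hcR') (isPreconnected_preComp _ _ _)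
    (preComp_mono _ (ball_subset_ball (by linarith)) c)
    (fun z hz => by
      have : dist ((it f n).eval z) w < R' / 2 := preComp_mapsTo _ _ _ hz
      rw [mem_closedBall]; linarith) hv hq hqv
  exact fun z hz => preComp_mapsTo _ _ _ (this hz)

/-- `Z` is a closed set absorbing the forward orbits of those critical points which are not
uniformly non-recurrent. -/
structure CritControl (f : ℂ[X]) (R₀ : ℝ) (Z : Set ℂ) (ε : ℝ) : Prop where
  esc : EscapeRadius f R₀
  deg : 0 < f.degree
  closed : IsClosed Z
  mem : (R₀ : ℂ) ∈ Z
  pos : 0 < ε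
  crit : ∀ c, f.derivative.eval c = 0 → (∀ n ≥ 1, (it f n).eval c ∈ Z) ∨
    (c ∈ filled f ∧ ∀ m ≥ 1, ε ≤ dist ((it f m).eval c) c ∧ (it f m).eval c ∉ kcomp f c)

section

variable {f : ℂ[X]} {R₀ ε : ℝ} {Z : Set ℂ}

lemma eval_mem_pull (hf : 0 < f.degree) {n t₁ t₂ : ℕ} (h12 : t₁ ≤ t₂) (h2 : t₂ ≤ n) {Ω : Set ℂ}
    (hΩ : IsOpen Ω) {u c : ℂ} (hu : (it f n).eval u ∈ Ω)
    (hc : c ∈ pull f (n - t₁) Ω ((it f t₁).eval u)) :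
    (it f (t₂ - t₁)).eval c ∈ pull f (n - t₂) Ω ((it f t₂).eval u) := by
  have h := image_pull_add hf (n - t₂) (t₂ - t₁) hΩ (u := (it f t₁).eval u) (by
    rw [← eval_it_add]; rwa [show n - t₂ + (t₂ - t₁) + t₁ = n by omega])
  rw [← eval_it_add, Nat.sub_add_cancel h12, show n - t₂ + (t₂ - t₁) = n - t₁ by omega] at h
  rw [← h]
  exact mem_image_of_mem _ hc

lemma CritControl.ncard_le_of_disjoint (S : CritControl f R₀ Z ε) {y : ℂ} {ρ : ℝ} (hρ : 0 < ρ)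
    (hJ : Disjoint (ball y ρ) (frontier (filled f))) (hZ : Disjoint (ball y ρ) Z) (n : ℕ) (u : ℂ)
    (hu : (it f n).eval u ∈ ball y ρ) (x : ℂ) :
    {z | z ∈ pull f n (ball y ρ) u ∧ (it f n).eval z = x}.ncard ≤ degBound f := by
  refine ncard_fiber_pull_le_degBound S.deg n (isLemn_ball y hρ) u hu ?_ x
  intro t₁ t₂ c h12 h2 hc0 hc1 hc2
  rcases S.crit c hc0 with hb | ⟨hcK, hg⟩
  · exact disjoint_left.1 hZ (preComp_mapsTo _ _ _ hc2) (hb (n - t₂) (by omega))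
  · have hd : Disjoint (pull f (n - t₂) (ball y ρ) ((it f t₂).eval u)) (frontier (filled f)) :=
      disjoint_left.2 fun v hv hvJ => disjoint_left.1 hJ (preComp_mapsTo _ _ _ hv)
        (eval_mem_frontier S.esc _ hvJ)
    have hsub := subset_filled_of_disjoint_frontier S.esc (isPreconnected_preComp _ _ _) hd hc2 hcK
    exact (hg (t₂ - t₁) (by omega)).2 (subset_kcomp (isPreconnected_preComp _ _ _) hsub hc2
      (eval_mem_pull S.deg h12.le h2.le isOpen_ball hu hc1))

lemma CritControl.infDist_le (S : CritControl f R₀ Z ε) {w : ℂ} (hw : w ∈ frontier (filled f)) :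
    infDist w Z ≤ 2 * R₀ := by
  refine (infDist_le_dist_of_mem S.mem).trans ?_
  have h1 := S.esc.mem_filled_iff.1 (S.esc.isCompact_filled.isClosed.frontier_subset hw) 0
  simp only [eval_it, Function.iterate_zero, id] at h1
  rw [dist_eq_norm]
  have := norm_sub_le w (R₀ : ℂ)
  rw [Complex.norm_real, Real.norm_of_nonneg S.esc.1.le] at this
  linarith

lemma ncard_cover_le {D : ℕ} {R : ℝ} (hR : 0 < R) (T : Finset ℂ) (hTb : ∀ t ∈ T, ‖t‖ < 1)
    (hT : ∀ z, ‖z‖ < 1 → ∃ t ∈ T, dist z t < 1 / 16) (hf : 0 < f.degree) (n : ℕ) (w u : ℂ)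
    (hD : ∀ x, {z | z ∈ pull f n (ball w R) u ∧ (it f n).eval z = x}.ncard ≤ D) :
    ∃ s : Finset ℂ, s.card ≤ T.card * D ∧ (∀ v ∈ s, (it f n).eval v ∈ ball w R) ∧
      pull f n (ball w R) u ⊆ ⋃ v ∈ s, pull f n (ball ((it f n).eval v) (R / 16)) v := by
  classical
  have hfin : ∀ x, {z | z ∈ pull f n (ball w R) u ∧ (it f n).eval z = x}.Finite := fun x =>
    (finite_fiber (degree_it_pos hf n) x).subset fun z hz => hz.2
  refine ⟨T.biUnion fun t => (hfin (w + R * t)).toFinset, ?_, ?_, ?_⟩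
  · refine Finset.card_biUnion_le_card_mul _ _ _ fun t _ => ?_
    rw [← ncard_eq_toFinset_card _ (hfin _)]
    exact hD _
  · intro v hv
    obtain ⟨t, _, hv⟩ := Finset.mem_biUnion.1 hv
    exact preComp_mapsTo _ _ _ ((hfin _).mem_toFinset.1 hv).1
  · intro v hv
    have hvw : dist ((it f n).eval v) w < R := preComp_mapsTo _ _ _ hv
    obtain ⟨t, ht, hvt⟩ := hT (((it f n).eval v - w) / R) (by
      rw [norm_div, Complex.norm_real, Real.norm_of_nonneg hR.le, div_lt_one hR, ← dist_eq_norm]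
      exact hvw)
    have hR' : (R : ℂ) ≠ 0 := by exact_mod_cast hR.ne'
    set y := w + R * t with hy
    have hvy : dist ((it f n).eval v) y < R / 16 := by
      have : (it f n).eval v - y = R * (((it f n).eval v - w) / R - t) := by
        rw [hy]; field_simp; ring
      rw [dist_eq_norm, this, norm_mul, Complex.norm_real, Real.norm_of_nonneg hR.le,
        ← dist_eq_norm]
      nlinarith
    have hyw : dist y w < R := by
      rw [hy, dist_eq_norm, add_sub_cancel_left, norm_mul, Complex.norm_real,
        Real.norm_of_nonneg hR.le]
      nlinarith [hTb t ht]
    have hvC : (it f n).eval v ∈ ball w R ∩ ball y (R / 16) := ⟨hvw, hvy⟩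
    have himg := image_preComp (degree_it_pos hf n) (isOpen_ball.inter isOpen_ball)
      ((convex_ball w R).inter (convex_ball y (R / 16))).isPreconnected hvC
    obtain ⟨v', hv', hv'y⟩ :
        y ∈ (it f n).eval '' preComp (it f n) (ball w R ∩ ball y (R / 16)) v := by
      rw [himg]; exact ⟨hyw, mem_ball_self (by positivity)⟩
    have hv'y : (it f n).eval v' = y := hv'y
    refine mem_iUnion₂.2 ⟨v', Finset.mem_biUnion.2 ⟨t, ht, (hfin _).mem_toFinset.2 ⟨?_, hv'y⟩⟩, ?_⟩
    · have : pull f n (ball w R) u = pull f n (ball w R) v := preComp_eq hv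
      rw [this]
      exact preComp_mono _ inter_subset_left _ hv'
    · have h1 := preComp_mono (it f n) inter_subset_right v hv'
      rw [hv'y, pull, ← preComp_eq h1]
      exact mem_preComp hvy

lemma exists_net : ∃ T : Finset ℂ, (∀ t ∈ T, ‖t‖ < 1) ∧
    ∀ z : ℂ, ‖z‖ < 1 → ∃ t ∈ T, dist z t < 1 / 16 := by
  classical
  have : TotallyBounded (ball (0 : ℂ) 1) :=
    ((isCompact_closedBall (0 : ℂ) 1).totallyBounded).subset ball_subset_closedBall
  obtain ⟨t, hts, htf, hcov⟩ := finite_approx_of_totallyBounded this (1 / 16) (by norm_num)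
  refine ⟨htf.toFinset, fun t ht => ?_, fun z hz => ?_⟩
  · simpa using hts (htf.mem_toFinset.1 ht)
  · obtain ⟨s, hs, hzs⟩ := mem_iUnion₂.1 (hcov (mem_ball_zero_iff.2 hz))
    exact ⟨s, htf.mem_toFinset.2 hs, hzs⟩

/-- Pullbacks of discs centred on the Julia set, of radius small compared to the distance to `Z`,
are uniformly small and have uniformly bounded degree. -/
theorem CritControl.exists_pull_small (S : CritControl f R₀ Z ε) :
    ∃ κ > 0, κ ≤ 1 / 16 ∧ ∀ n, ∀ w ∈ frontier (filled f), 0 < infDist w Z →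
      ∀ u, (it f n).eval u ∈ ball w (κ * infDist w Z) →
      ∀ x, {z | z ∈ pull f n (ball w (κ * infDist w Z)) u ∧ (it f n).eval z = x}.ncard
        ≤ degBound f := by
  have h := S.esc
  have hR₀ := h.1
  set D := degBound f with hD
  obtain ⟨T, hTb, hT⟩ := exists_net
  set σ₁ := ε / (2 * (T.card * D + 1)) with hσ₁
  have hε := S.pos
  have hσ₁0 : 0 < σ₁ := by positivity
  obtain ⟨σ, hσ, hLC⟩ := exists_mapsTo_of_le_dist D (M := 1) one_pos hσ₁0
  obtain ⟨ρ, hρ, hρJ⟩ := exists_pos_forall_le_dist h hσ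
  have hne : Z.Nonempty := ⟨_, S.mem⟩
  refine ⟨min (1 / 16) (ρ / (4 * R₀)), by positivity, min_le_left _ _, ?_⟩
  set κ := min (1 / 16) (ρ / (4 * R₀)) with hκ
  have hκ0 : 0 < κ := by positivity
  have hκ1 : κ ≤ 1 / 16 := min_le_left _ _
  have hκρ : κ * (4 * R₀) ≤ ρ := (le_div_iff₀ (by positivity)).1 (min_le_right _ _)
  have hZball : ∀ w r, r ≤ infDist w Z → Disjoint (ball w r) Z := fun w r hr =>
    disjoint_left.2 fun z hz hzZ => by
      have := infDist_le_dist_of_mem (x := w) hzZ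
      rw [mem_ball, dist_comm] at hz
      linarith
  suffices H : ∀ n, (∀ w ∈ frontier (filled f), 0 < infDist w Z →
      ∀ u, (it f n).eval u ∈ ball w (κ * infDist w Z) →
      ∀ x, {z | z ∈ pull f n (ball w (κ * infDist w Z)) u ∧ (it f n).eval z = x}.ncard ≤ D) ∧
      ∀ w ∈ frontier (filled f), 0 < infDist w Z →
      ∀ u, (it f n).eval u ∈ ball w (κ * infDist w Z) →
      ∀ a ∈ pull f n (ball w (κ * infDist w Z)) u, ∀ a' ∈ pull f n (ball w (κ * infDist w Z)) u,
        dist a a' < ε from fun n => (H n).1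
  intro n
  induction n using Nat.strong_induction_on with
  | _ n ih =>
  have hdeg : ∀ w ∈ frontier (filled f), 0 < infDist w Z →
      ∀ u, (it f n).eval u ∈ ball w (κ * infDist w Z) →
      ∀ x, {z | z ∈ pull f n (ball w (κ * infDist w Z)) u ∧ (it f n).eval z = x}.ncard ≤ D := by
    intro w hw hwZ u hu x
    refine ncard_fiber_pull_le_degBound S.deg n (isLemn_ball w (by positivity)) u hu ?_ x
    intro t₁ t₂ c h12 h2 hc0 hc1 hc2
    rcases S.crit c hc0 with hb | ⟨hcK, hg⟩
    · exact disjoint_left.1 (hZball w (κ * infDist w Z) (by nlinarith))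
        (preComp_mapsTo _ _ _ hc2) (hb (n - t₂) (by omega))
    · rcases Nat.eq_zero_or_pos t₂ with h0 | hpos
      · omega
      · have := (ih (n - t₂) (by omega)).2 w hw hwZ _
          (by rwa [← eval_it_add, Nat.sub_add_cancel h2.le]) _
          (eval_mem_pull S.deg h12.le h2.le isOpen_ball hu hc1) c hc2
        exact absurd this (not_lt.2 (hg (t₂ - t₁) (by omega)).1)
  refine ⟨hdeg, fun w hw hwZ u hu a ha a' ha' => ?_⟩
  set R := κ * infDist w Z with hR
  have hR0 : 0 < R := by positivity
  have hRle : R ≤ infDist w Z / 16 := by rw [hR]; nlinarith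
  obtain ⟨s, hscard, hsw, hcov⟩ := ncard_cover_le hR0 T hTb hT S.deg n w u (hdeg w hw hwZ u hu)
  have hle := dist_le_card_mul (isPreconnected_preComp _ _ _) s _ hcov hσ₁0.le ?_ ha ha'
  · have h1 : (s.card : ℝ) ≤ T.card * D := by exact_mod_cast hscard
    have h2 : (s.card : ℝ) * σ₁ ≤ T.card * D * σ₁ := by gcongr
    have h3 : (T.card * D + 1) * σ₁ = ε / 2 := by rw [hσ₁]; field_simp
    nlinarith
  intro v hv b hb b' hb'
  by_contra! hlt
  have hyw : dist ((it f n).eval v) w < R := hsw v hv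
  set y := (it f n).eval v with hy
  obtain ⟨w', hw', hyw'⟩ := (isCompact_frontier_filled h).exists_infDist_eq_dist ⟨w, hw⟩ y
  have h1 : dist y w' < R := hyw' ▸ (infDist_le_dist_of_mem hw).trans_lt hyw
  have hww' : infDist w Z ≤ infDist w' Z + dist w w' := infDist_le_infDist_add_dist
  have hww : dist w w' < 2 * R := by
    have := dist_triangle_left w w' y
    linarith
  have hw'Z : 7 / 8 * infDist w Z ≤ infDist w' Z := by linarith
  have hw'0 : 0 < infDist w' Z := by linarith
  have hJ : Disjoint (ball y (dist y w')) (frontier (filled f)) :=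
    disjoint_left.2 fun z hz hzJ => by
    have := infDist_le_dist_of_mem (x := y) hzJ
    rw [mem_ball, dist_comm] at hz
    linarith
  have hZ : Disjoint (ball y (dist y w')) Z :=
    (hZball w (infDist w Z) le_rfl).mono_left (ball_subset_ball' (by linarith))
  obtain ⟨v', hv', hmaps⟩ := hLC f R₀ n y w' R (κ * infDist w' Z) h S.deg hw' hR0
    (by linarith) (by nlinarith)
    (fun hge u' hu' x => S.ncard_le_of_disjoint (by linarith) hJ hZ n u' hu' x)
    (hdeg w' hw' hw'0) v b b' (mem_ball_self (by positivity)) hb hb' hlt.le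
  obtain ⟨p, hp, q, hq, hpq⟩ := hρJ n v' hv'
  have hp' := hmaps hp
  have hq' := hmaps hq
  rw [mem_ball] at hp' hq'
  have := dist_triangle_right ((it f n).eval p) ((it f n).eval q) w'
  have := S.infDist_le hw'
  nlinarith

end

section

variable {f : ℂ[X]} {R₀ ε : ℝ} {Z : Set ℂ}

lemma EscapeRadius.frontier_nonempty (h : EscapeRadius f R₀) {z : ℂ} (hz : z ∈ filled f) :
    (frontier (filled f)).Nonempty := by
  by_contra hne
  rw [not_nonempty_iff_eq_empty] at hne
  have h1 := subset_filled_of_disjoint_frontier h isPreconnected_univ (by simp [hne])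
    (mem_univ z) hz (mem_univ (R₀ : ℂ))
  have h2 := h.mem_filled_iff.1 h1 0
  simp only [eval_it, Function.iterate_zero, id, Complex.norm_real] at h2
  exact absurd (le_abs_self R₀) (not_le.2 h2)

lemma exists_pos_le_infDist {A Z : Set ℂ} (hA : IsCompact A) (hne : A.Nonempty) (hZ : IsClosed Z)
    (hZne : Z.Nonempty) (hd : Disjoint A Z) : ∃ r > 0, ∀ q ∈ A, r ≤ infDist q Z := by
  obtain ⟨q, hq, hmin⟩ := hA.exists_isMinOn hne (continuous_infDist_pt Z).continuousOn
  exact ⟨_, (hZ.notMem_iff_infDist_pos hZne).1 (disjoint_left.1 hd hq), fun p hp => hmin hp⟩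

/-- Near a component of the filled Julia set which avoids `Z`, pullbacks of discs of a definite
size under high iterates are uniformly small. -/
theorem CritControl.exists_forall_dist_lt (S : CritControl f R₀ Z ε) {z : ℂ} (hz : z ∈ filled f)
    (hd : Disjoint (kcomp f z) Z) :
    ∃ r > 0, ∃ O, IsOpen O ∧ kcomp f z ⊆ O ∧ ∀ τ > 0, ∃ k₀, ∀ k ≥ k₀, ∀ y ∈ O, ∀ u,
      (it f k).eval u ∈ ball y r → ∀ a ∈ pull f k (ball y r) u, ∀ a' ∈ pull f k (ball y r) u,
        dist a a' < τ := by
  have h := S.esc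
  have hR₀ := h.1
  obtain ⟨κ, hκ0, hκ1, hκ⟩ := S.exists_pull_small
  obtain ⟨h₀, hh₀, hh⟩ := exists_pos_le_infDist (h.isCompact_kcomp z) ⟨z, mem_kcomp hz⟩ S.closed
    ⟨_, S.mem⟩ hd
  set R := κ * h₀ / 2 with hR
  have hR0 : 0 < R := by positivity
  have hRh : R ≤ h₀ / 32 := by rw [hR]; nlinarith
  refine ⟨R / 16, by positivity, thickening (R / 8) (kcomp f z), isOpen_thickening,
    self_subset_thickening (by positivity) _, fun τ hτ => ?_⟩
  obtain ⟨σ, hσ, hLC⟩ := exists_mapsTo_of_le_dist (degBound f) (M := 2 * R₀ / R + 1)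
    (by positivity) hτ
  obtain ⟨k₀, hk₀⟩ := exists_forall_le_dist_of_le h hσ R₀
  refine ⟨k₀, fun k hk y hy u hu a ha a' ha' => ?_⟩
  by_contra! hlt
  obtain ⟨q, hq, hyq⟩ := mem_thickening_iff.1 hy
  obtain ⟨w, hw, hyw⟩ := (isCompact_frontier_filled h).exists_infDist_eq_dist
    (h.frontier_nonempty hz) y
  have hJ : Disjoint (ball y (dist y w)) (frontier (filled f)) := disjoint_left.2 fun z hz hzJ => by
    have := infDist_le_dist_of_mem (x := y) hzJ
    rw [mem_ball, dist_comm] at hz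
    linarith
  have hnorm : ∀ p ∈ filled f, ‖p‖ < R₀ := fun p hp => by
    simpa [eval_it] using h.mem_filled_iff.1 hp 0
  have hqK := kcomp_subset f z hq
  have hwK := h.isCompact_filled.isClosed.frontier_subset hw
  have hM : dist y w ≤ (2 * R₀ / R + 1) * R := by
    have h1 := dist_triangle y q w
    have h2 := dist_le_norm_add_norm q w
    have h3 : (2 * R₀ / R + 1) * R = 2 * R₀ + R := by field_simp
    linarith [hnorm q hqK, hnorm w hwK]
  have hfat : R / 4 ≤ dist y w → ball y (dist y w) ⊆ kcomp f z := fun hge => by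
    have hqb : q ∈ ball y (dist y w) := by rw [mem_ball, dist_comm]; linarith
    have h1 := subset_filled_of_disjoint_frontier h (convex_ball y _).isPreconnected hJ hqb hqK
    rw [kcomp_eq hq]
    exact subset_kcomp (convex_ball y _).isPreconnected h1 hqb
  have hwZ : 5 / 8 * (h₀ / 2) ≤ infDist w Z := by
    rcases lt_or_ge (dist y w) (R / 4) with hlt' | hge
    · have h1 := hh q hq
      have h2 : infDist q Z ≤ infDist w Z + dist q w := infDist_le_infDist_add_dist
      have h3 := dist_triangle_left q w y
      linarith
    · have h1 : w ∈ kcomp f z := by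
        have := closure_minimal (hfat hge) (h.isCompact_kcomp z).isClosed
        rw [closure_ball y (by linarith : dist y w ≠ 0 )] at this
        exact this (by rw [mem_closedBall, dist_comm])
      linarith [hh w h1]
  have hw0 : 0 < infDist w Z := by linarith
  obtain ⟨v, hv, hmaps⟩ := hLC f R₀ k y w R (κ * infDist w Z) h S.deg hw hR0 hM
    (by rw [hR]; nlinarith)
    (fun hge u' hu' x =>
        S.ncard_le_of_disjoint (by linarith) hJ (hd.mono_left (hfat hge)) k u' hu' x)
    (hκ k w hw hw0) u a a' hu ha ha' hlt
  obtain ⟨p, hp, q', hq', hpq⟩ := hk₀ k hk v hv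
  have hp1 := hmaps hp
  have hq1 := hmaps hq'
  rw [mem_ball] at hp1 hq1
  have := dist_triangle_right ((it f k).eval p) ((it f k).eval q') w
  have := S.infDist_le hw
  nlinarith

end

/-- The component of `x` in the filled Julia set is wandering. -/
def Wand (f : ℂ[X]) (x : ℂ) : Prop :=
  ∀ n m : ℕ, 1 ≤ m → kcomp f ((it f (n + m)).eval x) ≠ kcomp f ((it f n).eval x)

/-- `Q` is a forward invariant finite union of components of the filled Julia set. -/
def InvUnion (f : ℂ[X]) (Q : Set ℂ) : Prop :=
  ∃ S : Set ℂ, S.Finite ∧ S ⊆ filled f ∧ Q = ⋃ s ∈ S, kcomp f s ∧ MapsTo f.eval Q Q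

section

variable {f : ℂ[X]} {R₀ : ℝ} {Q : Set ℂ}

lemma InvUnion.kcomp_subset (hQ : InvUnion f Q) {y : ℂ} (hy : y ∈ Q) : kcomp f y ⊆ Q := by
  obtain ⟨S, -, -, rfl, -⟩ := hQ
  obtain ⟨s, hs, hys⟩ := mem_iUnion₂.1 hy
  rw [← kcomp_eq hys]
  exact subset_biUnion_of_mem (u := fun s => kcomp f s) hs

lemma InvUnion.disjoint_kcomp (hQ : InvUnion f Q) {y : ℂ} (hy : y ∈ filled f) (hyQ : y ∉ Q) :
    Disjoint (kcomp f y) Q :=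
  disjoint_left.2 fun _ hp hpQ => hyQ (hQ.kcomp_subset hpQ (kcomp_eq hp ▸ mem_kcomp hy))

lemma InvUnion.isClosed (hQ : InvUnion f Q) (h : EscapeRadius f R₀) : IsClosed Q := by
  obtain ⟨S, hS, -, rfl, -⟩ := hQ
  exact hS.isClosed_biUnion fun s _ => (h.isCompact_kcomp s).isClosed

lemma InvUnion.eval_mem (hQ : InvUnion f Q) {y : ℂ} (hy : y ∈ Q) (n : ℕ) :
    (it f n).eval y ∈ Q := by
  obtain ⟨S, -, -, -, hm⟩ := hQ
  rw [eval_it]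
  exact hm.iterate n hy

lemma InvUnion.biUnion {C : Set ℂ} (hC : C.Finite) {q : ℂ → Set ℂ}
    (hq : ∀ c ∈ C, InvUnion f (q c)) :
    InvUnion f (⋃ c ∈ C, q c) := by
  choose! S hS hSK hSq hm using hq
  refine ⟨⋃ c ∈ C, S c, hC.biUnion hS, iUnion₂_subset hSK, ?_, ?_⟩
  · rw [iUnion₂_congr hSq]
    ext z
    simp only [mem_iUnion]
    exact ⟨fun ⟨c, hc, s, hs, hz⟩ => ⟨s, ⟨c, hc, hs⟩, hz⟩,
      fun ⟨s, ⟨c, hc, hs⟩, hz⟩ => ⟨c, hc, s, hs, hz⟩⟩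
  · intro z hz
    obtain ⟨c, hc, hzc⟩ := mem_iUnion₂.1 hz
    exact mem_iUnion₂.2 ⟨c, hc, hm c hc hzc⟩

lemma exists_invUnion_of_not_wand (h : EscapeRadius f R₀) (hf : 0 < f.degree) {x : ℂ}
    (hx : x ∈ filled f) (hw : ¬ Wand f x) : ∃ Q, InvUnion f Q ∧ x ∈ Q := by
  unfold Wand at hw
  push Not at hw
  obtain ⟨n, m, hm, hnm⟩ := hw
  refine ⟨⋃ s ∈ (fun k => (it f k).eval x) '' Iio (n + m), kcomp f s,
    ⟨_, (finite_Iio _).image _, ?_, rfl, ?_⟩, ?_⟩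
  · rintro _ ⟨k, -, rfl⟩
    exact (h.mem_filled_it k).2 hx
  · intro z hz
    rw [biUnion_image] at hz ⊢
    obtain ⟨k, hk, hzk⟩ := mem_iUnion₂.1 hz
    have h1 : f.eval z ∈ kcomp f ((it f (k + 1)).eval x) := by
      have := h.image_kcomp hf 1 ((h.mem_filled_it k).2 hx)
      rw [← eval_it_add, add_comm 1 k] at this
      rw [← this, ← it_one_eval f z]
      exact mem_image_of_mem _ hzk
    rcases (Nat.succ_le_of_lt hk).lt_or_eq with hlt | heq
    · exact mem_iUnion₂.2 ⟨k + 1, hlt, h1⟩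
    · refine mem_iUnion₂.2 ⟨n, by simp; omega, ?_⟩
      rw [← hnm, ← heq]
      exact h1
  · rw [biUnion_image]
    refine mem_iUnion₂.2 ⟨0, by simp; omega, ?_⟩
    have : (it f 0).eval x = x := by simp
    rw [this]
    exact mem_kcomp hx

lemma InvUnion.notMem_of_wand (hQ : InvUnion f Q) {x : ℂ} (hw : Wand f x) (n : ℕ) :
    (it f n).eval x ∉ Q := by
  intro hn
  have hall : ∀ k, (it f (n + k)).eval x ∈ Q := fun k => by
    rw [add_comm, eval_it_add]
    exact hQ.eval_mem hn k
  obtain ⟨S, hS, -, rfl, -⟩ := hQ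
  simp only [mem_iUnion₂] at hall
  choose s hs hks using hall
  obtain ⟨k, -, l, -, hkl, hskl⟩ := infinite_univ.exists_ne_map_eq_of_mapsTo
    (f := s) (t := S) (fun k _ => hs k) hS
  wlog hlt : k < l generalizing k l
  · exact this l k hkl.symm hskl.symm (by omega)
  refine hw (n + k) (l - k) (by omega) ?_
  rw [show n + k + (l - k) = n + l by omega, ← kcomp_eq (hks l), ← kcomp_eq (hks k), hskl]

lemma exists_isOpen_eventually_notMem {A : Set ℂ} (hA : IsCompact A) {u : ℕ → ℂ}
    (h : ∀ y ∈ A, ¬ MapClusterPt y atTop u) :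
    ∃ N, IsOpen N ∧ A ⊆ N ∧ ∀ᶠ n in atTop, u n ∉ N := by
  have hd : Disjoint (𝓝ˢ A) (map u atTop) := by
    rw [hA.disjoint_nhdsSet_left]
    intro y hy
    have := h y hy
    rwa [MapClusterPt, ClusterPt, neBot_iff, not_not, ← disjoint_iff] at this
  obtain ⟨s, hs, t, ht, hst⟩ := Filter.disjoint_iff.1 hd
  obtain ⟨N, hN, hAN, hNs⟩ := mem_nhdsSet_iff_exists.1 hs
  exact ⟨N, hN, hAN, by
    filter_upwards [mem_map.1 ht] with n hn hnN using disjoint_left.1 hst (hNs hnN) hn⟩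

/-- If an orbit accumulates on an invariant finite union `Q` of components without entering it,
then it accumulates at a point of `f⁻¹(Q) \ Q`. -/
lemma InvUnion.exists_mapClusterPt (hQ : InvUnion f Q) (h : EscapeRadius f R₀) (hf : 0 < f.degree)
    {x : ℂ} (hx : x ∈ filled f) (hxQ : ∀ n, (it f n).eval x ∉ Q) {y₀ : ℂ} (hy₀ : y₀ ∈ Q)
    (hy₀x : MapClusterPt y₀ atTop fun n => (it f n).eval x) :
    ∃ y, MapClusterPt y atTop (fun n => (it f n).eval x) ∧ y ∉ Q ∧ f.eval y ∈ Q := by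
  by_contra! hcon
  have hQ' := hQ
  obtain ⟨S, hS, hSK, hSQ, hm⟩ := hQ'
  have hmem : ∀ n, (it f n).eval x ∈ filled f := fun n => (h.mem_filled_it n).2 hx
  have hR : ∀ {y}, y ∈ filled f → ∀ m, ‖(it f m).eval y‖ < R₀ := fun hy m => h.mem_filled_iff.1 hy m
  have hSQ' : S ⊆ Q := fun s hs => hSQ ▸ mem_iUnion₂.2 ⟨s, hs, mem_kcomp (hSK hs)⟩
  set S' := {s' | f.eval s' ∈ S} with hS'
  have hS'K : S' ⊆ filled f := fun s' hs' => by
    rw [← h.mem_filled_it 1, it_one_eval]; exact hSK hs'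
  have hS'f : S'.Finite := by
    have : S' = ⋃ s ∈ S, {z | f.eval z = s} := by ext; simp [hS']
    rw [this]
    exact hS.biUnion fun s _ => finite_fiber hf s
  have key : ∀ s' ∈ S' \ Q, ∃ n₀, ∀ n ≥ n₀, ∀ m ≥ n₀, (it f n).eval x ∉ piece f R₀ m s' := by
    rintro s' ⟨hs', hs'Q⟩
    have hs'K := hS'K hs'
    obtain ⟨N, hN, hsN, hev⟩ := exists_isOpen_eventually_notMem (h.isCompact_kcomp s')
      (u := fun n => (it f n).eval x) (fun y hy hyx => by
        refine hcon y hyx (disjoint_left.1 (hQ.disjoint_kcomp hs'K hs'Q) hy) ?_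
        refine hQ.kcomp_subset (hSQ' hs') ?_
        have := h.image_kcomp hf 1 hs'K
        rw [it_one_eval] at this
        rw [← this, ← it_one_eval]
        exact mem_image_of_mem _ hy)
    obtain ⟨m₀, hm₀⟩ := h.exists_piece_subset hs'K hN hsN
    obtain ⟨n₀, hn₀⟩ := eventually_atTop.1 hev
    exact ⟨max n₀ m₀, fun n hn m hm hnm => hn₀ n (le_of_max_le_left hn)
      (hm₀ m (le_of_max_le_right hm) hnm)⟩
  choose! b hb using key
  obtain ⟨n₀, hn₀⟩ := ((hS'f.subset sdiff_subset).image b).bddAbove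
  have hstep : ∀ n ≥ n₀, ∀ m ≥ n₀, (∃ s ∈ S, (it f (n + 1)).eval x ∈ piece f R₀ m s) →
      ∃ s ∈ S, (it f n).eval x ∈ piece f R₀ (m + 1) s := by
    rintro n hn m hm ⟨s, hs, hsx⟩
    have himg := image_piece hf m 1 (hR (hmem n) (m + 1))
    rw [← eval_it_add, add_comm 1 n, ← piece_eq hsx] at himg
    obtain ⟨s', hs', hs's⟩ : s ∈ (it f 1).eval '' piece f R₀ (m + 1) ((it f n).eval x) := by
      rw [himg]; exact mem_piece_iff_self.2 (hR (hSK hs) m)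
    have hs's : f.eval s' = s := by rw [← it_one_eval]; exact hs's
    have hs'S : s' ∈ S' := by rw [hS', mem_ofPred_eq, hs's]; exact hs
    have hxs' : (it f n).eval x ∈ piece f R₀ (m + 1) s' := by
      rw [← piece_eq hs']; exact mem_piece_iff_self.2 (hR (hmem n) _)
    by_cases hs'Q : s' ∈ Q
    · rw [hSQ] at hs'Q
      obtain ⟨t, ht, hts⟩ := mem_iUnion₂.1 hs'Q
      refine ⟨t, ht, ?_⟩
      rwa [piece_eq (h.kcomp_subset_piece (hSK ht) (m + 1) hts)]
    · have := hn₀ (mem_image_of_mem b ⟨hs'S, hs'Q⟩)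
      exact absurd hxs' (hb s' ⟨hs'S, hs'Q⟩ n (this.trans hn) (m + 1) (by omega))
  have hback : ∀ k m, n₀ ≤ m → (∃ s ∈ S, (it f (n₀ + k)).eval x ∈ piece f R₀ m s) →
      ∃ s ∈ S, (it f n₀).eval x ∈ piece f R₀ (m + k) s := by
    intro k
    induction k with
    | zero => exact fun m _ hk => hk
    | succ k ih =>
      intro m hm hk
      have := ih (m + 1) (by omega) (hstep (n₀ + k) (by omega) m hm hk)
      rwa [show m + 1 + k = m + (k + 1) by ring] at this
  have hdeep : ∀ M, ∃ s ∈ S, (it f n₀).eval x ∈ piece f R₀ M s := by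
    intro M
    rw [hSQ] at hy₀
    obtain ⟨s, hs, hys⟩ := mem_iUnion₂.1 hy₀
    have hnh : piece f R₀ n₀ s ∈ 𝓝 y₀ :=
      (isOpen_piece n₀ s).mem_nhds (h.kcomp_subset_piece (hSK hs) n₀ hys)
    obtain ⟨n, hn, hns⟩ := frequently_atTop.1 (hy₀x.frequently hnh) (n₀ + M)
    obtain ⟨t, ht, hxt⟩ := hback (n - n₀) n₀ le_rfl
      ⟨s, hs, by rwa [Nat.add_sub_cancel' (by omega)]⟩
    exact ⟨t, ht, h.piece_anti (by omega) (hR (hSK ht) _) hxt⟩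
  refine hxQ n₀ ?_
  rw [hSQ]
  by_contra hnot
  have hmiss : ∀ s ∈ S, ∃ m, (it f n₀).eval x ∉ piece f R₀ m s := fun s hs => by
    by_contra! hall
    exact hnot (mem_iUnion₂.2 ⟨s, hs, (h.mem_kcomp_iff (hSK hs)).2 hall⟩)
  choose! m hmm using hmiss
  obtain ⟨M, hM⟩ := (hS.image m).bddAbove
  obtain ⟨s, hs, hxs⟩ := hdeep M
  exact hmm s hs (h.piece_anti (hM (mem_image_of_mem m hs)) (hR (hSK hs) _) hxs)

lemma InvUnion.kcomp_ne (hQ : InvUnion f Q) {y : ℂ} (hyK : y ∈ filled f) (hy : y ∉ Q)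
    (hfy : f.eval y ∈ Q) {k : ℕ} (hk : 1 ≤ k) : kcomp f ((it f k).eval y) ≠ kcomp f y := by
  intro heq
  obtain ⟨k, rfl⟩ := Nat.exists_eq_add_of_le' hk
  have h1 : (it f (k + 1)).eval y ∈ Q := by
    rw [eval_it_add, it_one_eval]
    exact hQ.eval_mem hfy k
  exact hy (hQ.kcomp_subset h1 (heq ▸ mem_kcomp hyK))

/-- The orbit of a wandering component accumulates on a nonperiodic component avoiding `Q`. -/
lemma InvUnion.exists_nonperiodic (hQ : InvUnion f Q) (h : EscapeRadius f R₀) (hf : 0 < f.degree)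
    {x : ℂ} (hx : x ∈ filled f) (hw : Wand f x) :
    ∃ z ∈ filled f, MapClusterPt z atTop (fun n => (it f n).eval x) ∧ z ∉ Q ∧
      ∀ k ≥ 1, kcomp f ((it f k).eval z) ≠ kcomp f z := by
  have hmem : ∀ n, (it f n).eval x ∈ filled f := fun n => (h.mem_filled_it n).2 hx
  have hcl : ∀ y, MapClusterPt y atTop (fun n => (it f n).eval x) → y ∈ filled f := fun y hy =>
    h.isCompact_filled.isClosed.mem_of_mapClusterPt hy (Eventually.of_forall hmem)
  by_cases hA : ∃ y₀ ∈ Q, MapClusterPt y₀ atTop fun n => (it f n).eval x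
  · obtain ⟨y₀, hy₀, hy₀x⟩ := hA
    obtain ⟨y, hyx, hyQ, hfy⟩ := hQ.exists_mapClusterPt h hf hx (hQ.notMem_of_wand hw) hy₀ hy₀x
    exact ⟨y, hcl y hyx, hyx, hyQ, fun k hk => hQ.kcomp_ne (hcl y hyx) hyQ hfy hk⟩
  push Not at hA
  obtain ⟨z, hz, hzx⟩ := h.isCompact_filled.exists_mapClusterPt_of_frequently
    (l := atTop) (f := fun n => (it f n).eval x) (Frequently.of_forall hmem)
  by_cases hper : ∀ k ≥ 1, kcomp f ((it f k).eval z) ≠ kcomp f z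
  · exact ⟨z, hz, hzx, fun hzQ => hA z hzQ hzx, hper⟩
  push Not at hper
  obtain ⟨k, hk, hkz⟩ := hper
  obtain ⟨Q', hQ', hzQ'⟩ := exists_invUnion_of_not_wand h hf hz (fun hwz => by
    refine hwz 0 k hk ?_
    rw [zero_add, hkz]
    simp)
  obtain ⟨y, hyx, hyQ, hfy⟩ := hQ'.exists_mapClusterPt h hf hx (hQ'.notMem_of_wand hw) hzQ' hzx
  exact ⟨y, hcl y hyx, hyx, fun hy => hA y hy hyx,
    fun k hk => hQ'.kcomp_ne (hcl y hyx) hyQ hfy hk⟩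

lemma exists_pos_forall_le_dist_self {c : ℂ} (hw : Wand f c)
    (hc : ¬ MapClusterPt c atTop fun n => (it f n).eval c) :
    ∃ ε > 0, ∀ m ≥ 1, ε ≤ dist ((it f m).eval c) c := by
  obtain ⟨N, hN, hcN, hev⟩ := exists_isOpen_eventually_notMem (isCompact_singleton (x := c))
    (u := fun n => (it f n).eval c) (by simpa using hc)
  obtain ⟨n₀, hn₀⟩ := eventually_atTop.1 hev
  set A := (fun m => (it f m).eval c) '' Ico 1 n₀ with hA
  have hAc : c ∉ A := by
    rintro ⟨m, hm, hmc⟩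
    have hmc : (it f m).eval c = c := hmc
    refine hw 0 m hm.1 ?_
    rw [zero_add, hmc]
    simp
  obtain ⟨ε, hε, hball⟩ := Metric.isOpen_iff.1
    (hN.inter ((finite_Ico 1 n₀).image fun m => (it f m).eval c).isClosed.isOpen_compl) c
    ⟨hcN rfl, hAc⟩
  refine ⟨ε, hε, fun m hm => ?_⟩
  by_contra! hlt
  have := hball hlt
  rcases lt_or_ge m n₀ with hmn | hmn
  · exact this.2 (mem_image_of_mem _ ⟨hm, hmn⟩)
  · exact hn₀ m hmn this.1

theorem exists_critControl (h : EscapeRadius f R₀) (hf : 0 < f.degree)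
    (hcrit : ∀ c, f.derivative.eval c = 0 → c ∈ filled f → Wand f c →
      ¬ MapClusterPt c atTop fun n => (it f n).eval c) :
    ∃ Z ε Q, CritControl f R₀ Z ε ∧ InvUnion f Q ∧
      ∀ z ∈ filled f, z ∉ Q → Disjoint (kcomp f z) Z := by
  have hd1 : 1 ≤ f.natDegree := natDegree_pos_iff_degree_pos.2 hf
  have hder : f.derivative ≠ 0 := by
    intro h0
    have := Polynomial.derivative_eq_zero.1 h0
    omega
  have hfin : {c | f.derivative.eval c = 0}.Finite :=
    (f.derivative.roots.toFinset.finite_toSet).subset fun c hc => by simpa [hder] using hc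
  -- the invariant union
  have h1 : ∀ c ∈ {c | f.derivative.eval c = 0 ∧ c ∈ filled f ∧ ¬ Wand f c},
      ∃ q, InvUnion f q ∧ c ∈ q := fun c hc => exists_invUnion_of_not_wand h hf hc.2.1 hc.2.2
  choose! q hq hcq using h1
  have hQ : InvUnion f (⋃ c ∈ {c | f.derivative.eval c = 0 ∧ c ∈ filled f ∧ ¬ Wand f c}, q c) :=
    InvUnion.biUnion (hfin.subset fun c hc => hc.1) hq
  set Q := ⋃ c ∈ {c | f.derivative.eval c = 0 ∧ c ∈ filled f ∧ ¬ Wand f c}, q c with hQdef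
  -- escaping critical points
  have h2 : ∀ c, c ∉ filled f → ∃ N, ∀ n ≥ N, R₀ ≤ ‖(it f n).eval c‖ := fun c hc => by
    rw [h.mem_filled_iff] at hc
    push Not at hc
    obtain ⟨n, hn⟩ := hc
    exact eventually_atTop.1 ((h.tendsto hn).eventually_ge_atTop R₀)
  choose! N hN using h2
  -- non-recurrent critical points
  obtain ⟨ε, hε, hεc⟩ : ∃ ε > 0, ∀ c ∈ {c | f.derivative.eval c = 0},
      c ∈ filled f → Wand f c → ∀ m ≥ 1, ε ≤ dist ((it f m).eval c) c := by
    have : ∀ᶠ ε : ℝ in 𝓝[>] 0, ∀ c ∈ {c | f.derivative.eval c = 0},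
        c ∈ filled f → Wand f c → ∀ m ≥ 1, ε ≤ dist ((it f m).eval c) c := by
      rw [Filter.eventually_all_finite hfin]
      intro c hc
      by_cases hg : c ∈ filled f ∧ Wand f c
      · obtain ⟨ε, hε, hm⟩ := exists_pos_forall_le_dist_self hg.2 (hcrit c hc hg.1 hg.2)
        filter_upwards [Ioo_mem_nhdsGT hε] with e he _ _ m hm1
        exact he.2.le.trans (hm m hm1)
      · exact Eventually.of_forall fun e h1 h2 => absurd ⟨h1, h2⟩ hg
    obtain ⟨ε, hε, he⟩ := (this.and self_mem_nhdsWithin).exists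
    exact ⟨ε, he, hε⟩
  set A := ⋃ c ∈ {c | f.derivative.eval c = 0 ∧ c ∉ filled f},
    (fun n => (it f n).eval c) '' Iio (N c) with hA
  have hAf : A.Finite :=
    (hfin.subset fun c hc => hc.1).biUnion fun c _ => (finite_Iio _).image _
  refine ⟨{z | R₀ ≤ ‖z‖} ∪ A ∪ Q, ε, Q, ⟨h, hf, ?_, ?_, hε, ?_⟩, hQ, ?_⟩
  · exact ((isClosed_le continuous_const continuous_norm).union hAf.isClosed).union (hQ.isClosed h)
  · refine Or.inl (Or.inl ?_)
    rw [mem_ofPred_eq, Complex.norm_real]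
    exact le_abs_self _
  · intro c hc
    by_cases hcK : c ∈ filled f
    · by_cases hw : Wand f c
      · refine Or.inr ⟨hcK, fun m hm => ⟨hεc c hc hcK hw m hm, fun hmc => ?_⟩⟩
        refine hw 0 m hm ?_
        rw [zero_add, ← kcomp_eq hmc]
        simp
      · exact Or.inl fun n _ => Or.inr (hQ.eval_mem
          (mem_iUnion₂.2 ⟨c, ⟨hc, hcK, hw⟩, hcq c ⟨hc, hcK, hw⟩⟩) n)
    · refine Or.inl fun n _ => Or.inl ?_
      rcases lt_or_ge n (N c) with hlt | hge
      · exact Or.inr (mem_iUnion₂.2 ⟨c, ⟨hc, hcK⟩, n, hlt, rfl⟩)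
      · exact Or.inl (hN c hcK n hge)
  · intro z hz hzQ
    refine disjoint_left.2 fun p hp hpZ => ?_
    have hpK := kcomp_subset f z hp
    rcases hpZ with (hpZ | hpZ) | hpZ
    · have := h.mem_filled_iff.1 hpK 0
      simp only [eval_it, Function.iterate_zero, id] at this
      exact absurd this (not_lt.2 hpZ)
    · obtain ⟨c, ⟨-, hcK⟩, n, -, rfl⟩ := mem_iUnion₂.1 hpZ
      exact hcK ((h.mem_filled_it n).1 hpK)
    · exact disjoint_left.1 (hQ.disjoint_kcomp hz hzQ) hp hpZ

end

/-- `a` and `b` lie in a connected open subset of `S` of diameter at most `δ`. -/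
def Link (δ : ℝ) (S : Set ℂ) (a b : ℂ) : Prop :=
  ∃ E, IsOpen E ∧ IsPreconnected E ∧ E ⊆ S ∧ a ∈ E ∧ b ∈ E ∧ ∀ x ∈ E, ∀ y ∈ E, dist x y < δ

/-- `a` and `b` are joined by `n` successive links. -/
def Chain (δ : ℝ) (S : Set ℂ) : ℕ → ℂ → ℂ → Prop
  | 0, a, b => a = b
  | n + 1, a, b => ∃ c, Chain δ S n a c ∧ Link δ S c b

section

variable {δ τ : ℝ} {S G : Set ℂ} {a b c : ℂ} {n m : ℕ}

lemma Link.symm : Link δ S a b → Link δ S b a :=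
  fun ⟨E, hE, hEc, hES, ha, hb, hd⟩ => ⟨E, hE, hEc, hES, hb, ha, hd⟩

lemma eventually_link (hδ : 0 < δ) (hS : IsOpen S) (ha : a ∈ S) : ∀ᶠ b in 𝓝 a, Link δ S a b := by
  obtain ⟨r, hr, hrS⟩ := Metric.isOpen_iff.1 hS a ha
  have h0 : 0 < min r (δ / 2) := by positivity
  refine Filter.mem_of_superset (ball_mem_nhds a h0) fun b hb => ?_
  refine ⟨ball a (min r (δ / 2)), isOpen_ball, (convex_ball _ _).isPreconnected,
    (ball_subset_ball (min_le_left _ _)).trans hrS, mem_ball_self h0, hb, fun x hx y hy => ?_⟩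
  have hx' := (mem_ball.1 hx).trans_le (min_le_right _ _)
  have hy' := (mem_ball.1 hy).trans_le (min_le_right _ _)
  have := dist_triangle_right x y a
  linarith

lemma Link.refl (hδ : 0 < δ) (hS : IsOpen S) (ha : a ∈ S) : Link δ S a a :=
  (eventually_link hδ hS ha).self_of_nhds

lemma Chain.trans (h₁ : Chain δ S n a b) (h₂ : Chain δ S m b c) : Chain δ S (n + m) a c := by
  induction m generalizing c with
  | zero => obtain rfl : b = c := h₂; exact h₁
  | succ m ih =>
    obtain ⟨d, hd, hdc⟩ := h₂
    exact ⟨d, ih hd, hdc⟩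

lemma chain_one : Chain δ S 1 a b ↔ Link δ S a b :=
  ⟨fun ⟨_, hc, h⟩ => hc ▸ h, fun h => ⟨a, rfl, h⟩⟩

lemma Chain.symm (h : Chain δ S n a b) : Chain δ S n b a := by
  induction n generalizing b with
  | zero => exact Eq.symm h
  | succ n ih =>
    obtain ⟨c, hc, hcb⟩ := h
    rw [add_comm]
    exact (chain_one.2 hcb.symm).trans (ih hc)

lemma Chain.exists_split (h : Chain δ S (n + m) a b) : ∃ c, Chain δ S n a c ∧ Chain δ S m c b := by
  induction m generalizing b with
  | zero => exact ⟨b, h, rfl⟩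
  | succ m ih =>
    obtain ⟨d, hd, hdb⟩ := h
    obtain ⟨c, hc, hcd⟩ := ih hd
    exact ⟨c, hc, d, hcd, hdb⟩

lemma Chain.refl (hδ : 0 < δ) (hS : IsOpen S) (ha : a ∈ S) (n : ℕ) : Chain δ S n a a := by
  induction n with
  | zero => rfl
  | succ n ih => exact ⟨a, ih, Link.refl hδ hS ha⟩

lemma Chain.mono (hδ : 0 < δ) (hS : IsOpen S) (ha : a ∈ S) (h : Chain δ S n a b) (hnm : n ≤ m) :
    Chain δ S m a b := by
  obtain ⟨k, rfl⟩ := Nat.exists_eq_add_of_le' hnm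
  exact (Chain.refl hδ hS ha k).trans h

lemma isOpen_chain (hn : 1 ≤ n) : IsOpen {b | Chain δ S n a b} := by
  obtain ⟨n, rfl⟩ := Nat.exists_eq_add_of_le' hn
  refine isOpen_iff_mem_nhds.2 ?_
  rintro b ⟨c, hc, E, hE, hEc, hES, hcE, hb, hd⟩
  exact Filter.mem_of_superset (hE.mem_nhds hb) fun b' hb' => ⟨c, hc, E, hE, hEc, hES, hcE, hb', hd⟩

/-- If the chains of length `n` from `a` do not exhaust the connected set `A`, some point of `A` is
reached in exactly `n + 1` steps. -/
lemma exists_chain_succ (hδ : 0 < δ) (hS : IsOpen S) {A : Set ℂ} (hA : IsPreconnected A)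
    (hAS : A ⊆ S) (ha : a ∈ A) (hn : 1 ≤ n) (hb : b ∈ A) (hab : ¬ Chain δ S n a b) :
    ∃ c ∈ A, Chain δ S (n + 1) a c ∧ ¬ Chain δ S n a c := by
  by_contra! hcon
  refine hab (hA.subset_of_closure_inter_subset (isOpen_chain hn)
    ⟨a, ha, Chain.refl hδ hS (hAS ha) n⟩ ?_ hb)
  rintro c ⟨hc, hcA⟩
  obtain ⟨d, hd, hcd⟩ := mem_closure_iff_nhds.1 hc _ (eventually_link hδ hS (hAS hcA))
  exact hcon c hcA ⟨d, hcd, hd.symm⟩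

lemma exists_chain (hδ : 0 < δ) (hS : IsOpen S) (hSc : IsPreconnected S) (ha : a ∈ S) (hb : b ∈ S) :
    ∃ n, Chain δ S n a b := by
  have hopen : IsOpen (⋃ n : ℕ, {b | Chain δ S (n + 1) a b}) :=
    isOpen_iUnion fun n => isOpen_chain (by omega)
  have := hSc.subset_of_closure_inter_subset hopen
    ⟨a, ha, mem_iUnion.2 ⟨0, Chain.refl hδ hS ha _⟩⟩ (by
      rintro c ⟨hc, hcS⟩
      obtain ⟨d, hd, hcd⟩ := mem_closure_iff_nhds.1 hc _ (eventually_link hδ hS hcS)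
      obtain ⟨n, hn⟩ := mem_iUnion.1 hcd
      exact mem_iUnion.2 ⟨n + 1, d, hn, hd.symm⟩) hb
  obtain ⟨n, hn⟩ := mem_iUnion.1 this
  exact ⟨n + 1, hn⟩

lemma exists_uniform_chain (hδ : 0 < δ) (hS : IsOpen S) (hSc : IsPreconnected S) {C : Set ℂ}
    (hC : IsCompact C) (hCS : C ⊆ S) : ∃ L, ∀ a ∈ C, ∀ b ∈ C, Chain δ S L a b := by
  rcases C.eq_empty_or_nonempty with rfl | ⟨p, hp⟩
  · exact ⟨0, by simp⟩
  obtain ⟨N, hN⟩ := hC.elim_directed_cover (fun n : ℕ => {b | Chain δ S (n + 1) p b})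
    (fun n => isOpen_chain (by omega)) (fun b hb => by
      obtain ⟨n, hn⟩ := exists_chain hδ hS hSc (hCS hp) (hCS hb)
      exact mem_iUnion.2 ⟨n, hn.mono hδ hS (hCS hp) (by omega)⟩)
    (Monotone.directed_le fun i j hij b hb => Chain.mono hδ hS (hCS hp) hb (by omega))
  exact ⟨N + 1 + (N + 1), fun a ha b hb => (Chain.symm (hN ha)).trans (hN hb)⟩

lemma Chain.link (hδ : 0 < τ) (h : Chain τ S (n + 1) a b) : Link (2 * (n + 1) * τ) S a b := by
  suffices H : ∃ E, IsOpen E ∧ IsPreconnected E ∧ E ⊆ S ∧ a ∈ E ∧ b ∈ E ∧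
      ∀ x ∈ E, dist x b < (n + 1) * τ by
    obtain ⟨E, hE, hEc, hES, ha, hb, hd⟩ := H
    refine ⟨E, hE, hEc, hES, ha, hb, fun x hx y hy => ?_⟩
    have := dist_triangle_right x y b
    linarith [hd x hx, hd y hy]
  induction n generalizing b with
  | zero =>
    obtain ⟨E, hE, hEc, hES, ha, hb, hd⟩ := chain_one.1 h
    exact ⟨E, hE, hEc, hES, ha, hb, fun x hx => by simpa using hd x hx b hb⟩
  | succ n ih =>
    obtain ⟨c, hc, E', hE', hEc', hES', hc', hb', hd'⟩ := h
    obtain ⟨E, hE, hEc, hES, ha, hcE, hd⟩ := ih hc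
    refine ⟨E ∪ E', hE.union hE', hEc.union c hcE hc' hEc', union_subset hES hES', Or.inl ha,
      Or.inr hb', ?_⟩
    push_cast
    rintro x (hx | hx)
    · have := dist_triangle x c b
      linarith [hd x hx, hd' c hc' b hb']
    · have := hd' x hx b hb'
      have : 0 ≤ (n + 1 : ℝ) * τ := by positivity
      linarith

lemma Chain.regroup {k : ℕ} (hτ : 0 < τ) (hk : 1 ≤ k) (hkτ : 2 * k * τ ≤ δ)
    (h : Chain τ S (k * n) a b) : Chain δ S n a b := by
  induction n generalizing b with
  | zero => exact h
  | succ n ih =>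
    obtain ⟨c, hc, hcb⟩ := Chain.exists_split (n := k * n) (m := k) h
    refine ⟨c, ih hc, ?_⟩
    obtain ⟨k, rfl⟩ := Nat.exists_eq_add_of_le' hk
    obtain ⟨E, hE, hEc, hES, ha, hb, hd⟩ := hcb.link hτ
    push_cast at hkτ
    exact ⟨E, hE, hEc, hES, ha, hb, fun x hx y hy => (hd x hx y hy).trans_le hkτ⟩

variable {F : ℂ[X]} {p u : ℂ}

lemma Link.lift (hF : 0 < F.degree)
    (hT : ∀ y ∈ S, ∀ u, F.eval u ∈ ball y δ → ∀ a ∈ preComp F (ball y δ) u,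
      ∀ a' ∈ preComp F (ball y δ) u, dist a a' < τ)
    (hu : u ∈ preComp F S p) (h : Link δ S (F.eval u) b) :
    ∃ v ∈ preComp F S p, F.eval v = b ∧ Link τ (preComp F S p) u v := by
  obtain ⟨E, hE, hEc, hES, ha, hb, hd⟩ := h
  have himg := image_preComp hF hE hEc ha
  obtain ⟨v, hv, hvb⟩ : b ∈ F.eval '' preComp F E u := by rw [himg]; exact hb
  have hsub : preComp F E u ⊆ preComp F S p := by
    rw [preComp_eq hu]; exact preComp_mono F hES u
  have hball : preComp F E u ⊆ preComp F (ball (F.eval u) δ) u :=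
    preComp_mono F (fun x hx => hd x hx _ ha) u
  refine ⟨v, hsub hv, hvb, preComp F E u, isOpen_preComp F hE u, isPreconnected_preComp F E u, hsub,
    mem_preComp ha, hv, fun x hx y hy => ?_⟩
  have hself : dist (F.eval u) (F.eval u) < δ := hd _ ha _ ha
  exact hT (F.eval u) (hES ha) u hself x (hball hx) y (hball hy)

lemma Chain.lift (hF : 0 < F.degree)
    (hT : ∀ y ∈ S, ∀ u, F.eval u ∈ ball y δ → ∀ a ∈ preComp F (ball y δ) u,
      ∀ a' ∈ preComp F (ball y δ) u, dist a a' < τ)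
    (hu : u ∈ preComp F S p) (h : Chain δ S n (F.eval u) b) :
    ∃ v ∈ preComp F S p, F.eval v = b ∧ Chain τ (preComp F S p) n u v := by
  induction n generalizing b with
  | zero => exact ⟨u, hu, h, rfl⟩
  | succ n ih =>
    obtain ⟨c, hc, hcb⟩ := h
    obtain ⟨v, hv, rfl, huv⟩ := ih hc
    obtain ⟨w, hw, hwb, hvw⟩ := hcb.lift hF hT hv
    exact ⟨w, hw, hwb, v, huv, hvw⟩

/-- Lifting chains under a map of degree at most `D`. -/
lemma chain_preComp (hF : 0 < F.degree) (hτ : 0 < τ) (hS : IsOpen S)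
    (hT : ∀ y ∈ S, ∀ u, F.eval u ∈ ball y δ → ∀ a ∈ preComp F (ball y δ) u,
      ∀ a' ∈ preComp F (ball y δ) u, dist a a' < τ)
    {D : ℕ} (hD : ∀ x, {z | z ∈ preComp F S p ∧ F.eval z = x}.ncard ≤ D) {A : Set ℂ}
    (hA : IsPreconnected A) (hAG : A ⊆ preComp F S p) {ℓ : ℕ}
    (hAS : ∀ a ∈ A, ∀ b ∈ A, Chain δ S ℓ (F.eval a) (F.eval b)) (ha : a ∈ A) (hb : b ∈ A) :
    Chain τ (preComp F S p) (D * (2 * ℓ + 1) + 1) a b := by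
  classical
  have hG := isOpen_preComp F hS p
  by_contra hab
  have hlift : ∀ c ∈ A, ∃ v, (v ∈ preComp F S p ∧ F.eval v = F.eval a) ∧
      Chain τ (preComp F S p) ℓ c v := fun c hc => by
    obtain ⟨v, hv, hva, hcv⟩ := (hAS c hc a ha).lift hF hT (hAG hc)
    exact ⟨v, ⟨hv, hva⟩, hcv⟩
  have hex : ∀ i ∈ Finset.range (D + 1), ∃ c ∈ A,
      Chain τ (preComp F S p) (i * (2 * ℓ + 1) + 1 + 1) a c ∧
      ¬ Chain τ (preComp F S p) (i * (2 * ℓ + 1) + 1) a c := fun i hi => by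
    refine exists_chain_succ hτ hG hA hAG ha (by omega) hb fun h => hab ?_
    refine h.mono hτ hG (hAG ha) ?_
    have : i * (2 * ℓ + 1) ≤ D * (2 * ℓ + 1) :=
      Nat.mul_le_mul_right _ (Nat.lt_succ_iff.1 (Finset.mem_range.1 hi))
    omega
  choose! v hv hcv using hlift
  choose! c hcA hc hc' using hex
  have hfin : {z | z ∈ preComp F S p ∧ F.eval z = F.eval a}.Finite :=
    (finite_fiber hF _).subset fun z hz => hz.2
  obtain ⟨i, hi, j, hj, hij, hvij⟩ := Finset.exists_ne_map_eq_of_card_lt_of_maps_to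
    (s := Finset.range (D + 1)) (t := hfin.toFinset) (f := fun i => v (c i)) (by
      rw [Finset.card_range, ← ncard_eq_toFinset_card _ hfin]
      exact Nat.lt_succ_of_le (hD _))
    (fun i hi => by simpa using hv _ (hcA i hi))
  wlog hlt : i < j generalizing i j
  · exact this j hj i hi hij.symm hvij.symm (by omega)
  have hvij : v (c i) = v (c j) := hvij
  refine hc' j hj ?_
  have h1 := (hc i hi).trans ((hcv _ (hcA i hi)).trans (hvij ▸ (hcv _ (hcA j hj)).symm))
  refine h1.mono hτ hG (hAG ha) ?_
  have : (i + 1) * (2 * ℓ + 1) ≤ j * (2 * ℓ + 1) := Nat.mul_le_mul_right _ hlt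
  nlinarith

end

section

variable {f : ℂ[X]} {R₀ ε : ℝ} {Z : Set ℂ}

/-- Small pieces around a nonperiodic component do not return quickly. -/
lemma EscapeRadius.exists_no_return (h : EscapeRadius f R₀) (hf : 0 < f.degree) {z : ℂ}
    (hz : z ∈ filled f) (hper : ∀ k ≥ 1, kcomp f ((it f k).eval z) ≠ kcomp f z) (N : ℕ) :
    ∃ m₀, ∀ m ≥ m₀, ∀ s ≥ 1, s < N → ∀ p ∈ piece f R₀ m z, (it f s).eval p ∉ piece f R₀ m z := by
  have key : ∀ s ≥ 1, ∃ m₀, ∀ m ≥ m₀, ∀ p ∈ piece f R₀ m z,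
      (it f s).eval p ∉ piece f R₀ m z := by
    intro s hs
    have hd : Disjoint (kcomp f z) (kcomp f ((it f s).eval z)) := disjoint_left.2 fun p hp hp' =>
      hper s hs ((kcomp_eq hp').trans (kcomp_eq hp).symm)
    obtain ⟨U, V, hU, hV, hzU, hzV, hUV⟩ := SeparatedNhds.of_isCompact_isCompact
      (h.isCompact_kcomp z) (h.isCompact_kcomp ((it f s).eval z)) hd
    obtain ⟨m₀, hm₀⟩ := h.exists_piece_subset hz (hU.inter (hV.preimage (it f s).continuous))
      (subset_inter hzU fun p hp => hzV (by
        rw [← h.image_kcomp hf s hz]; exact mem_image_of_mem _ hp))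
    exact ⟨m₀, fun m hm p hp hps => disjoint_left.1 hUV (hm₀ m hm hps).1 (hm₀ m hm hp).2⟩
  choose! b hb using key
  obtain ⟨m₀, hm₀⟩ := ((finite_Iio N).image b).bddAbove
  exact ⟨m₀, fun m hm s hs hsN => hb s hs m ((hm₀ (mem_image_of_mem b hsN)).trans hm)⟩

/-- First return maps to a piece have uniformly bounded degree. -/
lemma EscapeRadius.ncard_first_return_le (h : EscapeRadius f R₀) (hf : 0 < f.degree) {m s : ℕ}
    {z u : ℂ} (hz : z ∈ filled f) (hus : (it f s).eval u ∈ piece f R₀ m z)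
    (hno : ∀ i, 0 < i → i < s → (it f i).eval u ∉ piece f R₀ m z) (x : ℂ) :
    {v | v ∈ pull f s (piece f R₀ m z) u ∧ (it f s).eval v = x}.ncard ≤ degBound f := by
  have hO := isOpen_piece (f := f) (R := R₀) m z
  refine ncard_fiber_pull_le_degBound hf s (isLemn_piece h.1 hf m (h.mem_filled_iff.1 hz m)) u hus
    ?_ x
  intro t₁ t₂ c h12 h2 _ hc1 hc2
  set O := piece f R₀ m z with hOdef
  have hc1O : (it f (s - t₁)).eval c ∈ O := preComp_mapsTo _ _ _ hc1
  have hc2O : (it f (s - t₂)).eval c ∈ O := preComp_mapsTo _ _ _ hc2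
  set c' := (it f (s - t₂)).eval c with hc'
  have hsum : t₂ - t₁ + (s - t₂) = s - t₁ := by omega
  have hc'O : (it f (t₂ - t₁)).eval c' ∈ O := by
    rw [hc', ← eval_it_add, hsum]; exact hc1O
  have himg := image_pull_add hf (t₂ - t₁) (s - t₂) hO (u := c) (by rw [hsum]; exact hc1O)
  rw [hsum, ← hc'] at himg
  have hnorm : ‖(it f (m + (t₂ - t₁))).eval c'‖ < R₀ := by
    rw [eval_it_add]
    exact norm_it_lt_of_mem_piece hc'O
  have hpiece := piece_add m (t₂ - t₁) hnorm
  rw [← piece_eq hc'O] at hpiece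
  have hsub : pull f (t₂ - t₁) O c' ⊆ O := by
    rw [← hpiece, hOdef, piece_eq hc2O]
    exact h.piece_anti (by omega) hnorm
  refine hno (s - (t₂ - t₁)) (by omega) (by omega) (hsub ?_)
  rw [← himg]
  refine ⟨(it f t₁).eval u, ?_, ?_⟩
  · have : pull f (s - t₁) O ((it f t₁).eval u) = pull f (s - t₁) O c := preComp_eq hc1
    rw [← this]
    refine mem_preComp ?_
    rw [← eval_it_add, show s - t₁ + t₁ = s by omega]
    exact hus
  · change (it f (s - t₂)).eval ((it f t₁).eval u) = _
    rw [← eval_it_add, show s - t₂ + t₁ = s - (t₂ - t₁) by omega]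

/-- One backward step between consecutive visits of the orbit of `u` to a piece. -/
lemma EscapeRadius.chain_step (h : EscapeRadius f R₀) (hf : 0 < f.degree) {m s g : ℕ} {z u : ℂ}
    (hz : z ∈ filled f) (hu : u ∈ filled f) (hus : (it f s).eval u ∈ piece f R₀ m z)
    (hno : ∀ i, 0 < i → i < s → (it f i).eval u ∉ piece f R₀ m z) {δ τ : ℝ} (hτ : 0 < τ)
    (hτδ : 16 * degBound f * τ ≤ δ)
    (hT : ∀ y ∈ piece f R₀ m z, ∀ u, (it f s).eval u ∈ ball y δ → ∀ a ∈ pull f s (ball y δ) u,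
      ∀ a' ∈ pull f s (ball y δ) u, dist a a' < τ) {ℓ : ℕ} (hℓ : 1 ≤ ℓ)
    (hch : ∀ a ∈ piece f R₀ (m + 1 + g) ((it f s).eval u),
      ∀ b ∈ piece f R₀ (m + 1 + g) ((it f s).eval u),
        Chain δ (piece f R₀ (m + g) ((it f s).eval u)) ℓ a b) :
    ∀ a ∈ piece f R₀ (m + 1 + (g + s)) u, ∀ b ∈ piece f R₀ (m + 1 + (g + s)) u,
      Chain δ (piece f R₀ (m + (g + s)) u) (max 1 (ℓ - 1)) a b := by
  have hR : ∀ m, ‖(it f m).eval u‖ < R₀ := fun m => h.mem_filled_iff.1 hu m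
  have husK := (h.mem_filled_it s).2 hu
  have hD1 : 1 ≤ degBound f := Nat.one_le_pow _ _ (natDegree_pos_iff_degree_pos.2 hf)
  have hSO : piece f R₀ (m + g) ((it f s).eval u) ⊆ piece f R₀ m z := by
    rw [piece_eq hus]
    exact h.piece_anti (by omega) (h.mem_filled_iff.1 husK _)
  have hpa : piece f R₀ (m + (g + s)) u =
      preComp (it f s) (piece f R₀ (m + g) ((it f s).eval u)) u := by
    rw [← add_assoc, piece_add (m + g) s (hR _)]; rfl
  have himg := image_piece hf (m + 1 + g) s (hR _)
  rw [hpa]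
  intro a ha b hb
  have hfib : ∀ x, {v | v ∈ preComp (it f s) (piece f R₀ (m + g) ((it f s).eval u)) u ∧
      (it f s).eval v = x}.ncard ≤ degBound f := fun x => by
    refine (ncard_le_ncard ?_ ?_).trans (h.ncard_first_return_le hf hz hus hno x)
    · exact fun v hv => ⟨preComp_mono _ hSO u hv.1, hv.2⟩
    · exact (finite_fiber (degree_it_pos hf s) x).subset fun v hv => hv.2
  have hmem : ∀ a ∈ piece f R₀ (m + 1 + (g + s)) u,
      (it f s).eval a ∈ piece f R₀ (m + 1 + g) ((it f s).eval u) := fun a ha => by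
    rw [← himg, add_assoc]; exact mem_image_of_mem _ ha
  have hlong := chain_preComp (degree_it_pos hf s) hτ (isOpen_piece _ _)
    (fun y hy => hT y (hSO hy)) hfib (isPreconnected_piece (m + 1 + (g + s)) u)
    (by rw [← hpa]; exact h.piece_anti (by omega) (hR _))
    (fun a ha b hb => hch _ (hmem a ha) _ (hmem b hb)) ha hb
  have haG : a ∈ preComp (it f s) (piece f R₀ (m + g) ((it f s).eval u)) u := by
    rw [← hpa]; exact h.piece_anti (by omega) (hR _) ha
  refine Chain.regroup (k := 8 * degBound f) hτ (by omega) (by push_cast; linarith)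
    (hlong.mono hτ (isOpen_preComp _ (isOpen_piece _ _) _) haG ?_)
  generalize degBound f = D at hD1
  rcases hℓ.eq_or_lt with rfl | hlt
  · simp; omega
  · obtain ⟨j, rfl⟩ := Nat.exists_eq_add_of_le' (show 2 ≤ ℓ from hlt)
    have : max 1 (j + 2 - 1) = j + 1 := by omega
    rw [this]
    nlinarith

lemma EscapeRadius.chain_of_visits (h : EscapeRadius f R₀) (hf : 0 < f.degree) {m N : ℕ} {z x : ℂ}
    (hz : z ∈ filled f) (hx : x ∈ filled f)
    (hret : ∀ s ≥ 1, s < N → ∀ p ∈ piece f R₀ m z, (it f s).eval p ∉ piece f R₀ m z)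
    {δ τ : ℝ} (hδ : 0 < δ) (hτ : 0 < τ) (hτδ : 16 * degBound f * τ ≤ δ)
    (hT : ∀ k ≥ N, ∀ y ∈ piece f R₀ m z, ∀ u, (it f k).eval u ∈ ball y δ →
      ∀ a ∈ pull f k (ball y δ) u, ∀ a' ∈ pull f k (ball y δ) u, dist a a' < τ) {L : ℕ}
    (hL : ∀ a ∈ piece f R₀ (m + 1) z, ∀ b ∈ piece f R₀ (m + 1) z, Chain δ (piece f R₀ m z) L a b)
    (V : Finset ℕ) (g t : ℕ) (hV : ∀ i ∈ V, t < i ∧ i ≤ t + g ∧ (it f i).eval x ∈ piece f R₀ m z)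
    (ht : (it f t).eval x ∈ piece f R₀ m z)
    (hTt : (it f (t + g)).eval x ∈ piece f R₀ (m + 1) z) :
    ∀ a ∈ piece f R₀ (m + 1 + g) ((it f t).eval x),
      ∀ b ∈ piece f R₀ (m + 1 + g) ((it f t).eval x),
        Chain δ (piece f R₀ (m + g) ((it f t).eval x)) (max 1 (L - V.card)) a b := by
  classical
  induction g using Nat.strong_induction_on generalizing t V with
  | _ g ih =>
  have hxt := (h.mem_filled_it t).2 hx
  rcases Nat.eq_zero_or_pos g with rfl | hg
  · have hV0 : V = ∅ := Finset.eq_empty_of_forall_notMem fun i hi => by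
      have := hV i hi; omega
    subst hV0
    intro a ha b hb
    simp only [add_zero, Finset.card_empty, Nat.sub_zero] at *
    rw [← piece_eq hTt] at ha hb
    rw [← piece_eq ht]
    exact (hL a ha b hb).mono hδ (isOpen_piece _ _)
      (h.piece_anti (by omega) (h.mem_filled_iff.1 hz _) ha) (le_max_right _ _)
  · -- the next visit
    have hex : ∃ s, 1 ≤ s ∧ (it f (s + t)).eval x ∈ piece f R₀ m z :=
      ⟨g, hg, h.piece_anti (show m ≤ m + 1 by omega) (h.mem_filled_iff.1 hz _)
        (by rw [add_comm g t]; exact hTt)⟩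
    set s := Nat.find hex with hsdef
    obtain ⟨hs1, hsx⟩ := Nat.find_spec hex
    rw [← hsdef] at hs1 hsx
    have hmin : ∀ i, 1 ≤ i → i < s → (it f (i + t)).eval x ∉ piece f R₀ m z := fun i hi1 hi hix =>
      Nat.find_min hex hi ⟨hi1, hix⟩
    have hsg : s ≤ g := Nat.find_min' hex ⟨hg, h.piece_anti (show m ≤ m + 1 by omega)
      (h.mem_filled_iff.1 hz _) (by rw [add_comm g t]; exact hTt)⟩
    have hsN : N ≤ s := by
      by_contra! hlt
      exact hret s hs1 hlt _ ht (by rwa [← eval_it_add])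
    have hV' := ih (g - s) (by omega) (V.erase (s + t)) (s + t) (fun i hi => by
      obtain ⟨hne, hiV⟩ := Finset.mem_erase.1 hi
      obtain ⟨h1, h2, h3⟩ := hV i hiV
      have : ¬ (i - t < s) := fun hlt => hmin (i - t) (by omega) hlt (by
        rwa [Nat.sub_add_cancel h1.le])
      exact ⟨by omega, by omega, h3⟩) hsx (by rwa [show s + t + (g - s) = t + g by omega])
    rw [eval_it_add] at hV'
    have hstep := h.chain_step hf (g := g - s) hz hxt (by rwa [← eval_it_add])
      (fun i hi1 his => by rw [← eval_it_add]; exact hmin i hi1 his) hτ hτδ (hT s hsN)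
      (le_max_left _ _) hV'
    rw [Nat.sub_add_cancel hsg] at hstep
    intro a ha b hb
    refine (hstep a ha b hb).mono hδ (isOpen_piece _ _)
      (h.piece_anti (by omega) (h.mem_filled_iff.1 hxt _) ha) ?_
    have := Finset.pred_card_le_card_erase (s := V) (a := s + t)
    omega

theorem CritControl.kcomp_subsingleton (S : CritControl f R₀ Z ε) {x z : ℂ} (hx : x ∈ filled f)
    (hz : z ∈ filled f) (hd : Disjoint (kcomp f z) Z)
    (hper : ∀ k ≥ 1, kcomp f ((it f k).eval z) ≠ kcomp f z)
    (hzx : MapClusterPt z atTop fun n => (it f n).eval x) : (kcomp f x).Subsingleton := by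
  have h := S.esc
  have hf := S.deg
  have hR : ∀ m, ‖(it f m).eval z‖ < R₀ := fun m => h.mem_filled_iff.1 hz m
  obtain ⟨δ, hδ, O, hO, hzO, hT⟩ := S.exists_forall_dist_lt hz hd
  have hD1 : 1 ≤ degBound f := Nat.one_le_pow _ _ (natDegree_pos_iff_degree_pos.2 hf)
  have hD0 : (0 : ℝ) < degBound f := by exact_mod_cast hD1
  obtain ⟨N, hN⟩ := hT (δ / (16 * degBound f)) (by positivity)
  obtain ⟨m₁, hm₁⟩ := h.exists_piece_subset hz hO hzO
  obtain ⟨m₂, hm₂⟩ := h.exists_no_return hf hz hper N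
  set m := max m₁ m₂ with hm
  have hmO := hm₁ m (le_max_left _ _)
  obtain ⟨L, hL⟩ := exists_uniform_chain hδ (isOpen_piece (f := f) (R := R₀) m z)
    (isPreconnected_piece m z) (h.isCompact_closure_piece (m + 1) (hR _))
    (h.closure_piece_subset (Nat.lt_succ_self m) (hR _))
  have hinf : ∀ n₀, ∃ n ≥ n₀, (it f n).eval x ∈ piece f R₀ (m + 1) z := fun n₀ =>
    frequently_atTop.1 (hzx.frequently ((isOpen_piece (m + 1) z).mem_nhds
      (mem_piece_iff_self.2 (hR _)))) n₀
  have hmm : piece f R₀ (m + 1) z ⊆ piece f R₀ m z := h.piece_anti (by omega) (hR _)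
  -- at every visit, the component is small
  have hsmall : ∀ t, (it f t).eval x ∈ piece f R₀ m z →
      ∀ a ∈ kcomp f ((it f t).eval x), dist a ((it f t).eval x) < δ := by
    intro t ht a ha
    have hWinf : {i | t < i ∧ (it f i).eval x ∈ piece f R₀ (m + 1) z}.Infinite := by
      refine infinite_of_not_bddAbove fun ⟨B, hB⟩ => ?_
      obtain ⟨n, hn, hnx⟩ := hinf (max B t + 1)
      have := hB (show n ∈ _ from ⟨by omega, hnx⟩)
      omega
    obtain ⟨W, hW, hWcard⟩ := hWinf.exists_subset_card_eq (L + 1)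
    have hWne : W.Nonempty := Finset.card_pos.1 (by omega)
    have hmax := hW (W.max'_mem hWne)
    set T := W.max' hWne with hTdef
    have hxt := (h.mem_filled_it t).2 hx
    have hlink := h.chain_of_visits hf hz hx (hm₂ m (le_max_right _ _)) hδ
      (τ := δ / (16 * degBound f)) (by positivity) (by field_simp; exact le_rfl)
      (fun k hk y hy => hN k hk y (hmO hy))
      (fun a ha b hb => hL a (subset_closure ha) b (subset_closure hb)) W (T - t) t
      (fun i hi => ⟨(hW hi).1, by have := W.le_max' i hi; have := hmax.1; omega, hmm (hW hi).2⟩) ht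
      (by rw [Nat.add_sub_cancel' hmax.1.le]; exact hmax.2)
      a (h.kcomp_subset_piece hxt _ ha) _ (mem_piece_iff_self.2 (h.mem_filled_iff.1 hxt _))
    rw [show max 1 (L - W.card) = 1 by omega, chain_one] at hlink
    obtain ⟨E, -, -, -, haE, hxE, hE⟩ := hlink
    exact hE _ haE _ hxE
  intro a ha b hb
  rw [← dist_le_zero]
  refine le_of_forall_pos_lt_add fun τ hτ => ?_
  obtain ⟨k₀, hk₀⟩ := hT τ hτ
  obtain ⟨t, ht, htx⟩ := hinf k₀
  have hsub : kcomp f x ⊆ pull f t (ball ((it f t).eval x) δ) x :=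
    subset_preComp (isPreconnected_kcomp f x) (fun p hp => hsmall t (hmm htx) _ (by
      rw [← h.image_kcomp hf t hx]; exact mem_image_of_mem _ hp)) (mem_kcomp hx)
  rw [zero_add]
  exact hk₀ t ht _ (hmO (hmm htx)) x (mem_ball_self hδ) a (hsub ha) b (hsub hb)

lemma wand_iff (h : EscapeRadius f R₀) (hf : 0 < f.degree) {x : ℂ} (hx : x ∈ filled f) :
    Wand f x ↔ ∀ n m : ℕ, 1 ≤ m →
      (fun w : ℂ => f.eval w)^[n + m] '' connectedComponentIn (filled f) x ≠
        (fun w : ℂ => f.eval w)^[n] '' connectedComponentIn (filled f) x := by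
  have key : ∀ n, (fun w : ℂ => f.eval w)^[n] '' connectedComponentIn (filled f) x =
      kcomp f ((it f n).eval x) := fun n => by
    rw [← h.image_kcomp hf n hx]
    exact image_congr fun w _ => (eval_it f n w).symm
  simp only [Wand, key]

end

end Wandering

open Wandering in
/-- **(Yin.)** Let `f` be a complex polynomial of degree `≥ 2` such that every critical
point lying in a wandering component of the filled-in Julia set is non-recurrent
(i.e. not in its own ω-limit set). Then every wandering component of the filled-in
Julia set is a single point. -/
theorem wandering_components_points_of_nonrecurrent_critical
    (f : Polynomial ℂ) (d : ℕ) (hd : 2 ≤ d) (hdeg : f.natDegree = d)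
    (Kf : Set ℂ)
    (hKf : Kf = {z : ℂ | Bornology.IsBounded
      (Set.range fun n : ℕ => (fun w : ℂ => f.eval w)^[n] z)})
    (hcrit : ∀ c : ℂ, f.derivative.eval c = 0 → c ∈ Kf →
      (∀ n m : ℕ, 1 ≤ m →
        (fun w : ℂ => f.eval w)^[n + m] '' connectedComponentIn Kf c ≠
          (fun w : ℂ => f.eval w)^[n] '' connectedComponentIn Kf c) →
      ¬ MapClusterPt c Filter.atTop (fun n : ℕ => (fun w : ℂ => f.eval w)^[n] c)) :
    ∀ x ∈ Kf,
      (∀ n m : ℕ, 1 ≤ m →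
        (fun w : ℂ => f.eval w)^[n + m] '' connectedComponentIn Kf x ≠
          (fun w : ℂ => f.eval w)^[n] '' connectedComponentIn Kf x) →
      connectedComponentIn Kf x = {x} := by
  have hK : Kf = filled f := by simp only [hKf, filled, eval_it]
  clear hKf
  subst hK
  subst hdeg
  obtain ⟨R₀, h⟩ := exists_escapeRadius hd
  have hf : 0 < f.degree := Polynomial.natDegree_pos_iff_degree_pos.1 (by omega)
  obtain ⟨Z, ε, Q, S, hQ, hQZ⟩ := exists_critControl h hf (fun c hc hcK hw => by
    simp only [eval_it]
    exact hcrit c hc hcK ((wand_iff h hf hcK).1 hw))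
  intro x hx hw
  obtain ⟨z, hz, hzx, hzQ, hper⟩ := hQ.exists_nonperiodic h hf hx ((wand_iff h hf hx).2 hw)
  exact (S.kcomp_subsingleton hx hz (hQZ z hz hzQ) hper hzx).eq_singleton_of_mem (mem_kcomp hx)
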